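/- Every two-dimensional Artin group A_S is torsion-free: the only element of A_S of finite order is the identity. -/

import Mathlib

open scoped ENNReal

/-- The alternating word `s t s t ⋯` of length `m`. -/
def altWord {G : Type*} [Monoid G] (s t : G) : ℕ → G
  | 0 => 1
  | n + 1 => s * altWord t s n

/-- The Artin relations associated to a matrix of exponents `M : S → S → ℕ∞`:
for each pair `s ≠ t` with `M s t = n < ∞`, the relation
`prod(s,t;n) = prod(t,s;n)`. -/
def artinRels {S : Type*} (M : S → S → ℕ∞) : Set (FreeGroup S) :=
  { w | ∃ s t : S, s ≠ t ∧ ∃ n : ℕ, M s t = (n : ℕ∞) ∧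
      w = altWord (FreeGroup.of s) (FreeGroup.of t) n *
        (altWord (FreeGroup.of t) (FreeGroup.of s) n)⁻¹ }

/-- The Artin group with generating set `S` and exponents `M`. -/
abbrev ArtinGroup {S : Type*} (M : S → S → ℕ∞) := PresentedGroup (artinRels M)

/-- The Artin group is two-dimensional if `1/m_{st} + 1/m_{tr} + 1/m_{sr} ≤ 1` for all
pairwise distinct `s, t, r ∈ S` (with the convention `1/∞ = 0`). -/
def TwoDimensional {S : Type*} (M : S → S → ℕ∞) : Prop :=
  ∀ s t r : S, s ≠ t → t ≠ r → s ≠ r →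
    ((M s t : ℝ≥0∞))⁻¹ + ((M t r : ℝ≥0∞))⁻¹ + ((M s r : ℝ≥0∞))⁻¹ ≤ 1

namespace Pride

open FreeGroup hiding map_mul map_inv map_one

variable {S : Type*}

theorem red_sub {l m : List (S × Bool)} (h : FreeGroup.IsReduced m) (hs : l <:+: m) :
    FreeGroup.IsReduced l := by
  obtain ⟨s, t, rfl⟩ := hs
  exact List.IsChain.right_of_append (List.IsChain.left_of_append h)

/-- Inverse letter. -/
def linv (a : S × Bool) : S × Bool := (a.1, !a.2)

@[simp] theorem linv_fst (a : S × Bool) : (linv a).1 = a.1 := rfl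
@[simp] theorem linv_linv (a : S × Bool) : linv (linv a) = a := by simp [linv]
theorem linv_ne (a : S × Bool) : linv a ≠ a := by
  intro h; have := congrArg Prod.snd h; simp [linv] at this
theorem linv_inj {a b : S × Bool} (h : linv a = linv b) : a = b := by
  rw [← linv_linv a, h, linv_linv]

theorem ne_linv_iff (a b : S × Bool) : (a.1 = b.1 → a.2 = b.2) ↔ b ≠ linv a := by
  obtain ⟨a, x⟩ := a
  obtain ⟨b, y⟩ := b
  constructor
  · rintro h h2
    simp only [linv, Prod.mk.injEq] at h2
    have := h h2.1.symm
    rw [h2.2] at this; simp at this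
  · intro h e
    simp only at e; subst e
    by_contra h3
    apply h
    simp only [linv, Prod.mk.injEq, true_and]
    revert h3; cases x <;> cases y <;> simp

theorem mk_linv (a : S × Bool) : (FreeGroup.mk [linv a]) = (FreeGroup.mk [a])⁻¹ := by
  rw [FreeGroup.inv_mk]; simp [FreeGroup.invRev, linv]

theorem mk_cons (a : S × Bool) (l : List (S × Bool)) :
    FreeGroup.mk (a :: l) = FreeGroup.mk [a] * FreeGroup.mk l := by
  rw [FreeGroup.mul_mk]; rfl

theorem mk_append (l m : List (S × Bool)) :
    FreeGroup.mk (l ++ m) = FreeGroup.mk l * FreeGroup.mk m := by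
  rw [FreeGroup.mul_mk]

theorem mk_nil : (FreeGroup.mk ([] : List (S × Bool))) = 1 := rfl

theorem isReduced_cons_cons' {a b : S × Bool} {l : List (S × Bool)} :
    IsReduced (a :: b :: l) ↔ b ≠ linv a ∧ IsReduced (b :: l) := by
  rw [← ne_linv_iff]
  simp [FreeGroup.IsReduced]

theorem eq_of_mk_eq {l m : List (S × Bool)} (hl : IsReduced l) (hm : IsReduced m)
    (h : FreeGroup.mk l = FreeGroup.mk m) : l = m := by
  classical
  have := congrArg FreeGroup.toWord h
  rwa [toWord_mk, toWord_mk, hl.reduce_eq, hm.reduce_eq] at this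

theorem exists_red (x : FreeGroup S) : ∃ l, IsReduced l ∧ FreeGroup.mk l = x := by
  classical
  exact ⟨x.toWord, isReduced_toWord, mk_toWord⟩

/-- elements whose reduced word starts with `e` -/
def St (e : S × Bool) : Set (FreeGroup S) :=
  {x | ∃ z, IsReduced (e :: z) ∧ x = FreeGroup.mk (e :: z)}

theorem isReduced_append_singleton {l : List (S × Bool)} {a : S × Bool} (hl : IsReduced l)
    (h : ∀ b ∈ l.getLast?, a ≠ linv b) : IsReduced (l ++ [a]) := by
  unfold FreeGroup.IsReduced at *
  rw [List.isChain_append]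
  refine ⟨hl, by simp, ?_⟩
  intro x hx y hy
  simp at hy; subst hy
  rw [ne_linv_iff]; exact h x hx

theorem St_enter {e a : S × Bool} {h : FreeGroup S} (h1 : h ∉ St e)
    (h2 : h * FreeGroup.mk [a] ∈ St e) : h = 1 ∧ a = e := by
  obtain ⟨l, hl, rfl⟩ := exists_red h
  by_cases hc : ∀ b ∈ l.getLast?, a ≠ linv b
  · have hr := isReduced_append_singleton hl hc
    obtain ⟨z, hz, hz2⟩ := h2
    rw [← mk_append] at hz2
    have := eq_of_mk_eq hr hz hz2
    cases l with
    | nil => simp at this; exact ⟨rfl, this.1⟩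
    | cons b l =>
      exfalso; apply h1
      simp at this
      exact ⟨l, this.1 ▸ hl, by rw [this.1]⟩
  · push Not at hc
    obtain ⟨b, hb, rfl⟩ := hc
    exfalso
    obtain ⟨l', rfl⟩ : ∃ l', l = l' ++ [b] := by
      exact (List.mem_getLast?_eq_getLast hb).elim fun h1 h2 => ⟨l.dropLast, by rw [h2, List.dropLast_append_getLast]⟩
    rw [mk_append, mk_linv, mul_inv_cancel_right] at h2
    obtain ⟨z, hz, hz2⟩ := h2
    have hl' : IsReduced l' := red_sub hl ⟨[], [b], by simp⟩
    have := eq_of_mk_eq hl' hz hz2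
    subst this
    exact h1 ⟨z ++ [b], by simpa using hl, by simp⟩

theorem follow_front {e : S × Bool} (Λ : List (S × Bool)) : ∀ {h : FreeGroup S}, h ∉ St e →
    h * FreeGroup.mk Λ ∈ St e → ∃ Λ1 Λ2, Λ = Λ1 ++ e :: Λ2 ∧ h * FreeGroup.mk Λ1 = 1 := by
  induction Λ with
  | nil => intro h h1 h2; rw [mk_nil, mul_one] at h2; exact absurd h2 h1
  | cons a Λ ih =>
    intro h h1 h2
    by_cases hh : h * FreeGroup.mk [a] ∈ St e
    · obtain ⟨rfl, rfl⟩ := St_enter h1 hh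
      exact ⟨[], Λ, rfl, by simp [mk_nil]⟩
    · rw [mk_cons, ← mul_assoc] at h2
      obtain ⟨Λ1, Λ2, rfl, h3⟩ := ih hh h2
      exact ⟨a :: Λ1, Λ2, rfl, by rw [mk_cons, ← mul_assoc, h3]⟩

theorem one_not_St (e : S × Bool) : (1 : FreeGroup S) ∉ St e := by
  rintro ⟨z, hz, h⟩
  have := eq_of_mk_eq (l := []) (by simp) hz h
  simp at this

/-- cyclic reducedness, concretely -/
theorem cr_iff {l : List (S × Bool)} : IsCyclicallyReduced l ↔
    IsReduced l ∧ ∀ a ∈ l.getLast?, ∀ b ∈ l.head?, b ≠ linv a := by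
  unfold IsCyclicallyReduced
  simp only [ne_linv_iff]

theorem isReduced_append_iff {l m : List (S × Bool)} : IsReduced (l ++ m) ↔
    IsReduced l ∧ IsReduced m ∧ ∀ a ∈ l.getLast?, ∀ b ∈ m.head?, b ≠ linv a := by
  unfold FreeGroup.IsReduced
  rw [List.isChain_append]
  simp only [ne_linv_iff]

theorem cr_rotate {l m : List (S × Bool)} (h : IsCyclicallyReduced (l ++ m)) :
    IsCyclicallyReduced (m ++ l) := by
  rcases List.eq_nil_or_concat l with rfl | ⟨l', a, rfl⟩
  · simpa using h
  rcases List.eq_nil_or_concat m with rfl | ⟨m', b, rfl⟩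
  · simpa using h
  rw [cr_iff] at *
  obtain ⟨h1, h2⟩ := h
  rw [isReduced_append_iff] at *
  refine ⟨⟨h1.2.1, h1.1, ?_⟩, ?_⟩
  · intro x hx y hy
    apply h2 x (by rw [List.getLast?_append]; simpa using hx) y
    cases l' <;> simpa using hy
  · intro x hx y hy
    apply h1.2.2 x (by rw [List.getLast?_append] at hx; simpa using hx) y
    cases m' <;> simpa using hy

theorem invRev_append' (l m : List (S × Bool)) : invRev (l ++ m) = invRev m ++ invRev l := by
  simp [invRev]

theorem invRev_cons' (a : S × Bool) (m : List (S × Bool)) :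
    invRev (a :: m) = invRev m ++ [linv a] := by
  simp [invRev, linv]

theorem mk_invRev (l : List (S × Bool)) : FreeGroup.mk (invRev l) = (FreeGroup.mk l)⁻¹ := by
  rw [FreeGroup.inv_mk]

theorem red_invRev {l : List (S × Bool)} (h : IsReduced l) : IsReduced (invRev l) := by
  classical
  rw [isReduced_iff_reduce_eq] at *
  rw [← h, reduce_invRev, h, h]

theorem getLast?_invRev (l : List (S × Bool)) : (invRev l).getLast? = l.head?.map linv := by
  cases l with
  | nil => rfl
  | cons a l => rw [invRev_cons']; simp

theorem head?_invRev (l : List (S × Bool)) : (invRev l).head? = l.getLast?.map linv := by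
  rcases List.eq_nil_or_concat l with rfl | ⟨l', a, rfl⟩
  · rfl
  · rw [List.concat_eq_append, invRev_append']; simp [invRev, linv]

theorem cr_invRev {l : List (S × Bool)} (h : IsCyclicallyReduced l) :
    IsCyclicallyReduced (invRev l) := by
  rw [cr_iff] at *
  refine ⟨red_invRev h.1, ?_⟩
  rw [getLast?_invRev, head?_invRev]
  simp only [Option.mem_def, Option.map_eq_some_iff]
  rintro _ ⟨a, ha, rfl⟩ _ ⟨b, hb, rfl⟩ h3
  apply h.2 b hb a ha
  rw [linv_linv] at h3; rw [← h3]

/-- every word is conjugate to a cyclically reduced one -/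
theorem exists_cr (l : List (S × Bool)) (h : IsReduced l) : ∃ p u, l = p ++ u ++ invRev p ∧
    IsCyclicallyReduced u := by
  classical
  refine ⟨reduceCyclically.conjugator l, reduceCyclically l, ?_, ?_⟩
  · exact (reduceCyclically.conj_conjugator_reduceCyclically l).symm
  · exact reduceCyclically.isCyclicallyReduced h

end Pride

namespace Pride

open FreeGroup hiding map_mul map_inv map_one

variable {S : Type*}

/-- value of a two-letter function at the junction of two words -/
def jn (φ : S × Bool → S × Bool → ℝ) (p q : List (S × Bool)) : ℝ :=
  match p.getLast?, q.head? with
  | some a, some b => φ a b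
  | _, _ => 0

/-- sum of a two-letter function over consecutive letters of a word -/
def lsum (φ : S × Bool → S × Bool → ℝ) : List (S × Bool) → ℝ
  | [] => 0
  | [_] => 0
  | a :: b :: l => φ a b + lsum φ (b :: l)

/-- two-letter function from a function of labels -/
def lc (c : S → S → ℝ) (a b : S × Bool) : ℝ := c a.1 b.1

/-- A system of face groups in a group over the free group. -/
structure Sys (S Γ I : Type*) [Group Γ] where
  ι : FreeGroup S →* Γ
  π : Γ →* FreeGroup S
  πι : ∀ x, π (ι x) = x
  lab : I → Set S
  K : I → Subgroup Γ
  c : S → S → ℝ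
  cen : ∀ i k f, π k = 1 → f ∈ K i → k * f = f * k
  norm : ∀ i (a : S × Bool) f, a.1 ∈ lab i → f ∈ K i →
    ι (FreeGroup.mk [a]) * f * (ι (FreeGroup.mk [a]))⁻¹ ∈ K i
  inj : ∀ i f, f ∈ K i → π f = 1 → f = 1
  lett : ∀ i f l, f ∈ K i → IsReduced l → π f = FreeGroup.mk l → ∀ a ∈ l, a.1 ∈ lab i
  csymm : ∀ s t, c s t = c t s
  cself : ∀ s, c s s = 0
  cnonneg : ∀ s t, 0 ≤ c s t
  chalf : ∀ s t, c s t ≤ 1 / 2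
  ctri : ∀ s t r, c s t + c t r + c s r ≤ 1
  lab_eq : ∀ i j s t, s ≠ t → s ∈ lab i → t ∈ lab i → s ∈ lab j → t ∈ lab j → i = j
  syl : ∀ i f u, f ∈ K i → IsCyclicallyReduced u → u ≠ [] → π f = FreeGroup.mk u →
    2 ≤ lsum (lc c) u + jn (lc c) u u

variable {Γ I : Type*} [Group Γ] (Y : Sys S Γ I)

namespace Sys

/-- lift of a word -/
def W (l : List (S × Bool)) : Γ := Y.ι (FreeGroup.mk l)

@[simp] theorem W_nil : Y.W [] = 1 := by unfold W; rw [mk_nil, map_one]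
theorem W_append (l m : List (S × Bool)) : Y.W (l ++ m) = Y.W l * Y.W m := by
  unfold W; rw [mk_append, map_mul]
theorem W_cons (a : S × Bool) (m : List (S × Bool)) : Y.W (a :: m) = Y.W [a] * Y.W m := by
  unfold W; rw [mk_cons, map_mul]
theorem W_linv (a : S × Bool) : Y.W [linv a] = (Y.W [a])⁻¹ := by
  unfold W; rw [mk_linv, map_inv]
theorem W_invRev (l : List (S × Bool)) : Y.W (invRev l) = (Y.W l)⁻¹ := by
  unfold W; rw [mk_invRev, map_inv]
@[simp] theorem π_W (l : List (S × Bool)) : Y.π (Y.W l) = FreeGroup.mk l := Y.πι _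

/-- elements which are products of at most `n` conjugates of elements of face groups -/
inductive Ar : ℕ → Γ → Prop
  | one : Ar 0 1
  | cons (n : ℕ) (x : Γ) (i : I) (f g : Γ) : Ar n x → f ∈ Y.K i → Ar (n + 1) (g * f * g⁻¹ * x)

variable {Y}

theorem Ar.mul {n m : ℕ} {x y : Γ} (hx : Y.Ar n x) (hy : Y.Ar m y) : Y.Ar (n + m) (x * y) := by
  induction hx with
  | one => simpa using hy
  | cons n x i f g hx hf ih =>
    have := Ar.cons _ _ i f g ih hf
    rw [mul_assoc, show n + 1 + m = n + m + 1 by ring]; exact this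

theorem Ar.of {i : I} {f : Γ} (hf : f ∈ Y.K i) : Y.Ar 1 f := by
  simpa using Ar.cons 0 1 i f 1 Ar.one hf

theorem Ar.conj {n : ℕ} {x : Γ} (hx : Y.Ar n x) (h : Γ) : Y.Ar n (h * x * h⁻¹) := by
  induction hx with
  | one => simpa using Ar.one
  | cons n x i f g hx hf ih =>
    have := Ar.cons _ _ i f (h * g) ih hf
    convert this using 1; group

theorem Ar.conj' {n : ℕ} {x : Γ} (hx : Y.Ar n x) (h : Γ) : Y.Ar n (h⁻¹ * x * h) := by
  simpa using hx.conj h⁻¹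

theorem Ar.inv {n : ℕ} {x : Γ} (hx : Y.Ar n x) : Y.Ar n x⁻¹ := by
  induction hx with
  | one => simpa using Ar.one
  | cons n x i f g hx hf ih =>
    have h2 := ((Ar.of ((Y.K i).inv_mem hf)).conj g)
    have := ih.mul h2
    convert this using 1; group

theorem Ar.mono_succ {n : ℕ} {x : Γ} (i : I) (hx : Y.Ar n x) : Y.Ar (n + 1) x := by
  simpa using Ar.cons n x i 1 1 hx (Y.K i).one_mem

theorem Ar.zero {n : ℕ} {x : Γ} (hx : Y.Ar n x) (h : n = 0) : x = 1 := by
  cases hx with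
  | one => rfl
  | cons => omega

theorem Ar.cen {n : ℕ} {x k : Γ} (hx : Y.Ar n x) (hk : Y.π k = 1) : k * x = x * k := by
  induction hx with
  | one => simp
  | cons n x i f g hx hf ih =>
    have h1 : Y.π (g⁻¹ * k * g) = 1 := by simp [hk]
    have h2 := Y.cen i _ f h1 hf
    calc k * (g * f * g⁻¹ * x) = g * ((g⁻¹ * k * g) * f) * g⁻¹ * x := by group
      _ = g * f * g⁻¹ * (k * x) := by rw [h2]; group
      _ = _ := by rw [ih]; group

/-- conjugation of `Ar` elements only depends on the image in the free group -/
theorem Ar.conj_eq {n : ℕ} {x g h : Γ} (hx : Y.Ar n x) (hk : Y.π g = Y.π h) :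
    g * x * g⁻¹ = h * x * h⁻¹ := by
  have := hx.cen (k := h⁻¹ * g) (by simp [hk])
  calc g * x * g⁻¹ = h * (h⁻¹ * g * x) * g⁻¹ := by group
    _ = _ := by rw [this]; group

variable (Y)

theorem norm_list {i : I} (l : List (S × Bool)) {f : Γ} (hl : ∀ a ∈ l, a.1 ∈ Y.lab i)
    (hf : f ∈ Y.K i) : Y.W l * f * (Y.W l)⁻¹ ∈ Y.K i := by
  induction l with
  | nil => simpa using hf
  | cons a l ih =>
    have := Y.norm i a _ (hl a (by simp)) (ih fun b hb => hl b (by simp [hb]))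
    rw [W_cons]
    convert this using 1
    unfold W; group

theorem norm_list' {i : I} (l : List (S × Bool)) {f : Γ} (hl : ∀ a ∈ l, a.1 ∈ Y.lab i)
    (hf : f ∈ Y.K i) : (Y.W l)⁻¹ * f * Y.W l ∈ Y.K i := by
  have := Y.norm_list (i := i) (invRev l) (f := f) ?_ hf
  · rw [W_invRev] at this; simpa using this
  · intro a ha
    simp only [invRev, List.mem_reverse, List.mem_map] at ha
    obtain ⟨b, hb, rfl⟩ := ha
    exact hl b hb

/-- products of `n` lollipops with total stem length `s` -/
inductive Lp : ℕ → ℕ → Γ → Prop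
  | one : Lp 0 0 1
  | cons (n s : ℕ) (x : Γ) (i : I) (f : Γ) (u g : List (S × Bool)) : Lp n s x → f ∈ Y.K i →
    Y.π f = FreeGroup.mk u → IsCyclicallyReduced u →
    Lp (n + 1) (s + g.length) (Y.W g * f * (Y.W g)⁻¹ * x)

variable {Y}

theorem Lp.ar {n s : ℕ} {x : Γ} (h : Y.Lp n s x) : Y.Ar n x := by
  induction h with
  | one => exact Ar.one
  | cons n s x i f u g _ hf _ _ ih => exact Ar.cons _ _ i f _ ih hf

theorem Lp.mul {n m s t : ℕ} {x y : Γ} (hx : Y.Lp n s x) (hy : Y.Lp m t y) :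
    Y.Lp (n + m) (s + t) (x * y) := by
  induction hx with
  | one => simpa using hy
  | cons n s x i f u g hx hf h1 h2 ih =>
    have := Lp.cons _ _ _ i f u g ih hf h1 h2
    rw [mul_assoc, show n + 1 + m = n + m + 1 by ring,
      show s + g.length + t = s + t + g.length by ring]; exact this

theorem Lp.of {i : I} {f : Γ} {u : List (S × Bool)} (g : List (S × Bool)) (hf : f ∈ Y.K i)
    (h1 : Y.π f = FreeGroup.mk u) (h2 : IsCyclicallyReduced u) :
    Y.Lp 1 g.length (Y.W g * f * (Y.W g)⁻¹) := by
  simpa using Lp.cons 0 0 1 i f u g Lp.one hf h1 h2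

theorem Lp.inv {n s : ℕ} {x : Γ} (hx : Y.Lp n s x) : Y.Lp n s x⁻¹ := by
  induction hx with
  | one => simpa using Lp.one
  | cons n s x i f u g hx hf h1 h2 ih =>
    have h3 := Lp.of (u := invRev u) g ((Y.K i).inv_mem hf) (by rw [map_inv, h1, mk_invRev])
      (cr_invRev h2)
    have := ih.mul h3
    convert this using 1; group

theorem Ar.lp {n : ℕ} {x : Γ} (hx : Y.Ar n x) : ∃ s, Y.Lp n s x := by
  induction hx with
  | one => exact ⟨0, Lp.one⟩
  | cons n x i f g hx hf ih =>
    obtain ⟨s, hs⟩ := ih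
    obtain ⟨q, hq, hq2⟩ := exists_red (Y.π g)
    obtain ⟨l, hl, hl2⟩ := exists_red (Y.π f)
    obtain ⟨p, u, rfl, hu⟩ := exists_cr l hl
    have hlab := Y.lett i f _ hf hl hl2.symm
    have h1 := Y.norm_list' (i := i) p (fun a ha => hlab a (by simp [ha])) hf
    refine ⟨s + (q ++ p).length, ?_⟩
    have h2 := Lp.cons n s x i _ u (q ++ p) hs h1 (by
      rw [mk_append, mk_append, mk_invRev] at hl2
      simp only [map_mul, map_inv, π_W, ← hl2]; group) hu
    convert h2 using 1
    rw [(Ar.of hf).conj_eq (g := g) (h := Y.W q) (by rw [π_W, hq2]), W_append]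
    group

/-- one step of the peeling procedure -/
theorem Lp.step {n s : ℕ} {x : Γ} (hx : Y.Lp n s x) : ∀ {e : S × Bool} {h : Γ} {k : ℕ},
    Y.Ar k h → Y.π h ∉ St e → Y.π h * Y.π x ∈ St e → ∃ m, n = m + 1 ∧
    ((∃ i f q, f ∈ Y.K i ∧ Y.π f = FreeGroup.mk (e :: q) ∧ IsCyclicallyReduced (e :: q) ∧
        ∃ y, Y.Ar m y ∧ h * x = f * h * y) ∨
     ∃ i f u q, f ∈ Y.K i ∧ Y.π f = FreeGroup.mk u ∧ IsCyclicallyReduced u ∧ ∃ y s1, Y.Lp m s1 y ∧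
      s1 + q.length < s ∧
      (h * x = Y.W [e] * (Y.W q * f * (Y.W q)⁻¹) * (Y.W [e])⁻¹ * h * y ∨
        h * x = (Y.W q * f * (Y.W q)⁻¹) * h * y)) := by
  induction hx with
  | one =>
    intro e h k hk h1 h2
    simp at h2
    exact absurd h2 h1
  | cons n s x i f u g hx hf hu hc ih =>
    intro e h k hk h1 h2
    have hlf : Y.Ar 1 (Y.W g * f * (Y.W g)⁻¹) := (Ar.of hf).conj _
    have hl : Y.π (Y.W g * f * (Y.W g)⁻¹) = FreeGroup.mk (g ++ u ++ invRev g) := by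
      rw [mk_append, mk_append, mk_invRev]; simp [hu]
    by_cases h3 : Y.π h * Y.π (Y.W g * f * (Y.W g)⁻¹) ∈ St e
    · refine ⟨n, rfl, ?_⟩
      rw [hl] at h3
      -- the basic rearrangement
      have key : ∀ r : Γ, Y.π r = Y.π h * FreeGroup.mk g →
          h * (Y.W g * f * (Y.W g)⁻¹ * x) = (r * f * r⁻¹) * h * x := by
        intro r hr
        rw [(Ar.of hf).conj_eq (g := r) (h := h * Y.W g) (by rw [hr, map_mul, π_W])]
        group
      obtain ⟨Λ1, Λ2, h4, h5⟩ := follow_front _ h1 h3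
      have hcases : (∃ q, g = Λ1 ++ e :: q) ∨ (∃ p q, Λ1 = g ++ p ∧ u = p ++ e :: q) ∨
          (∃ p q, Λ1 = g ++ u ++ p ∧ invRev g = p ++ e :: q) := by
        rw [List.append_assoc, List.append_eq_append_iff] at h4
        rcases h4 with ⟨a, ha1, ha2⟩ | ⟨a, ha1, ha2⟩
        · rw [List.append_eq_append_iff] at ha2
          rcases ha2 with ⟨b, hb1, hb2⟩ | ⟨b, hb1, hb2⟩
          · right; right
            exact ⟨b, Λ2, by rw [ha1, hb1, List.append_assoc], hb2⟩
          · cases b with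
            | nil =>
              right; right
              refine ⟨[], Λ2, ?_, by simpa using hb2.symm⟩
              rw [ha1, hb1]; simp
            | cons b1 b =>
              right; left
              simp at hb2
              exact ⟨a, b, ha1, by rw [hb1, hb2.1]⟩
        · cases a with
          | nil =>
            simp at ha1 ha2
            cases u with
            | nil =>
              right; right
              exact ⟨[], Λ2, by simp [ha1], by simpa using ha2.symm⟩
            | cons u1 u =>
              right; left
              simp at ha2
              exact ⟨[], u, by simp [ha1], by simp [ha2.1]⟩
          | cons a1 a =>
            left
            simp at ha2
            exact ⟨a, by rw [ha1, ha2.1]⟩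
      rcases hcases with ⟨q, hq⟩ | ⟨p, q, hp, hq⟩ | ⟨p, q, hp, hq⟩
      · right
        refine ⟨i, f, u, q, hf, hu, hc, x, s, hx, ?_, Or.inl ?_⟩
        · rw [hq]; simp; omega
        · rw [key (Y.W (e :: q)) (by rw [π_W, hq, mk_append, ← mul_assoc, h5, one_mul]), W_cons]
          group
      · left
        have hred : IsReduced u := (cr_iff.1 hc).1
        have hlab := Y.lett i f _ hf hred hu
        have h6 := Y.norm_list' (i := i) p (fun a ha => hlab a (by simp [hq, ha])) hf
        refine ⟨i, _, q ++ p, h6, ?_, ?_, x, hx.ar, ?_⟩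
        · rw [← List.cons_append, mk_append]
          rw [map_mul, map_mul, map_inv, π_W, hu, hq, mk_append]; group
        · rw [hq] at hc; simpa using cr_rotate hc
        · rw [key (Y.W p)⁻¹ ?_]
          · simp
          · rw [hp, mk_append] at h5
            rw [map_inv, π_W]
            exact inv_eq_of_mul_eq_one_left (by rw [mul_assoc]; exact h5)
      · right
        have hg : g = invRev q ++ linv e :: invRev p := by
          have := congrArg invRev hq
          rw [invRev_invRev, invRev_append', invRev_cons'] at this
          simpa using this
        refine ⟨i, f, u, invRev p, hf, hu, hc, x, s, hx, ?_, Or.inr ?_⟩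
        · rw [hg]; simp; omega
        · rw [key (Y.W (invRev p) * f⁻¹) ?_]
          · group
          · rw [hp, mk_append, mk_append] at h5
            rw [map_mul, π_W, map_inv, hu, mk_invRev, ← mul_inv_rev]
            exact inv_eq_of_mul_eq_one_left (by simpa only [mul_assoc] using h5)
    · have h4 := ih (e := e) (h := h * (Y.W g * f * (Y.W g)⁻¹)) (hk.mul hlf)
        (by rw [map_mul]; exact h3) (by rw [map_mul, mul_assoc, ← map_mul Y.π _ x]; exact h2)
      obtain ⟨m, rfl, h4⟩ := h4
      refine ⟨m + 1, rfl, ?_⟩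
      rcases h4 with ⟨j, f', q, hf', hq, hq2, y, hy, hy2⟩ |
        ⟨j, f', u', q, hf', hu', hc', y, s1, hy, hs1, hy2⟩
      · left
        refine ⟨j, f', q, hf', hq, hq2, _, Ar.cons _ _ i f (Y.W g) hy hf, ?_⟩
        calc _ = h * (Y.W g * f * (Y.W g)⁻¹) * x := by group
          _ = _ := by rw [hy2]; group
      · right
        refine ⟨j, f', u', q, hf', hu', hc', _, _, Lp.cons _ _ _ i f u g hy hf hu hc, by omega, ?_⟩
        rcases hy2 with hy2 | hy2
        · left
          calc _ = h * (Y.W g * f * (Y.W g)⁻¹) * x := by group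
            _ = _ := by rw [hy2]; group
        · right
          calc _ = h * (Y.W g * f * (Y.W g)⁻¹) * x := by group
            _ = _ := by rw [hy2]; group

theorem Lp.step0 {n s : ℕ} {x : Γ} (hx : Y.Lp n s x) {e : S × Bool} (h2 : Y.π x ∈ St e) :
    ∃ m, n = m + 1 ∧
    ((∃ i f q, f ∈ Y.K i ∧ Y.π f = FreeGroup.mk (e :: q) ∧ IsCyclicallyReduced (e :: q) ∧
        ∃ y, Y.Ar m y ∧ x = f * y) ∨
     (∃ y s1 z s2, Y.Lp m s1 y ∧ Y.Lp 1 s2 z ∧ s1 + s2 < s ∧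
      x = Y.W [e] * z * (Y.W [e])⁻¹ * y) ∨ ∃ s1, s1 < s ∧ Y.Lp n s1 x) := by
  have := hx.step (e := e) (h := 1) Ar.one (by rw [map_one]; exact one_not_St e) (by simpa using h2)
  obtain ⟨m, rfl, h⟩ := this
  refine ⟨m, rfl, ?_⟩
  simp only [one_mul, mul_one] at h
  rcases h with h | ⟨i, f, u, q, hf, hu, hc, y, s1, hy, hs, rfl | rfl⟩
  · exact Or.inl h
  · right; left
    exact ⟨y, s1, _, _, hy, Lp.of q hf hu hc, hs, rfl⟩
  · right; right
    exact ⟨_, hs, Lp.cons _ _ _ i f u q hy hf hu hc⟩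

theorem peel_aux (N : ℕ) : ∀ {e : S × Bool} {z : List (S × Bool)} {A B : Γ} {a b s t : ℕ},
    Y.Lp a s A → Y.Lp b t B → s + t ≤ N → IsReduced (e :: z) →
    Y.π (Y.W [e] * A * (Y.W [e])⁻¹ * B) = FreeGroup.mk (e :: z) →
    (∃ m i f q, a + b = m + 1 ∧ f ∈ Y.K i ∧ Y.π f = FreeGroup.mk (e :: q) ∧
      IsCyclicallyReduced (e :: q) ∧ ∃ y, Y.Ar m y ∧ Y.W [e] * A * (Y.W [e])⁻¹ * B = f * y) ∨
    (∃ y y' A' B' a' b', a' + b' = a + b ∧ Y.Ar a' A' ∧ Y.Ar b' B' ∧ z = y ++ linv e :: y' ∧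
      Y.π A' = FreeGroup.mk y ∧ Y.π B' = FreeGroup.mk y' ∧
      Y.W [e] * A * (Y.W [e])⁻¹ * B = Y.W [e] * A' * (Y.W [e])⁻¹ * B') := by
  induction N using Nat.strong_induction_on with
  | _ N IH =>
  intro e z A B a b s t hA hB hN hred hx
  by_cases h1 : Y.π B ∈ St e
  · obtain ⟨m, rfl, h⟩ := hB.step0 h1
    rcases h with ⟨i, f, q, hf, hq, hc, y, hy, rfl⟩ | ⟨y, s1, z1, s2, hy, hz, hs, rfl⟩ | ⟨s1, hs, hl⟩
    · left
      refine ⟨a + m, i, f, q, rfl, hf, hq, hc, _, ((hA.ar.conj (Y.W [e])).conj' f).mul hy, ?_⟩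
      group
    · have heq : Y.W [e] * A * (Y.W [e])⁻¹ * (Y.W [e] * z1 * (Y.W [e])⁻¹ * y) =
        Y.W [e] * (A * z1) * (Y.W [e])⁻¹ * y := by group
      have := IH _ (by omega : s + s2 + s1 < N) (hA.mul hz) hy le_rfl hred (by rw [← heq]; exact hx)
      rw [heq, show a + (m + 1) = a + 1 + m by ring]
      exact this
    · exact IH _ (by omega : s + s1 < N) hA hl le_rfl hred hx
  by_cases h2 : Y.π A⁻¹ ∈ St (linv e)
  · obtain ⟨m, rfl, h⟩ := hA.inv.step0 h2
    rcases h with ⟨i, f, q, hf, hq, hc, y, hy, hA2⟩ | ⟨y, s1, z1, s2, hy, hz, hs, hA2⟩ | ⟨s1, hs, hl⟩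
    · left
      have hA3 : A = y⁻¹ * f⁻¹ := by rw [← inv_inv A, hA2]; group
      have hlab := Y.lett i f _ hf (cr_iff.1 hc).1 hq
      have h6 := Y.norm i e f⁻¹ (hlab (linv e) (by simp)) ((Y.K i).inv_mem hf)
      refine ⟨m + b, i, _, invRev q, by omega, h6, ?_, ?_,
        (Y.W [e] * f * y⁻¹ * f⁻¹ * (Y.W [e])⁻¹) * B, Ar.mul ?_ hB.ar, ?_⟩
      · have : Y.π f = (FreeGroup.mk [e])⁻¹ * FreeGroup.mk q := by rw [hq, mk_cons, mk_linv]
        rw [mk_cons e (invRev q), mk_invRev]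
        simp only [map_mul, map_inv, Y.πι, this]; group
      · have := cr_invRev hc
        rw [invRev_cons', linv_linv] at this
        exact cr_rotate this
      · convert (hy.inv.conj (Y.W [e] * f)) using 1; group
      · rw [hA3]; unfold W; group
    · have hA3 : A = y⁻¹ * (Y.W [e])⁻¹ * z1⁻¹ * Y.W [e] := by
        rw [← inv_inv A, hA2, W_linv]; group
      have heq : Y.W [e] * A * (Y.W [e])⁻¹ * B = Y.W [e] * y⁻¹ * (Y.W [e])⁻¹ * (z1⁻¹ * B) := by
        rw [hA3]; group
      rw [heq] at hx ⊢
      have := IH _ (by omega : s1 + (s2 + t) < N) hy.inv (hz.inv.mul hB) le_rfl hred hx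
      rw [show m + 1 + b = m + (1 + b) by ring]
      exact this
    · have h3 := hl.inv
      rw [inv_inv] at h3
      exact IH _ (by omega : s1 + t < N) h3 hB le_rfl hred hx
  · right
    obtain ⟨y, hy, hy2⟩ := exists_red (Y.π A)
    obtain ⟨y', hy', hy2'⟩ := exists_red (Y.π B)
    refine ⟨y, y', A, B, a, b, rfl, hA.ar, hB.ar, ?_, hy2.symm, hy2'.symm, rfl⟩
    apply eq_of_mk_eq (red_sub hred ⟨[e], [], by simp⟩)
    · rw [isReduced_append_iff]
      refine ⟨hy, ?_, ?_⟩
      · cases y' with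
        | nil => simp
        | cons c y' =>
          rw [isReduced_cons_cons']
          refine ⟨?_, hy'⟩
          rintro rfl
          rw [linv_linv] at *
          exact h1 ⟨y', hy', hy2'.symm⟩
      · intro c hc d hd hcd
        simp at hd; subst hd
        have := linv_inj hcd; subst this
        obtain ⟨l', rfl⟩ : ∃ l', y = l' ++ [e] := by
          exact (List.mem_getLast?_eq_getLast hc).elim
            fun h1 h2 => ⟨y.dropLast, by rw [h2, List.dropLast_append_getLast]⟩
        apply h2
        refine ⟨invRev l', ?_, ?_⟩
        · have := red_invRev hy
          rw [invRev_append'] at this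
          exact this
        · rw [map_inv, ← hy2, ← mk_invRev, invRev_append']; rfl
    · rw [mk_append, mk_cons, mk_linv, hy2, hy2']
      rw [mk_cons] at hx
      simp only [map_mul, map_inv, π_W] at hx
      rw [mul_assoc, mul_assoc] at hx
      exact (mul_left_cancel hx).symm

/-- The peeling lemma: the first edge of a diagram with reduced boundary word lies on a face
or is a bridge. -/
theorem peel {e : S × Bool} {z : List (S × Bool)} {x : Γ} {n : ℕ} (hx : Y.Ar n x)
    (hred : IsReduced (e :: z)) (hπ : Y.π x = FreeGroup.mk (e :: z)) :
    (∃ m i f q, n = m + 1 ∧ f ∈ Y.K i ∧ Y.π f = FreeGroup.mk (e :: q) ∧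
      IsCyclicallyReduced (e :: q) ∧ Y.Ar m (f⁻¹ * x)) ∨
    (∃ y y' A B a b, a + b = n ∧ Y.Ar a A ∧ Y.Ar b B ∧ z = y ++ linv e :: y' ∧
      Y.π A = FreeGroup.mk y ∧ Y.π B = FreeGroup.mk y' ∧
      x = Y.W [e] * A * (Y.W [e])⁻¹ * B) := by
  obtain ⟨s, hs⟩ := hx.lp
  have := peel_aux (Y := Y) (0 + s) (A := 1) (B := x) Lp.one hs le_rfl hred (by simpa using hπ)
  simp only [zero_add, mul_one, mul_inv_cancel, one_mul] at this
  rcases this with ⟨m, i, f, q, h1, h2, h3, h4, y, hy, rfl⟩ | this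
  · left
    exact ⟨m, i, f, q, h1, h2, h3, h4, by simpa using hy⟩
  · right; exact this

end Sys
end Pride

namespace Pride

open FreeGroup hiding map_mul map_inv map_one

variable {S Γ I : Type*} [Group Γ] (Y : Sys S Γ I)

namespace Sys

/-- conjugation by the inverse of a word -/
def cj (p : List (S × Bool)) (x : Γ) : Γ := (Y.W p)⁻¹ * x * Y.W p

@[simp] theorem cj_nil (x : Γ) : Y.cj [] x = x := by simp [cj]
theorem cj_append (p q : List (S × Bool)) (x : Γ) : Y.cj (p ++ q) x = Y.cj q (Y.cj p x) := by
  simp only [cj, W_append]; group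
theorem cj_mul (p : List (S × Bool)) (x y : Γ) : Y.cj p (x * y) = Y.cj p x * Y.cj p y := by
  simp only [cj]; group
theorem cj_inv (p : List (S × Bool)) (x : Γ) : Y.cj p x⁻¹ = (Y.cj p x)⁻¹ := by
  simp only [cj]; group
theorem π_cj (p : List (S × Bool)) (x : Γ) :
    Y.π (Y.cj p x) = (FreeGroup.mk p)⁻¹ * Y.π x * FreeGroup.mk p := by
  simp [cj]

variable {Y}

theorem Ar.cj {n : ℕ} {x : Γ} (hx : Y.Ar n x) (p : List (S × Bool)) : Y.Ar n (Y.cj p x) :=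
  hx.conj' _

theorem Ar.of_cj {n : ℕ} {x : Γ} {p : List (S × Bool)} (hx : Y.Ar n (Y.cj p x)) : Y.Ar n x := by
  have := hx.conj (Y.W p)
  convert this using 1; simp only [Sys.cj]; group

/-- conjugating by a word equals conjugating by any lift -/
theorem Ar.cj_eq {n : ℕ} {x : Γ} (hx : Y.Ar n x) {p : List (S × Bool)} {g : Γ}
    (h : Y.π g = FreeGroup.mk p) : Y.cj p x = g⁻¹ * x * g := by
  have := hx.conj_eq (g := (Y.W p)⁻¹) (h := g⁻¹) (by rw [map_inv, map_inv, h, π_W])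
  simpa [Sys.cj] using this

theorem cj_mem {i : I} {p : List (S × Bool)} {f : Γ} (hp : ∀ a ∈ p, a.1 ∈ Y.lab i)
    (hf : f ∈ Y.K i) : Y.cj p f ∈ Y.K i := Y.norm_list' p hp hf

theorem of_cj_mem {i : I} {p : List (S × Bool)} {f : Γ} (hp : ∀ a ∈ p, a.1 ∈ Y.lab i)
    (hf : Y.cj p f ∈ Y.K i) : f ∈ Y.K i := by
  have := Y.norm_list p hp hf
  convert this using 1; simp only [cj]; group

variable (Y)

/-- exposed corners -/
def Ex (n : ℕ) (x : Γ) (a b : S × Bool) : Prop :=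
  ∃ i, a.1 ∈ Y.lab i ∧ b.1 ∈ Y.lab i ∧ ∃ f ∈ Y.K i, ∃ j < n, Y.Ar j (f * x)

open Classical in
/-- turning angle at a corner -/
noncomputable def turn (n : ℕ) (x : Γ) (a b : S × Bool) : ℝ :=
  if b = linv a then 1 else if Y.Ex n x a b then lc Y.c a b else - lc Y.c a b

open Classical in
/-- upper bound for turning angles -/
noncomputable def U (a b : S × Bool) : ℝ := if b = linv a then 1 else lc Y.c a b

/-- sums along a path -/
def gsum (φ : Γ → S × Bool → S × Bool → ℝ) : Γ → List (S × Bool) → ℝ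
  | _, [] => 0
  | _, [_] => 0
  | x, a :: b :: l => φ (Y.cj [a] x) a b + gsum φ (Y.cj [a] x) (b :: l)

/-- sum of turning angles -/
noncomputable def csum (n : ℕ) (x : Γ) (w : List (S × Bool)) : ℝ :=
  Y.gsum (Y.turn n) x w + jn (Y.turn n x) w w

/-- no decomposition of the diagram -/
def Prime (n : ℕ) (x : Γ) (w : List (S × Bool)) : Prop :=
  ∀ α β γ, w = α ++ β ++ γ → ∀ X Z a b, Y.cj α x = X * Z → Y.π X = FreeGroup.mk β →
    Y.Ar a X → Y.Ar b Z → a + b ≤ n → β = [] ∨ (α = [] ∧ γ = [])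

end Sys

theorem jn_nil_left (φ : S × Bool → S × Bool → ℝ) (q) : jn φ [] q = 0 := rfl
theorem jn_nil_right (φ : S × Bool → S × Bool → ℝ) (q) : jn φ q [] = 0 := by
  unfold jn; cases q.getLast? <;> rfl
theorem jn_some (φ : S × Bool → S × Bool → ℝ) {p q : List (S × Bool)} {a b}
    (ha : p.getLast? = some a) (hb : q.head? = some b) : jn φ p q = φ a b := by
  unfold jn; rw [ha, hb]
theorem jn_concat_cons (φ : S × Bool → S × Bool → ℝ) (p q : List (S × Bool)) (a b) :
    jn φ (p ++ [a]) (b :: q) = φ a b := jn_some φ (by simp) rfl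

theorem jn_append_left (φ : S × Bool → S × Bool → ℝ) {p q r : List (S × Bool)} (h : q ≠ []) :
    jn φ (p ++ q) r = jn φ q r := by
  rcases List.eq_nil_or_concat q with rfl | ⟨q', a, rfl⟩
  · exact absurd rfl h
  · unfold jn; rw [List.getLast?_append]; simp
theorem jn_append_right (φ : S × Bool → S × Bool → ℝ) {p q r : List (S × Bool)} (h : q ≠ []) :
    jn φ p (q ++ r) = jn φ p q := by
  cases q with
  | nil => exact absurd rfl h
  | cons b q => unfold jn; simp

theorem exists_last {l : List (S × Bool)} (h : l ≠ []) : ∃ l' a, l = l' ++ [a] := by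
  rcases List.eq_nil_or_concat l with rfl | ⟨q', a, rfl⟩
  · exact absurd rfl h
  · exact ⟨q', a, by simp⟩
theorem exists_head {l : List (S × Bool)} (h : l ≠ []) : ∃ a l', l = a :: l' := by
  cases l with
  | nil => exact absurd rfl h
  | cons a l => exact ⟨a, l, rfl⟩

namespace Sys

theorem gsum_append (φ : Γ → S × Bool → S × Bool → ℝ) (p q : List (S × Bool)) : ∀ x : Γ,
    Y.gsum φ x (p ++ q) = Y.gsum φ x p + jn (φ (Y.cj p x)) p q + Y.gsum φ (Y.cj p x) q := by
  induction p with
  | nil => intro x; simp [gsum, jn_nil_left]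
  | cons a p ih =>
    intro x
    cases p with
    | nil =>
      cases q with
      | nil => simp [gsum, jn_nil_right]
      | cons b q => simp [gsum, jn]
    | cons b p =>
      have := ih (Y.cj [a] x)
      simp only [List.cons_append, gsum] at this ⊢
      rw [this, ← cj_append, List.singleton_append]
      have h2 : jn (φ (Y.cj (a :: b :: p) x)) (a :: b :: p) q =
        jn (φ (Y.cj (a :: b :: p) x)) (b :: p) q := jn_append_left _ (p := [a]) (by simp)
      rw [h2]; ring

theorem gsum_le {φ ψ : Γ → S × Bool → S × Bool → ℝ} (l : List (S × Bool)) : ∀ {x x' : Γ},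
    (∀ l1 a b l2, l = l1 ++ a :: b :: l2 →
      φ (Y.cj (l1 ++ [a]) x) a b ≤ ψ (Y.cj (l1 ++ [a]) x') a b) →
    Y.gsum φ x l ≤ Y.gsum ψ x' l := by
  induction l with
  | nil => intros; simp [gsum]
  | cons a l ih =>
    intro x x' h
    cases l with
    | nil => simp [gsum]
    | cons b l =>
      simp only [gsum]
      refine add_le_add (h [] a b l rfl) (ih ?_)
      intro l1 c d l2 h2
      have := h (a :: l1) c d l2 (by rw [h2]; rfl)
      rw [← cj_append, ← cj_append]
      exact this

theorem gsum_const (φ : S × Bool → S × Bool → ℝ) (l : List (S × Bool)) : ∀ x : Γ,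
    Y.gsum (fun _ => φ) x l = lsum φ l := by
  induction l with
  | nil => intro x; rfl
  | cons a l ih =>
    intro x
    cases l with
    | nil => rfl
    | cons b l => simp only [gsum, lsum]; rw [ih]

theorem gsum_neg (φ : Γ → S × Bool → S × Bool → ℝ) (l : List (S × Bool)) : ∀ x : Γ,
    Y.gsum (fun x a b => - φ x a b) x l = - Y.gsum φ x l := by
  induction l with
  | nil => intro x; simp [gsum]
  | cons a l ih =>
    intro x
    cases l with
    | nil => simp [gsum]
    | cons b l => simp only [gsum]; rw [ih]; ring

theorem lc_nonneg (a b : S × Bool) : 0 ≤ lc Y.c a b := Y.cnonneg _ _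
theorem lc_half (a b : S × Bool) : lc Y.c a b ≤ 1 / 2 := Y.chalf _ _
theorem lc_symm (a b : S × Bool) : lc Y.c a b = lc Y.c b a := Y.csymm _ _
theorem lc_linv (a b : S × Bool) : lc Y.c a (linv b) = lc Y.c a b := rfl
theorem lc_linv' (a b : S × Bool) : lc Y.c (linv a) b = lc Y.c a b := rfl
theorem lc_tri (a b d : S × Bool) : lc Y.c a b + lc Y.c b d + lc Y.c a d ≤ 1 := Y.ctri _ _ _

theorem turn_le_U (n : ℕ) (x : Γ) (a b : S × Bool) : Y.turn n x a b ≤ Y.U a b := by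
  have := Y.lc_nonneg a b
  unfold turn U; split_ifs <;> linarith

theorem neg_le_turn (n : ℕ) (x : Γ) (a b : S × Bool) : - lc Y.c a b ≤ Y.turn n x a b := by
  have := Y.lc_nonneg a b
  unfold turn; split_ifs <;> linarith

theorem turn_of_ex {n : ℕ} {x : Γ} {a b : S × Bool} (h : Y.Ex n x a b) :
    lc Y.c a b ≤ Y.turn n x a b := by
  have := Y.lc_half a b
  unfold turn; simp only [h, if_true]; split_ifs <;> linarith

theorem U_of_ne {a b : S × Bool} (h : b ≠ linv a) : Y.U a b = lc Y.c a b := by simp [U, h]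
theorem U_of_eq {a b : S × Bool} (h : b = linv a) : Y.U a b = 1 := by simp [U, h]
theorem turn_of_eq {a b : S × Bool} (n : ℕ) (x : Γ) (h : b = linv a) : Y.turn n x a b = 1 := by
  simp [turn, h]

theorem turn_mono {n k : ℕ} {x x' : Γ} {a b : S × Bool} (h : Y.Ex k x' a b → Y.Ex n x a b) :
    Y.turn k x' a b ≤ Y.turn n x a b := by
  have := Y.lc_nonneg a b
  unfold turn
  by_cases h1 : Y.Ex k x' a b
  · simp [h1, h h1]
  · simp only [h1, if_false]; split_ifs <;> linarith

variable {Y}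

theorem Ex.mul_right {n m : ℕ} {x z : Γ} {a b : S × Bool} (h : Y.Ex n x a b) (hz : Y.Ar m z) {k : ℕ}
    (hk : n + m ≤ k) : Y.Ex k (x * z) a b := by
  obtain ⟨i, h1, h2, f, hf, j, hj, h3⟩ := h
  refine ⟨i, h1, h2, f, hf, j + m, by omega, ?_⟩
  rw [← mul_assoc]; exact h3.mul hz

theorem cj_self {n : ℕ} {x : Γ} (hx : Y.Ar n x) {w : List (S × Bool)}
    (h : Y.π x = FreeGroup.mk w) : Y.cj w x = x := by
  rw [hx.cj_eq h]; group

/-- the rotated element -/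
theorem rot_eq {n : ℕ} {x : Γ} (hx : Y.Ar n x) {l : List (S × Bool)} {b : S × Bool}
    (h : Y.π x = FreeGroup.mk (l ++ [b])) : Y.cj l x = Y.W [b] * x * (Y.W [b])⁻¹ := by
  rw [hx.cj_eq (p := l) (g := x * (Y.W [b])⁻¹)]
  · group
  · rw [map_mul, h, map_inv, π_W, mk_append]; group

theorem csum_rotate {k n : ℕ} {x : Γ} (hx : Y.Ar k x) {l : List (S × Bool)} {b : S × Bool}
    (h : Y.π x = FreeGroup.mk (l ++ [b])) :
    Y.csum n x (l ++ [b]) = Y.csum n (Y.W [b] * x * (Y.W [b])⁻¹) (b :: l) := by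
  have h2 : Y.cj [b] (Y.W [b] * x * (Y.W [b])⁻¹) = x := by unfold cj; group
  have hr := rot_eq hx h
  cases l with
  | nil =>
    rw [← hr]; simp
  | cons a l =>
    unfold csum
    rw [gsum_append]
    simp only [gsum]
    rw [h2, hr]
    have e1 : jn (Y.turn n x) (a :: l ++ [b]) (a :: l ++ [b]) = Y.turn n x b a :=
      jn_some _ (by rw [List.getLast?_append]; simp) (by simp)
    have e2 : jn (Y.turn n (Y.W [b] * x * (Y.W [b])⁻¹)) (b :: a :: l) (b :: a :: l) =
      jn (Y.turn n (Y.W [b] * x * (Y.W [b])⁻¹)) (a :: l) [b] := by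
      rw [show b :: a :: l = [b] ++ (a :: l) from rfl, jn_append_left _ (by simp),
        jn_append_right _ (by simp)]
    rw [e1, e2]; ring

theorem prime_rotate {n : ℕ} {x : Γ} {l : List (S × Bool)} {b : S × Bool}
    (h : Y.π x = FreeGroup.mk (l ++ [b])) (hp : Y.Prime n x (l ++ [b])) :
    Y.Prime n (Y.W [b] * x * (Y.W [b])⁻¹) (b :: l) := by
  have h2 : Y.cj [b] (Y.W [b] * x * (Y.W [b])⁻¹) = x := by unfold cj; group
  intro α β γ hw X Z a' b' hXZ hX ha hb hab
  cases α with
  | cons a0 α =>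
    simp at hw
    obtain ⟨rfl, hl⟩ := hw
    rw [← List.singleton_append, cj_append, h2] at hXZ
    have := hp α β (γ ++ [b]) (by rw [hl]; simp) X Z a' b' hXZ hX ha hb hab
    simpa using this
  | nil =>
    cases β with
    | nil => left; rfl
    | cons b0 β =>
      simp at hw
      obtain ⟨rfl, rfl⟩ := hw
      right
      refine ⟨rfl, ?_⟩
      rw [cj_nil] at hXZ
      have hZ : Y.π Z = FreeGroup.mk γ := by
        have h3 := congrArg Y.π hXZ
        rw [map_mul, map_mul, map_mul, map_inv, h, hX, π_W, mk_cons b β, mk_append, mk_append] at h3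
        have h4 : FreeGroup.mk [b] * FreeGroup.mk β * FreeGroup.mk γ =
          FreeGroup.mk [b] * FreeGroup.mk β * Y.π Z := by
          rw [← h3]; group
        exact (mul_left_cancel h4).symm
      have h5 : Y.cj β x = Z * X := by
        have := (ha.mul hb).cj_eq (p := b :: β) (g := X) hX
        rw [← hXZ, ← List.singleton_append, cj_append, h2, hXZ] at this
        rw [this]; group
      have := hp β γ [b] (by simp) Z X b' a' h5 hZ hb ha (by omega)
      simpa using this

end Sys

theorem not_red {w : List (S × Bool)} (h : ¬ IsReduced w) :
    ∃ α a γ, w = α ++ [a, linv a] ++ γ := by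
  induction w with
  | nil => simp at h
  | cons a w ih =>
    cases w with
    | nil => simp at h
    | cons b w =>
      rw [isReduced_cons_cons'] at h
      by_cases hb : b = linv a
      · exact ⟨[], a, w, by simp [hb]⟩
      · have : ¬ IsReduced (b :: w) := fun h2 => h ⟨hb, h2⟩
        obtain ⟨α, c, γ, h3⟩ := ih this
        exact ⟨a :: α, c, γ, by rw [h3]; simp⟩

theorem mk_ne_one {w : List (S × Bool)} (h : IsReduced w) (hw : w ≠ []) :
    FreeGroup.mk w ≠ 1 := fun h2 => hw (eq_of_mk_eq h (m := []) (by simp) h2)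

theorem lsum_append (φ : S × Bool → S × Bool → ℝ) (p q : List (S × Bool)) :
    lsum φ (p ++ q) = lsum φ p + jn φ p q + lsum φ q := by
  induction p with
  | nil => simp [lsum, jn_nil_left]
  | cons a p ih =>
    cases p with
    | nil =>
      cases q with
      | nil => simp [lsum, jn_nil_right]
      | cons b q => simp [lsum, jn]
    | cons b p =>
      simp only [List.cons_append, lsum] at ih ⊢
      rw [ih]
      have h2 : jn φ (a :: b :: p) q = jn φ (b :: p) q := jn_append_left _ (p := [a]) (by simp)
      rw [h2]; ring

theorem Sys.lsum_invRev (v : List (S × Bool)) :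
    lsum (lc Y.c) (invRev v) = lsum (lc Y.c) v := by
  induction v with
  | nil => rfl
  | cons a v ih =>
    rw [invRev_cons', lsum_append, ih]
    cases v with
    | nil => simp [lsum, invRev, jn]
    | cons b v =>
      rw [invRev_cons', jn_concat_cons]
      simp only [lsum]
      rw [Y.lc_symm a b]
      simp only [lc, linv_fst]; ring

end Pride

namespace Pride

open FreeGroup hiding map_mul map_inv map_one

variable {S Γ I : Type*} [Group Γ] (Y : Sys S Γ I)

namespace Sys

/-- the Gauss–Bonnet statement for prime diagrams with `n` faces -/
def GB (n : ℕ) : Prop := ∀ x w, w ≠ [] → Y.π x = FreeGroup.mk w → Y.Ar n x →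
  (∀ m < n, ¬ Y.Ar m x) → Y.Prime n x w → 2 ≤ Y.csum n x w

/-- diagrams whose boundary has labels in one face type are faces -/
def Claim (n : ℕ) : Prop := ∀ x l i, Y.Ar n x → Y.π x = FreeGroup.mk l →
  (∀ a ∈ l, a.1 ∈ Y.lab i) → x ∈ Y.K i

variable {Y}

theorem ar_pos {a : ℕ} {X : Γ} {β : List (S × Bool)} (h : Y.Ar a X) (hπ : Y.π X = FreeGroup.mk β)
    (hr : IsReduced β) (hβ : β ≠ []) : 1 ≤ a := by
  by_contra h2
  have := h.zero (by omega)
  rw [this, map_one] at hπ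
  exact mk_ne_one hr hβ hπ.symm

theorem cut_ineq {n : ℕ} {x : Γ} {p q r s : S × Bool}
    (hx : p = linv q → r = linv s → Y.Ex n x p r) :
    Y.U s r + Y.U p q + lc Y.c s q - 2 ≤ Y.turn n x p r := by
  -- `p` last of z1, `q` first of v2, `r` first of z2, `s` last of v1
  have t0 := Y.neg_le_turn n x p r
  have h1 := Y.lc_half p r
  have h2 := Y.lc_half s r
  have h3 := Y.lc_half p q
  have h4 := Y.lc_half s q
  by_cases e1 : r = linv s
  · by_cases e2 : p = linv q
    · have := Y.turn_of_ex (hx e2 e1)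
      rw [Y.U_of_eq e1, Y.U_of_eq (show q = linv p by rw [e2, linv_linv])]
      have e3 : lc Y.c p r = lc Y.c s q := by
        rw [e1, e2, lc_linv, lc_linv', lc_symm]
      linarith
    · have e2' : q ≠ linv p := fun h => e2 (by rw [h, linv_linv])
      rw [Y.U_of_eq e1, Y.U_of_ne e2']
      have := Y.lc_tri p s q
      have e3 : lc Y.c p r = lc Y.c p s := by rw [e1, lc_linv]
      linarith
  · by_cases e2 : q = linv p
    · rw [Y.U_of_ne e1, Y.U_of_eq e2]
      have e3 : lc Y.c s q = lc Y.c s p := by rw [e2, lc_linv]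
      have := Y.lc_tri s p r
      linarith
    · rw [Y.U_of_ne e1, Y.U_of_ne e2]
      linarith

theorem Qlemma {i : I} {n : ℕ} (hGB : ∀ k < n, Y.GB k) (hCl : ∀ k < n, Y.Claim k) (N : ℕ) :
    ∀ (v z : List (S × Bool)) (x X : Γ) (k : ℕ), v.length + z.length ≤ N → k < n →
    v ≠ [] → z ≠ [] → IsReduced v → (∀ a ∈ v, a.1 ∈ Y.lab i) →
    Y.π x = FreeGroup.mk (v ++ z) → Y.Ar k x →
    (∀ v1 v2 f j, v = v1 ++ v2 → f ∈ Y.K i → j < k → ¬ Y.Ar j (f * Y.cj v1 x)) →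
    (∀ z1 y z2 X1 Y1 a b, z = z1 ++ y ++ z2 → Y.cj (v ++ z1) x = X1 * Y1 →
      Y.π X1 = FreeGroup.mk y → Y.Ar a X1 → Y.Ar b Y1 → a + b ≤ k → y = []) →
    (∀ z1 z2 p q, z = z1 ++ z2 → Y.Ex k (Y.cj (v ++ z1) x) p q → Y.Ex n (Y.cj z1 X) p q) →
    (∀ v1 v2 z1 z2 A Z a b, v = v1 ++ v2 → z = z1 ++ z2 → Y.cj v1 x = A * Z →
      Y.π A = FreeGroup.mk (v2 ++ z1) → Y.π Z = FreeGroup.mk (z2 ++ v1) → Y.Ar a A → Y.Ar b Z →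
      a + b ≤ k → ∃ f ∈ Y.K i, ∃ j < n, Y.Ar j (f * Y.cj z1 X)) →
    2 ≤ Y.gsum (Y.turn n) X z - lsum (lc Y.c) v + jn Y.U z v + jn Y.U v z := by
  induction N with
  | zero =>
    intro v z x X k hN _ hv
    exfalso; apply hv; apply List.eq_nil_of_length_eq_zero; omega
  | succ N IH =>
  intro v z x X k hN hk hv hz hvr hvl hπ hx h1 h3 H1 H2
  by_cases hprime : Y.Prime k x (v ++ z)
  · -- prime case
    have hmin : ∀ m < k, ¬ Y.Ar m x := by
      intro m hm h
      exact h1 [] v 1 m rfl (Y.K i).one_mem hm (by simpa using h)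
    have hg := hGB k hk x (v ++ z) (by simp [hv]) hπ hx hmin hprime
    unfold csum at hg
    rw [gsum_append, jn_append_left _ hz, jn_append_right _ hv] at hg
    have b1 : Y.gsum (Y.turn k) x v ≤ - lsum (lc Y.c) v := by
      rw [← Y.gsum_const (lc Y.c) v x, ← gsum_neg]
      apply gsum_le
      intro l1 a b l2 hl
      have hab : b ≠ linv a := by
        have : IsReduced (a :: b :: l2) := red_sub hvr ⟨l1, [], by rw [hl]; simp⟩
        exact (isReduced_cons_cons'.1 this).1
      unfold turn
      simp only [hab, if_false]
      split_ifs with hE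
      · obtain ⟨i', ha, hb, f, hf, j, hj, har⟩ := hE
        by_cases hab2 : a.1 = b.1
        · simp [lc, hab2, Y.cself]
        · have hai := hvl a (by simp [hl])
          have hbi := hvl b (by simp [hl])
          have := Y.lab_eq i' i _ _ hab2 ha hb hai hbi
          subst this
          exact absurd har (h1 (l1 ++ [a]) (b :: l2) f j (by simp [hl]) hf hj)
      · exact le_rfl
    have b2 : Y.gsum (Y.turn k) (Y.cj v x) z ≤ Y.gsum (Y.turn n) X z := by
      apply gsum_le
      intro l1 a b l2 hl
      apply turn_mono
      intro h
      rw [← cj_append] at h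
      exact H1 (l1 ++ [a]) (b :: l2) a b (by simp [hl]) h
    obtain ⟨v', vl, hvl'⟩ := exists_last hv
    obtain ⟨vf, v'', hvf'⟩ := exists_head hv
    obtain ⟨z', zl, hzl'⟩ := exists_last hz
    obtain ⟨zf, z'', hzf'⟩ := exists_head hz
    have e1 : ∀ φ : S × Bool → S × Bool → ℝ, jn φ v z = φ vl zf := fun φ =>
      jn_some φ (by simp [hvl']) (by simp [hzf'])
    have e2 : ∀ φ : S × Bool → S × Bool → ℝ, jn φ z v = φ zl vf := fun φ =>
      jn_some φ (by simp [hzl']) (by simp [hvf'])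
    rw [e1, e2] at hg ⊢
    have b3 := Y.turn_le_U k (Y.cj v x) vl zf
    have b4 := Y.turn_le_U k x zl vf
    linarith
  · -- non-prime case
    unfold Prime at hprime
    push Not at hprime
    obtain ⟨α, β, γ, hw, A, Z, a, b, hAZ, hA, ha, hb, hab, hβ, hαγ⟩ := hprime
    -- case 1
    have case1 : ∀ v3, v = α ++ β ++ v3 → False := by
      intro v3 hv3
      have hβr : IsReduced β := red_sub hvr ⟨α, v3, by rw [hv3]⟩
      have hapos := ar_pos ha hA hβr hβ
      have hAK := hCl a (by omega) A β i ha hA (fun c hc => hvl c (by simp [hv3, hc]))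
      refine h1 α (β ++ v3) A⁻¹ b (by simp [hv3]) ((Y.K i).inv_mem hAK) (by omega) ?_
      rw [hAZ]; simpa using hb
    -- case 2
    have case2 : ∀ z1, α = v ++ z1 → z = z1 ++ β ++ γ → False := by
      intro z1 hα hz1
      rw [hα] at hAZ
      exact hβ (h3 z1 β γ A Z a b hz1 hAZ hA ha hb hab)
    have hcase3 : ∃ v2 z1, v = α ++ v2 ∧ z = z1 ++ γ ∧ β = v2 ++ z1 ∧ v2 ≠ [] ∧ z1 ≠ [] := by
      rw [List.append_assoc, List.append_eq_append_iff] at hw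
      rcases hw with ⟨z1, hα, hz1⟩ | ⟨v2, hv2, hz2⟩
      · exact (case2 z1 hα (by rw [hz1]; simp)).elim
      · rw [List.append_eq_append_iff] at hz2
        rcases hz2 with ⟨v3, hv3, hz3⟩ | ⟨z1, hβ1, hz1⟩
        · exact (case1 v3 (by rw [hv2, hv3]; simp)).elim
        · by_cases hz0 : z1 = []
          · subst hz0
            exact (case1 [] (by rw [hv2]; simpa using hβ1.symm)).elim
          · by_cases hv0 : v2 = []
            · subst hv0
              exact (case2 [] (by simpa using hv2.symm) (by rw [hz1]; simpa using hβ1.symm)).elim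
            · exact ⟨v2, z1, hv2, hz1, hβ1, hv0, hz0⟩
    obtain ⟨v2, z1, hv2, hz1, rfl, hv2n, hz1n⟩ := hcase3
    -- rename
    obtain ⟨v1, rfl⟩ : ∃ v1, v1 = α := ⟨α, rfl⟩
    obtain ⟨z2, rfl⟩ : ∃ z2, z2 = γ := ⟨γ, rfl⟩
    subst hv2 hz1
    have hZ : Y.π Z = FreeGroup.mk (z2 ++ v1) := by
      have h4 := congrArg Y.π hAZ
      rw [π_cj, map_mul, hA, hπ] at h4
      simp only [mk_append] at h4 ⊢
      have h5 : FreeGroup.mk v2 * FreeGroup.mk z1 * Y.π Z =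
        FreeGroup.mk v2 * FreeGroup.mk z1 * (FreeGroup.mk z2 * FreeGroup.mk v1) := by
        rw [← h4]; group
      exact mul_left_cancel h5
    have hZA : Y.cj ((v1 ++ v2) ++ z1) x = Z * A := by
      rw [List.append_assoc, cj_append, hAZ, (ha.mul hb).cj_eq hA]; group
    have hv1n : v1 ≠ [] := by
      rintro rfl
      have hz2n : z2 ≠ [] := hαγ rfl
      apply hz2n
      exact h3 z1 z2 [] Z A b a (by simp) hZA (by simpa using hZ) hb ha (by omega)
    have hz2n : z2 ≠ [] := by
      rintro rfl
      have hZ' : Y.π Z = FreeGroup.mk v1 := by simpa using hZ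
      have hv1r : IsReduced v1 := red_sub hvr ⟨[], v2, by simp⟩
      have hbpos := ar_pos hb hZ' hv1r hv1n
      have hZK := hCl b (by omega) Z v1 i hb hZ' (fun c hc => hvl c (by simp [hc]))
      refine h1 v1 v2 Z⁻¹ a rfl ((Y.K i).inv_mem hZK) (by omega) ?_
      rw [hAZ]
      convert ha.conj' Z using 1; group
    -- first piece
    have IA := IH v2 z1 A X a (by
        simp only [List.length_append] at hN
        have := List.length_pos_iff.2 hv1n
        omega) (by omega) hv2n hz1n (red_sub hvr ⟨v1, [], by simp⟩)
      (fun c hc => hvl c (by simp [hc])) hA ha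
      (by
        intro v21 v22 f j hv hf hj har
        refine h1 (v1 ++ v21) v22 f (j + b) (by simp [hv]) hf (by omega) ?_
        rw [cj_append, hAZ, cj_mul, ← mul_assoc]
        exact har.mul (hb.cj _))
      (by
        intro z11 y z12 X1 Y1 a1 b1 hz hc hX1 ha1 hb1 hab1
        refine h3 z11 y (z12 ++ z2) X1 (Y1 * Y.cj (v2 ++ z11) Z) a1 (b1 + b) (by simp [hz]) ?_ hX1
          ha1 (hb1.mul (hb.cj _)) (by omega)
        rw [List.append_assoc, cj_append, hAZ, cj_mul, hc, mul_assoc])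
      (by
        intro z11 z12 p q hz hE
        refine H1 z11 (z12 ++ z2) p q (by simp [hz]) ?_
        rw [List.append_assoc, cj_append, hAZ, cj_mul]
        exact hE.mul_right (hb.cj _) (by omega))
      (by
        intro v21 v22 z11 z12 A1 Z1 a1 b1 hv hz hc hA1 hZ1 ha1 hb1 hab1
        refine H2 (v1 ++ v21) v22 z11 (z12 ++ z2) A1 (Z1 * Y.cj v21 Z) a1 (b1 + b) (by simp [hv])
          (by simp [hz]) ?_ hA1 ?_ ha1 (hb1.mul (hb.cj _)) (by omega)
        · rw [cj_append, hAZ, cj_mul, hc, mul_assoc]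
        · rw [map_mul, π_cj, hZ1, hZ]; simp only [mk_append]; group)
    -- second piece
    have c1 : Y.cj v1 (Y.cj z2 Z) = Z := by
      rw [← cj_append]; exact cj_self hb hZ
    have c2 : x = Y.cj z2 Z * Y.cj z2 A := by
      rw [← cj_mul, ← hZA, ← cj_append]
      rw [cj_self hx]; simpa using hπ
    have IB := IH v1 z2 (Y.cj z2 Z) (Y.cj z1 X) b (by
        simp only [List.length_append] at hN
        have := List.length_pos_iff.2 hv2n
        omega) (by omega) hv1n hz2n (red_sub hvr ⟨[], v2, by simp⟩)
      (fun c hc => hvl c (by simp [hc]))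
      (by rw [π_cj, hZ]; simp only [mk_append]; group) (hb.cj _)
      (by
        intro v11 v12 f j hv hf hj har
        refine h1 v11 (v12 ++ v2) f (j + a) (by simp [hv]) hf (by omega) ?_
        rw [c2, cj_mul, ← mul_assoc]
        exact har.mul ((ha.cj _).cj _))
      (by
        intro z21 y z22 X1 Y1 a1 b1 hz hc hX1 ha1 hb1 hab1
        rw [cj_append, c1] at hc
        refine h3 (z1 ++ z21) y z22 X1 (Y1 * Y.cj z21 A) a1 (b1 + a) (by simp [hz]) ?_ hX1
          ha1 (hb1.mul (ha.cj _)) (by omega)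
        rw [← List.append_assoc, cj_append, hZA, cj_mul, hc, mul_assoc])
      (by
        intro z21 z22 p q hz hE
        rw [cj_append, c1] at hE
        have := H1 (z1 ++ z21) z22 p q (by simp [hz]) (by
          rw [← List.append_assoc, cj_append, hZA, cj_mul]
          exact hE.mul_right (ha.cj _) (by omega))
        rwa [cj_append] at this)
      (by
        intro v11 v12 z21 z22 A1 Z1 a1 b1 hv hz hc hA1 hZ1 ha1 hb1 hab1
        have hT : Y.Ar a (Y.cj v11 (Y.cj z2 A)) := (ha.cj _).cj _
        have := H2 v11 (v12 ++ v2) (z1 ++ z21) z22 (A1 * (Z1 * Y.cj v11 (Y.cj z2 A) * Z1⁻¹)) Z1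
          (a1 + a) b1 (by simp [hv]) (by simp [hz]) (by
            rw [c2, cj_mul, hc]; group) (by
            rw [map_mul, map_mul, map_mul, map_inv, π_cj, π_cj, hA1, hZ1, hA, hz]
            simp only [mk_append]; group) hZ1 (ha1.mul (hT.conj _)) hb1 (by omega)
        rwa [cj_append] at this)
    -- combine
    obtain ⟨v1', s, hs⟩ := exists_last hv1n
    obtain ⟨q, v2', hq⟩ := exists_head hv2n
    obtain ⟨z1', p, hp⟩ := exists_last hz1n
    obtain ⟨r, z2', hr⟩ := exists_head hz2n
    have key := cut_ineq (n := n) (x := Y.cj z1 X) (p := p) (q := q) (r := r) (s := s) (by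
      intro e1 e2
      obtain ⟨f, hf, j, hj, har⟩ := H2 v1 v2 z1 z2 A Z a b rfl rfl hAZ hA hZ ha hb hab
      refine ⟨i, ?_, ?_, f, hf, j, hj, har⟩
      · rw [e1, linv_fst]; exact hvl q (by simp [hq])
      · rw [e2, linv_fst]; exact hvl s (by simp [hs]))
    rw [gsum_append, lsum_append, jn_append_left _ hz2n, jn_append_right _ hv1n,
      jn_append_left _ hv2n, jn_append_right _ hz1n]
    have j1 : jn (Y.turn n (Y.cj z1 X)) z1 z2 = Y.turn n (Y.cj z1 X) p r :=
      jn_some _ (by simp [hp]) (by simp [hr])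
    have j2 : jn (lc Y.c) v1 v2 = lc Y.c s q := jn_some _ (by simp [hs]) (by simp [hq])
    have j3 : jn Y.U v1 z2 = Y.U s r := jn_some _ (by simp [hs]) (by simp [hr])
    have j4 : jn Y.U z1 v2 = Y.U p q := jn_some _ (by simp [hp]) (by simp [hq])
    rw [j1, j2]
    rw [j4] at IA
    rw [j3] at IB
    linarith

end Sys
end Pride

namespace Pride

open FreeGroup hiding map_mul map_inv map_one

variable {S Γ I : Type*} [Group Γ] {Y : Sys S Γ I}

namespace Sys

theorem csum_two (n : ℕ) (x : Γ) (a : S × Bool) : Y.csum n x [a, linv a] = 2 := by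
  have h : jn (Y.turn n x) [a, linv a] [a, linv a] = Y.turn n x (linv a) a :=
    jn_some _ (by simp) (by simp)
  unfold csum
  rw [h]
  simp only [gsum]
  rw [Y.turn_of_eq _ _ rfl, Y.turn_of_eq _ _ (by rw [linv_linv])]
  norm_num

/-- the main computation for a face at the beginning of the boundary word -/
theorem gb_face {n m : ℕ} (hn : n = m + 1) (hGB : ∀ k < n, Y.GB k) (hCl : ∀ k < n, Y.Claim k)
    (i : I) (N : ℕ) : ∀ (v e z : List (S × Bool)) (x f : Γ), v.length ≤ N → e ≠ [] →
    Y.π x = FreeGroup.mk (e ++ z) → Y.Ar n x → (∀ m < n, ¬ Y.Ar m x) → Y.Prime n x (e ++ z) →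
    IsCyclicallyReduced (e ++ z) → f ∈ Y.K i → Y.π f = FreeGroup.mk (e ++ invRev v) →
    IsCyclicallyReduced (e ++ invRev v) → Y.Ar m (f⁻¹ * x) → 2 ≤ Y.csum n x (e ++ z) := by
  induction N with
  | zero => ?_
  | succ N IH => ?_
  all_goals
    intro v e z x f hN he hπ hx hmin hprime hcr hf hfπ hfcr har
    have hlab := Y.lett i f _ hf (cr_iff.1 hfcr).1 hfπ
    have hle : ∀ a ∈ e, a.1 ∈ Y.lab i := fun a ha => hlab a (by simp [ha])
    have hlv : ∀ a ∈ v, a.1 ∈ Y.lab i := by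
      intro a ha
      have := hlab (linv a) (by
        rw [List.mem_append]; right
        simp only [invRev, List.mem_reverse, List.mem_map]
        exact ⟨a, ha, rfl⟩)
      exact this
    have hexp : ∀ e1, (∀ a ∈ e1, a.1 ∈ Y.lab i) → ∀ a b, a.1 ∈ Y.lab i → b.1 ∈ Y.lab i →
        Y.Ex n (Y.cj e1 x) a b := by
      intro e1 he1 a b ha hb
      refine ⟨i, ha, hb, Y.cj e1 f⁻¹, cj_mem he1 ((Y.K i).inv_mem hf), m, by omega, ?_⟩
      rw [← cj_mul]; exact har.cj _
    have htsum : lsum (lc Y.c) e ≤ Y.gsum (Y.turn n) x e := by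
      rw [← Y.gsum_const (lc Y.c) e x]
      apply gsum_le
      intro l1 a b l2 hl
      apply turn_of_ex
      exact hexp _ (fun c hc => hle c (by
        rw [hl]; simp only [List.mem_append, List.mem_singleton, List.mem_cons] at hc ⊢; tauto))
        _ _ (hle _ (by simp [hl])) (hle _ (by simp [hl]))
    by_cases hz : z = []
    · subst hz
      rw [List.append_nil] at *
      have hxK : Y.Ar 1 x := by
        have h1 : Y.π (f⁻¹ * x) = FreeGroup.mk v := by
          rw [map_mul, map_inv, hfπ, hπ, mk_append, mk_invRev]; group
        have := hCl m (by omega) _ v i har h1 hlv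
        have h2 : x ∈ Y.K i := by
          have := (Y.K i).mul_mem hf this
          simpa using this
        exact Ar.of h2
      have hxK' : x ∈ Y.K i := by
        have h1 : Y.π (f⁻¹ * x) = FreeGroup.mk v := by
          rw [map_mul, map_inv, hfπ, hπ, mk_append, mk_invRev]; group
        have := (Y.K i).mul_mem hf (hCl m (by omega) _ v i har h1 hlv)
        simpa using this
      have hs := Y.syl i x e hxK' hcr he hπ
      unfold csum
      have : jn (lc Y.c) e e ≤ jn (Y.turn n x) e e := by
        obtain ⟨e', el, hel⟩ := exists_last he
        obtain ⟨ef, e'', hef⟩ := exists_head he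
        have j : ∀ φ : S × Bool → S × Bool → ℝ, jn φ e e = φ el ef := fun φ =>
          jn_some φ (by simp [hel]) (by simp [hef])
        rw [j, j]
        apply turn_of_ex
        have := hexp [] (by simp) el ef (hle _ (by simp [hel])) (hle _ (by simp [hef]))
        simpa using this
      linarith
    by_cases hv : v = []
    · exfalso
      subst hv
      have hfe : Y.π f = FreeGroup.mk e := by simpa [invRev] using hfπ
      have := hprime [] e z (by simp) f (f⁻¹ * x) 1 m (by simp) hfe (Ar.of hf) har (by omega)
      simp [he, hz] at this
    by_cases hb1 : ∃ v' a z', v = v' ++ [a] ∧ z = linv a :: z'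
    · first
      | (obtain ⟨v', a, z', rfl, rfl⟩ := hb1
         simp at hN; done)
      | (obtain ⟨v', a, z', rfl, rfl⟩ := hb1
         have e1 : e ++ linv a :: z' = (e ++ [linv a]) ++ z' := by simp
         have e2 : e ++ invRev (v' ++ [a]) = (e ++ [linv a]) ++ invRev v' := by
           rw [invRev_append']; simp [invRev, linv]
         rw [e1] at hπ hprime hcr ⊢
         rw [e2] at hfπ hfcr
         exact IH v' (e ++ [linv a]) z' x f (by simp at hN; omega) (by simp) hπ hx hmin hprime hcr hf
           hfπ hfcr har)
    by_cases hb2 : ∃ v' a z', v = a :: v' ∧ z = z' ++ [linv a]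
    · first
      | (obtain ⟨v', a, z', rfl, rfl⟩ := hb2
         simp at hN; done)
      | (obtain ⟨v', a, z', rfl, rfl⟩ := hb2
         have e1 : e ++ (z' ++ [linv a]) = (e ++ z') ++ [linv a] := by simp
         rw [e1] at hπ hprime hcr ⊢
         rw [invRev_cons', ← List.append_assoc] at hfπ hfcr
         have e3 : linv a :: (e ++ z') = (linv a :: e) ++ z' := by simp
         rw [csum_rotate hx hπ, e3]
         have hcr2 := cr_rotate hcr
         have hfcr2 := cr_rotate hfcr
         refine IH v' (linv a :: e) z' _ (Y.W [linv a] * f * (Y.W [linv a])⁻¹)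
           (by simp at hN; omega) (by simp) ?_ (hx.conj _) ?_ ?_ (by simpa using hcr2)
           (Y.norm i (linv a) f (hlv a (by simp)) hf) ?_ (by simpa using hfcr2) ?_
         · rw [← e3, mk_cons (linv a) (e ++ z'), map_mul, map_mul, hπ, map_inv, π_W,
             mk_append (e ++ z')]; group
         · intro m hm h
           apply hmin m hm
           convert h.conj' (Y.W [linv a]) using 1; group
         · rw [← e3]; exact prime_rotate hπ hprime
         · rw [List.cons_append, mk_cons (linv a) (e ++ invRev v'), map_mul, map_mul, hfπ, map_inv, π_W,
             mk_append (e ++ invRev v')]; group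
         · convert har.conj (Y.W [linv a]) using 1; group)
    -- main case
    have hk1 : Y.cj e x = Y.cj v (f⁻¹ * x * f) := by
      have h1 := hx.cj_eq (p := e) (g := f * Y.W v) (by
        rw [map_mul, hfπ, π_W, mk_append, mk_invRev]; group)
      rw [h1, cj]; group
    have hvr : IsReduced v := by
      have := (cr_iff.1 hfcr).1
      rw [isReduced_append_iff] at this
      have := red_invRev this.2.1
      rwa [invRev_invRev] at this
    have hπ' : Y.π (f⁻¹ * x) = FreeGroup.mk (v ++ z) := by
      rw [map_mul, map_inv, hfπ, hπ]; simp only [mk_append, mk_invRev]; group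
    -- conjugates of X
    have hX : ∀ z1, Y.cj z1 (Y.cj e x) = Y.cj (v ++ z1) (f⁻¹ * x) * Y.cj (v ++ z1) f := by
      intro z1
      rw [hk1, ← cj_append, cj_mul]
    have Q := Qlemma (i := i) hGB hCl (v.length + z.length) v z (f⁻¹ * x) (Y.cj e x) m le_rfl
      (by omega) hv hz hvr hlv hπ' har
      (by
        intro v1 v2 f1 j hv12 hf1 hj har1
        have hv1 : ∀ a ∈ v1, a.1 ∈ Y.lab i := fun a ha => hlv a (by simp [hv12, ha])
        apply hmin (1 + j) (by omega)
        have h2 : Y.cj v1 f * f1⁻¹ ∈ Y.K i :=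
          (Y.K i).mul_mem (cj_mem hv1 hf) ((Y.K i).inv_mem hf1)
        have := (Ar.of h2).mul har1
        apply Ar.of_cj (p := v1)
        convert this using 1
        rw [cj_mul, cj_inv]; group)
      (by
        intro z1 y z2 X1 Y1 a b hz1 hc hX1 ha hb hab
        have := hprime (e ++ z1) y z2 (by rw [hz1]; simp) X1 (Y1 * Y.cj (v ++ z1) f) a (b + 1) (by
          rw [cj_append, hX, hc, mul_assoc]) hX1 ha (hb.mul ((Ar.of hf).cj _)) (by omega)
        simpa [he] using this)
      (by
        intro z1 z2 p q hz1 hE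
        rw [hX]
        exact hE.mul_right ((Ar.of hf).cj _) (by omega))
      (by
        intro v1 v2 z1 z2 A Z a b hv12 hz12 hc hA hZ ha hb hab
        have hv1 : ∀ a ∈ v1, a.1 ∈ Y.lab i := fun a ha => hlv a (by simp [hv12, ha])
        have hf1 : Y.cj v1 f ∈ Y.K i := cj_mem hv1 hf
        refine ⟨(Y.cj v1 f)⁻¹, (Y.K i).inv_mem hf1, b + a, by omega, ?_⟩
        have : Y.cj z1 (Y.cj e x) = Z * Y.cj v1 f * A := by
          rw [hX, ← cj_mul, hv12, List.append_assoc, cj_append, cj_mul, hc,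
            ((ha.mul hb).mul (Ar.of hf1)).cj_eq hA]
          group
        rw [this]
        convert (hb.conj' (Y.cj v1 f)).mul ha using 1; group)
    have hs := Y.syl i f _ hf hfcr (by simp [he]) hfπ
    unfold csum
    obtain ⟨e', el, hel⟩ := exists_last he
    obtain ⟨ef, e'', hef⟩ := exists_head he
    obtain ⟨v', vl, hvl'⟩ := exists_last hv
    obtain ⟨vf, v'', hvf'⟩ := exists_head hv
    obtain ⟨z', zl, hzl'⟩ := exists_last hz
    obtain ⟨zf, z'', hzf'⟩ := exists_head hz
    have hiv : invRev v ≠ [] := by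
      rw [hvf', invRev_cons']; simp
    rw [gsum_append, jn_append_left _ hz, jn_append_right _ he]
    rw [lsum_append, lsum_invRev, jn_append_left _ hiv, jn_append_right _ he] at hs
    have j1 : jn (lc Y.c) e (invRev v) = lc Y.c el vl := by
      rw [jn_some _ (a := el) (b := linv vl) (by simp [hel])
        (by rw [head?_invRev]; simp [hvl']), lc_linv]
    have j2 : jn (lc Y.c) (invRev v) e = lc Y.c vf ef := by
      rw [jn_some _ (a := linv vf) (b := ef) (by rw [getLast?_invRev]; simp [hvf'])
        (by simp [hef]), lc_linv']
    have j3 : jn (Y.turn n (Y.cj e x)) e z = Y.turn n (Y.cj e x) el zf :=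
      jn_some _ (by simp [hel]) (by simp [hzf'])
    have j4 : jn (Y.turn n x) z e = Y.turn n x zl ef := jn_some _ (by simp [hzl']) (by simp [hef])
    have j5 : jn Y.U z v = lc Y.c zl vf := by
      rw [jn_some _ (a := zl) (b := vf) (by simp [hzl']) (by simp [hvf']), U_of_ne]
      intro h
      exact hb2 ⟨v'', vf, z', hvf', by rw [hzl', h, linv_linv]⟩
    have j6 : jn Y.U v z = lc Y.c vl zf := by
      rw [jn_some _ (a := vl) (b := zf) (by simp [hvl']) (by simp [hzf']), U_of_ne]
      intro h
      exact hb1 ⟨v', vl, z'', hvl', by rw [hzf', h]⟩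
    rw [j1, j2] at hs
    rw [j5, j6] at Q
    rw [j3, j4]
    have t1 := Y.neg_le_turn n (Y.cj e x) el zf
    have t2 := Y.neg_le_turn n x zl ef
    have t3 := Y.lc_tri el vl zf
    have t4 := Y.lc_tri zl vf ef
    linarith

theorem gb_step {n : ℕ} (hGB : ∀ k < n, Y.GB k) (hCl : ∀ k < n, Y.Claim k) : Y.GB n := by
  intro x w hw hπ hx hmin hprime
  by_cases hcr : IsCyclicallyReduced w
  · obtain ⟨e, z, rfl⟩ := exists_head hw
    have hred := (cr_iff.1 hcr).1
    rcases peel hx hred hπ with ⟨m, i, f, q, hn, hf, hfπ, hfcr, har⟩ |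
      ⟨y, y', A, B, a, b, hab, ha, hb, hz, hA, hB, hxe⟩
    · have := gb_face hn hGB hCl i (invRev q).length (invRev q) [e] z x f le_rfl (by simp)
        (by simpa using hπ) hx hmin (by simpa using hprime) (by simpa using hcr) hf
        (by rw [invRev_invRev]; simpa using hfπ) (by rw [invRev_invRev]; simpa using hfcr) har
      simpa using this
    · exfalso
      have := hprime [e] y (linv e :: y') (by rw [hz]; simp) A ((Y.W [e])⁻¹ * B * Y.W [e]) a b
        (by rw [hxe, cj]; group) hA ha (hb.conj' _) (by omega)
      have hy : y = [] := by simpa using this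
      rw [hz, hy] at hred
      simp only [List.nil_append, isReduced_cons_cons'] at hred
      exact hred.1 rfl
  · have : ∃ a, w = [a, linv a] := by
      by_cases hr : IsReduced w
      · rw [cr_iff] at hcr
        push Not at hcr
        obtain ⟨a, ha, b, hb, hab⟩ := hcr hr
        obtain ⟨b', w', rfl⟩ := exists_head hw
        simp at hb
        subst hb
        have hw' : w' ≠ [] := by
          rintro rfl
          simp at ha; subst ha
          exact linv_ne _ hab.symm
        obtain ⟨w'', a', rfl⟩ := exists_last hw'
        have ha' : a' = a := by
          rw [← List.cons_append, List.getLast?_append] at ha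
          simpa using ha
        subst ha'
        have := hprime [b'] w'' [a'] (by simp) (Y.cj [b'] x) 1 n 0 (by simp) (by
          rw [π_cj, hπ, mk_cons b' (w'' ++ [a']), mk_append, hab, mk_linv]; group) (hx.cj _) Ar.one le_rfl
        have : w'' = [] := by simpa using this
        subst this
        exact ⟨b', by rw [hab, linv_linv]; rfl⟩
      · obtain ⟨α, a, γ, rfl⟩ := not_red hr
        have := hprime α [a, linv a] γ rfl 1 (Y.cj α x) 0 n (by simp) (by
          rw [mk_cons, mk_linv, map_one]; group) Ar.one (hx.cj _) (by omega)
        have : α = [] ∧ γ = [] := by simpa using this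
        exact ⟨a, by simp [this.1, this.2]⟩
    obtain ⟨a, rfl⟩ := this
    rw [csum_two]

theorem sphere_step {n : ℕ} (hCl : ∀ k < n, Y.Claim k) {x : Γ} (hx : Y.Ar n x)
    (hπ : Y.π x = 1) : x = 1 := by
  cases hx with
  | one => rfl
  | cons n x i f g hx hf =>
    obtain ⟨l, hl, hl2⟩ := exists_red (Y.π f)
    have hlab := Y.lett i f l hf hl hl2.symm
    have h1 : Y.π (g⁻¹ * x * g) = FreeGroup.mk (invRev l) := by
      rw [mk_invRev, hl2]
      simp only [map_mul, map_inv] at hπ ⊢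
      have : Y.π x = Y.π g * (Y.π f)⁻¹ * (Y.π g)⁻¹ := by
        calc Y.π x = (Y.π g * Y.π f * (Y.π g)⁻¹)⁻¹ * (Y.π g * Y.π f * (Y.π g)⁻¹ * Y.π x) := by group
          _ = _ := by rw [hπ]; group
      rw [this]; group
    have h2 := hCl n (by omega) _ _ i (hx.conj' g) h1 (by
      intro a ha
      simp only [invRev, List.mem_reverse, List.mem_map] at ha
      obtain ⟨b, hb, rfl⟩ := ha
      exact hlab b hb)
    have h3 := (Y.K i).mul_mem hf h2
    have h4 := Y.inj i _ h3 (by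
      rw [map_mul, h1, mk_invRev, hl2]; group)
    calc g * f * g⁻¹ * x = g * (f * (g⁻¹ * x * g)) * g⁻¹ := by group
      _ = 1 := by rw [h4]; group

theorem claim_step {n : ℕ} (hGB : Y.GB n) (hCl : ∀ k < n, Y.Claim k) : Y.Claim n := by
  intro x l i hx hπ hl
  by_cases hmin : ∃ m < n, Y.Ar m x
  · obtain ⟨m, hm, h⟩ := hmin
    exact hCl m hm x l i h hπ hl
  push Not at hmin
  -- reduce
  classical
  have hl' : ∀ a ∈ FreeGroup.reduce l, a.1 ∈ Y.lab i := by
    intro a ha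
    exact hl a ((FreeGroup.Red.sublist (FreeGroup.reduce.red (L := l))).mem ha)
  have hπ2 : Y.π x = FreeGroup.mk (FreeGroup.reduce l) := by
    rw [hπ]; exact (FreeGroup.reduce.self).symm
  obtain ⟨p, u, hpu, hcr⟩ := exists_cr _ (FreeGroup.isReduced_iff_reduce_eq.2 FreeGroup.reduce.idem :
    IsReduced (FreeGroup.reduce l))
  rw [hpu] at hl' hπ2
  have hlp : ∀ a ∈ p, a.1 ∈ Y.lab i := fun a ha => hl' a (by simp [ha])
  have hlu : ∀ a ∈ u, a.1 ∈ Y.lab i := fun a ha => hl' a (by simp [ha])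
  apply of_cj_mem hlp
  have hx0 : Y.Ar n (Y.cj p x) := hx.cj p
  have hmin0 : ∀ m < n, ¬ Y.Ar m (Y.cj p x) := fun m hm h => hmin m hm h.of_cj
  have hπ0 : Y.π (Y.cj p x) = FreeGroup.mk u := by
    rw [π_cj, hπ2]; simp only [mk_append, mk_invRev]; group
  generalize Y.cj p x = x0 at *
  by_cases hu : u = []
  · subst hu
    rw [sphere_step hCl hx0 hπ0]
    exact (Y.K i).one_mem
  by_cases hprime : Y.Prime n x0 u
  · by_contra hcon
    have hg := hGB x0 u hu hπ0 hx0 hmin0 hprime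
    have hturn : ∀ α a b, (∀ c ∈ α, c.1 ∈ Y.lab i) → a ∈ u → b ∈ u → b ≠ linv a →
        Y.turn n (Y.cj α x0) a b ≤ 0 := by
      intro α a b hα ha hb hab
      unfold turn
      simp only [hab, if_false]
      split_ifs with hE
      · obtain ⟨i', ha', hb', f, hf, j, hj, har⟩ := hE
        by_cases hab2 : a.1 = b.1
        · simp [lc, hab2, Y.cself]
        · exfalso
          have := Y.lab_eq i' i _ _ hab2 ha' hb' (hlu a ha) (hlu b hb)
          subst this
          obtain ⟨q, hq, hq2⟩ := exists_red (Y.π f)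
          have hlab := Y.lett i' f q hf hq hq2.symm
          have h1 := hCl j hj _ (q ++ (invRev α ++ u ++ α)) i' har (by
            rw [map_mul, π_cj, hπ0]; simp only [mk_append, mk_invRev, hq2]) (by
            intro c hc
            simp only [List.mem_append, invRev, List.mem_reverse, List.mem_map] at hc
            rcases hc with hc | (⟨d, hd, rfl⟩ | hc) | hc
            · exact hlab c hc
            · exact hα d hd
            · exact hlu c hc
            · exact hα c hc)
          have h2 := (Y.K i').mul_mem ((Y.K i').inv_mem hf) h1
          rw [inv_mul_cancel_left] at h2
          exact hcon (of_cj_mem hα h2)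
      · have := Y.lc_nonneg a b; linarith
    have hr := (cr_iff.1 hcr)
    have b1 : Y.gsum (Y.turn n) x0 u ≤ 0 := by
      have : Y.gsum (Y.turn n) x0 u ≤ Y.gsum (fun _ => fun _ _ => (0 : ℝ)) x0 u := by
        apply gsum_le
        intro l1 a b l2 hl
        apply hturn
        · intro c hc
          apply hlu
          rw [hl]; simp only [List.mem_append, List.mem_singleton, List.mem_cons] at hc ⊢; tauto
        · simp [hl]
        · simp [hl]
        · have : IsReduced (a :: b :: l2) := red_sub hr.1 ⟨l1, [], by rw [hl]; simp⟩
          exact (isReduced_cons_cons'.1 this).1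
      have h0 : ∀ (u : List (S × Bool)) (x : Γ), Y.gsum (fun _ => fun _ _ => (0 : ℝ)) x u = 0 := by
        intro u
        induction u with
        | nil => intro x; rfl
        | cons a u ih =>
          intro x
          cases u with
          | nil => rfl
          | cons b u => simp only [gsum, zero_add]; exact ih _
      rw [h0] at this; exact this
    have b2 : jn (Y.turn n x0) u u ≤ 0 := by
      obtain ⟨e', el, hel⟩ := exists_last hu
      obtain ⟨ef, e'', hef⟩ := exists_head hu
      rw [jn_some _ (a := el) (b := ef) (by simp [hel]) (by simp [hef])]
      have := hturn [] el ef (by simp) (by simp [hel]) (by simp [hef])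
        (hr.2 el (by simp [hel]) ef (by simp [hef]))
      simpa using this
    unfold csum at hg
    linarith
  · unfold Prime at hprime
    push Not at hprime
    obtain ⟨α, β, γ, hw, A, Z, a, b, hAZ, hA, ha, hb, hab, hβ, hαγ⟩ := hprime
    have hr := (cr_iff.1 hcr).1
    have hβr : IsReduced β := red_sub hr ⟨α, γ, by rw [hw]⟩
    have hapos := ar_pos ha hA hβr hβ
    have hZ : Y.π Z = FreeGroup.mk (γ ++ α) := by
      have h4 := congrArg Y.π hAZ
      rw [π_cj, map_mul, hA, hπ0, hw] at h4
      simp only [mk_append] at h4 ⊢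
      have h5 : FreeGroup.mk β * Y.π Z =
        FreeGroup.mk β * (FreeGroup.mk γ * FreeGroup.mk α) := by
        rw [← h4]; group
      exact mul_left_cancel h5
    have hγr : IsReduced (γ ++ α) := by
      rw [hw] at hcr
      have := (cr_iff.1 (cr_rotate hcr)).1
      exact red_sub this ⟨[], β, by simp⟩
    have hbpos := ar_pos hb hZ hγr (by
      intro h
      rw [List.append_eq_nil_iff] at h
      exact hαγ h.2 h.1)
    have hA2 := hCl a (by omega) A β i ha hA (fun c hc => hlu c (by simp [hw, hc]))
    have hZ2 := hCl b (by omega) Z _ i hb hZ (fun c hc => hlu c (by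
      rw [hw]; simp only [List.mem_append] at hc ⊢; tauto))
    apply of_cj_mem (p := α) (fun c hc => hlu c (by simp [hw, hc]))
    rw [hAZ]
    exact (Y.K i).mul_mem hA2 hZ2

theorem gb_claim (n : ℕ) : Y.GB n ∧ Y.Claim n := by
  induction n using Nat.strong_induction_on with
  | _ n ih =>
    have h1 := gb_step (fun k hk => (ih k hk).1) (fun k hk => (ih k hk).2)
    exact ⟨h1, claim_step h1 (fun k hk => (ih k hk).2)⟩

theorem claim {n : ℕ} {x : Γ} {l : List (S × Bool)} {i : I} (hx : Y.Ar n x)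
    (hπ : Y.π x = FreeGroup.mk l) (hl : ∀ a ∈ l, a.1 ∈ Y.lab i) : x ∈ Y.K i :=
  (gb_claim n).2 x l i hx hπ hl

theorem sphere {n : ℕ} {x : Γ} (hx : Y.Ar n x) (hπ : Y.π x = 1) : x = 1 :=
  sphere_step (fun k _ => (gb_claim k).2) hx hπ

end Sys
end Pride

namespace Pride
open FreeGroup hiding map_mul map_inv map_one
variable {S : Type*}

theorem altWord_map {G H : Type*} [Monoid G] [Monoid H] (f : G →* H) (n : ℕ) : ∀ s t : G,
    f (altWord s t n) = altWord (f s) (f t) n := by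
  induction n with
  | zero => intro s t; simp [altWord]
  | succ n ih => intro s t; simp [altWord, ih]

theorem altWord_conj {H : Type*} [Group H] (x j : H) (h2 : j * (j * x * j⁻¹) * j⁻¹ = x) (n : ℕ) :
    altWord x (j * x * j⁻¹) n = (x * j) ^ n * (j⁻¹) ^ n ∧
    altWord (j * x * j⁻¹) x n = j * altWord x (j * x * j⁻¹) n * j⁻¹ := by
  have h : ∀ n, altWord (j * x * j⁻¹) x n = j * altWord x (j * x * j⁻¹) n * j⁻¹ := by
    intro n
    have := altWord_map (MulAut.conj j).toMonoidHom n x (j * x * j⁻¹)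
    simp only [MulEquiv.coe_toMonoidHom, MulAut.conj_apply] at this
    rw [this, h2]
  refine ⟨?_, h n⟩
  induction n with
  | zero => simp [altWord]
  | succ n ih =>
    rw [altWord, h n, ih, pow_succ', pow_succ]
    group

/-- the rotation -/
def Jp : Equiv.Perm (ℝ × ℝ) where
  toFun v := (-v.2, v.1)
  invFun v := (v.2, -v.1)
  left_inv v := by simp
  right_inv v := by simp

/-- upper transvection -/
def Up (L : ℝ) : Equiv.Perm (ℝ × ℝ) where
  toFun v := (v.1 + L * v.2, v.2)
  invFun v := (v.1 - L * v.2, v.2)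
  left_inv v := by simp
  right_inv v := by simp

/-- lower transvection -/
def Lo (L : ℝ) : Equiv.Perm (ℝ × ℝ) where
  toFun v := (v.1, v.2 - L * v.1)
  invFun v := (v.1, v.2 + L * v.1)
  left_inv v := by simp
  right_inv v := by simp

theorem Lo_eq (L : ℝ) : Lo L = Jp * Up L * Jp⁻¹ := by
  rw [eq_mul_inv_iff_mul_eq]
  ext v <;> simp [Lo, Jp, Up, Equiv.Perm.mul_apply] <;> ring

theorem Up_eq (L : ℝ) : Jp * Lo L * Jp⁻¹ = Up L := by
  rw [mul_inv_eq_iff_eq_mul]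
  ext v <;> simp [Lo, Jp, Up, Equiv.Perm.mul_apply] <;> ring

theorem UpJ_pow (f : ℕ → ℝ) (L : ℝ) (h0 : f 0 = 0) (h1 : f 1 = 1)
    (h2 : ∀ n, f (n + 2) = L * f (n + 1) - f n) (n : ℕ) (v : ℝ × ℝ) :
    ((Up L * Jp) ^ (n + 1)) v = (f (n + 2) * v.1 - f (n + 1) * v.2, f (n + 1) * v.1 - f n * v.2) := by
  induction n with
  | zero => simp [Up, Jp, Equiv.Perm.mul_apply, h0, h1, h2 0]; ring
  | succ n ih =>
    rw [pow_succ', Equiv.Perm.mul_apply, ih]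
    simp only [Up, Jp, Equiv.Perm.mul_apply, Equiv.coe_fn_mk]
    rw [h2 (n + 1), h2 n]
    ext <;> simp <;> ring

theorem braid_UpLo (f : ℕ → ℝ) (L : ℝ) (h0 : f 0 = 0) (h1 : f 1 = 1)
    (h2 : ∀ n, f (n + 2) = L * f (n + 1) - f n) (m : ℕ) (hm : f (m + 1) = 0)
    (hm' : f m = 1) : altWord (Up L) (Lo L) (m + 1) = altWord (Lo L) (Up L) (m + 1) := by
  have e : Jp * (Jp * Up L * Jp⁻¹) * Jp⁻¹ = Up L := by rw [← Lo_eq, Up_eq]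
  have := altWord_conj (Up L) Jp e (m + 1)
  rw [Lo_eq, this.2, this.1]
  have e2 : (Up L * Jp) ^ (m + 1) = Jp ^ 2 := by
    ext v <;> rw [UpJ_pow f L h0 h1 h2] <;>
    simp [h2 m, hm, hm', pow_two, Jp, Equiv.Perm.mul_apply]
  rw [e2]
  group

/-- the sequence of sines -/
theorem sine_seq (m : ℕ) (hm : 3 ≤ m) : ∃ (f : ℕ → ℝ) (L : ℝ), f 0 = 0 ∧ f 1 = 1 ∧
    (∀ n, f (n + 2) = L * f (n + 1) - f n) ∧ f m = 0 ∧ f (m - 1) = 1 ∧ 0 < L ∧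
    ∀ k, 1 ≤ k → k < m → 0 < f k := by
  have hm0 : (0 : ℝ) < m := by positivity
  have hm3 : (3 : ℝ) ≤ m := by exact_mod_cast hm
  set θ := Real.pi / m with hθ
  have hpos : 0 < θ := by positivity
  have hmθ : m * θ = Real.pi := by rw [hθ]; field_simp
  have hlt : θ < Real.pi / 2 := by rw [← hmθ]; nlinarith
  have hs : 0 < Real.sin θ := Real.sin_pos_of_pos_of_lt_pi hpos (by linarith)
  refine ⟨fun k => Real.sin (k * θ) / Real.sin θ, 2 * Real.cos θ, by simp, ?_, ?_, ?_, ?_, ?_, ?_⟩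
  · simp [hs.ne']
  · intro n
    have e1 : ((n + 2 : ℕ) : ℝ) * θ = (n + 1 : ℕ) * θ + θ := by push_cast; ring
    have e2 : ((n : ℕ) : ℝ) * θ = (n + 1 : ℕ) * θ - θ := by push_cast; ring
    simp only
    rw [e1, e2, Real.sin_add, Real.sin_sub]
    field_simp
    ring
  · simp only; rw [hmθ]; simp
  · have e1 : ((m - 1 : ℕ) : ℝ) * θ = Real.pi - θ := by
      rw [Nat.cast_sub (by omega)]; push_cast; rw [sub_mul, hmθ]; ring
    simp only
    rw [e1, Real.sin_pi_sub]
    exact div_self hs.ne'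
  · have := Real.cos_pos_of_mem_Ioo (x := θ) ⟨by linarith, hlt⟩
    linarith
  · intro k h1 h2
    have h1' : (1 : ℝ) ≤ k := by exact_mod_cast h1
    have h2' : (k : ℝ) < m := by exact_mod_cast h2
    apply div_pos _ hs
    apply Real.sin_pos_of_pos_of_lt_pi
    · positivity
    · rw [← hmθ]; exact mul_lt_mul_of_pos_right h2' hpos

end Pride

namespace Pride
open FreeGroup hiding map_mul map_inv map_one
variable {S : Type*}

open Classical in
/-- number of label changes in a word -/
noncomputable def nc : List (S × Bool) → ℕ
  | [] => 0
  | [_] => 0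
  | a :: b :: l => (if a.1 = b.1 then 0 else 1) + nc (b :: l)

theorem nc_same {a b : S × Bool} (l) (h : a.1 = b.1) : nc (a :: b :: l) = nc (b :: l) := by
  simp [nc, h]
theorem nc_diff {a b : S × Bool} (l) (h : a.1 ≠ b.1) : nc (a :: b :: l) = nc (b :: l) + 1 := by
  simp [nc, h, add_comm]

theorem nc_split (l : List (S × Bool)) : ∀ k, k < nc l → ∃ p a b q, l = p ++ a :: b :: q ∧
    a.1 ≠ b.1 ∧ nc (p ++ [a]) = k ∧ nc (b :: q) + k + 1 = nc l := by
  induction l with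
  | nil => intro k h; simp [nc] at h
  | cons x l ih =>
    cases l with
    | nil => intro k h; simp [nc] at h
    | cons y l =>
      intro k h
      by_cases hxy : x.1 = y.1
      · rw [nc_same _ hxy] at h
        obtain ⟨p, a, b, q, h1, h2, h3, h4⟩ := ih k h
        refine ⟨x :: p, a, b, q, by rw [h1]; rfl, h2, ?_, by rw [nc_same _ hxy, h4]⟩
        cases p with
        | nil => simp at h1; simp only [List.cons_append, List.nil_append] at h3 ⊢
                 rw [nc_same _ (h1.1 ▸ hxy), h3]
        | cons z p => simp at h1; simp only [List.cons_append] at h3 ⊢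
                      rw [nc_same _ (h1.1 ▸ hxy), h3]
      · rw [nc_diff _ hxy] at h ⊢
        cases k with
        | zero => exact ⟨[], x, y, l, rfl, hxy, by simp [nc], by omega⟩
        | succ k =>
          obtain ⟨p, a, b, q, h1, h2, h3, h4⟩ := ih k (by omega)
          refine ⟨x :: p, a, b, q, by rw [h1]; rfl, h2, ?_, by omega⟩
          cases p with
          | nil => simp at h1; simp only [List.cons_append, List.nil_append] at h3 ⊢
                   rw [nc_diff _ (h1.1 ▸ hxy), h3]
          | cons z p => simp at h1; simp only [List.cons_append] at h3 ⊢
                        rw [nc_diff _ (h1.1 ▸ hxy), h3]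

theorem nc_zero {a : S × Bool} (l : List (S × Bool)) (h : nc (a :: l) = 0) :
    ∀ b ∈ l, b.1 = a.1 := by
  induction l generalizing a with
  | nil => simp
  | cons b l ih =>
    by_cases hab : a.1 = b.1
    · rw [nc_same _ hab] at h
      intro c hc
      rcases List.mem_cons.1 hc with rfl | hc
      · exact hab.symm
      · rw [ih h c hc, hab]
    · rw [nc_diff _ hab] at h; omega

/-- parity of number of changes for two labels -/
theorem nc_parity {s t : S} {a : S × Bool} (l : List (S × Bool)) (b : S × Bool)
    (hl : ∀ c ∈ a :: l, c.1 = s ∨ c.1 = t) (hb : (a :: l).getLast? = some b) :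
    (Even (nc (a :: l)) ↔ a.1 = b.1) := by
  induction l generalizing a with
  | nil => simp at hb; simp [nc, hb]
  | cons c l ih =>
    have := ih (fun c hc => hl c (List.mem_cons_of_mem _ hc)) (by simpa using hb)
    by_cases hac : a.1 = c.1
    · rw [nc_same _ hac, this, hac]
    · rw [nc_diff _ hac, Nat.even_add_one, this]
      have hbm : b ∈ a :: c :: l := List.mem_of_getLast? hb
      have h1 := hl a (by simp)
      have h2 := hl c (by simp)
      have h3 := hl b hbm
      grind

/-- the core estimate -/
theorem core_step {A B L f0 f1 f2 η : ℝ} (hA : A ≠ 0) (hL : 0 < L)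
    (h2 : f2 = L * f1 - f0) (hf1 : 0 < f1) (hf2 : 0 < f2) (hB : |B| * f1 ≤ |A| * f0)
    (hη : η = 1 ∨ η = -1) :
    0 < η * (B + η * L * A) * A ∧ |A| * f2 ≤ |B + η * L * A| * f1 := by
  have hA' : 0 < |A| := abs_pos.2 hA
  have e1 : |η * L * A| = L * |A| := by
    rcases hη with rfl | rfl <;> simp [abs_mul, abs_of_pos hL]
  have hlt : |B| < L * |A| := by
    by_contra h
    push Not at h
    have : L * |A| * f1 ≤ |A| * f0 := le_trans (mul_le_mul_of_nonneg_right h hf1.le) hB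
    nlinarith
  constructor
  · have hsq : |A| * |A| = A * A := abs_mul_abs_self A
    have hBA : |B| * |A| = |B * A| := (abs_mul _ _).symm
    have h3 : |B * A| < L * (A * A) := by rw [← hBA, ← hsq]; nlinarith
    have := abs_lt.1 h3
    rcases hη with rfl | rfl <;> nlinarith
  · have h4 : L * |A| - |B| ≤ |B + η * L * A| := by
      rw [← e1]
      have h5 := abs_sub_abs_le_abs_sub (η * L * A) (-B)
      rw [abs_neg, sub_neg_eq_add, add_comm (η * L * A) B] at h5
      exact h5
    nlinarith

theorem core_same {A B L f0 f1 η : ℝ} (hL : 0 < L) (hf0 : 0 ≤ f0) (hpos : 0 < η * A * B)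
    (hB : |B| * f1 ≤ |A| * f0) (hη : η = 1 ∨ η = -1) :
    0 < η * (A + η * L * B) * B ∧ |B| * f1 ≤ |A + η * L * B| * f0 := by
  have hη2 : η * η = 1 := by rcases hη with rfl | rfl <;> norm_num
  constructor
  · have : η * (A + η * L * B) * B = η * A * B + (η * η) * (L * (B * B)) := by ring
    rw [this, hη2]
    nlinarith [mul_self_nonneg B, mul_nonneg hL.le (mul_self_nonneg B)]
  · refine hB.trans (mul_le_mul_of_nonneg_right ?_ hf0)
    apply sq_le_sq.1
    have : 0 ≤ L * (η * A * B) := by positivity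
    have h3 : (A + η * L * B) ^ 2 = A ^ 2 + 2 * (L * (η * A * B)) + (η * η) * (L * B) ^ 2 := by ring
    rw [h3, hη2]
    nlinarith [sq_nonneg (L * B)]
end Pride

namespace Pride
open FreeGroup hiding map_mul map_inv map_one
variable {S : Type*}

theorem nc_concat (l : List (S × Bool)) (b a : S × Bool) :
    nc (l ++ [b, a]) = nc (l ++ [b]) + nc [b, a] := by
  induction l with
  | nil => simp [nc]
  | cons x l ih =>
    cases l with
    | nil => by_cases h : x.1 = b.1 <;> simp [nc, h]
    | cons y l =>
      simp only [List.cons_append] at ih ⊢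
      by_cases h : x.1 = y.1
      · rw [nc_same _ h, nc_same _ h, ih]
      · rw [nc_diff _ h, nc_diff _ h, ih]; omega

theorem nc_invRev (l : List (S × Bool)) : nc (invRev l) = nc l := by
  induction l with
  | nil => rfl
  | cons a l ih =>
    cases l with
    | nil => simp [nc, invRev]
    | cons b l =>
      rw [invRev_cons', invRev_cons'] at *
      rw [List.append_assoc]
      simp only [List.cons_append, List.nil_append]
      rw [nc_concat, ih]
      by_cases h : a.1 = b.1
      · rw [nc_same _ h]; simp [nc, h]
      · rw [nc_diff _ h]; simp [nc, Ne.symm h]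

theorem red_const {a : S × Bool} (l : List (S × Bool)) (h : IsReduced (a :: l))
    (hl : ∀ b ∈ l, b.1 = a.1) : ∀ c ∈ a :: l, c = a := by
  induction l generalizing a with
  | nil => simp
  | cons b l ih =>
    rw [isReduced_cons_cons'] at h
    have hba : b = a := by
      have h1 := h.1
      rw [← ne_linv_iff] at h1
      have h2 := hl b (by simp)
      exact Prod.ext h2 (h1 h2.symm).symm
    subst hba
    have := ih h.2 (fun c hc => hl c (List.mem_cons_of_mem _ hc))
    intro c hc
    rcases List.mem_cons.1 hc with rfl | hc
    · rfl
    · exact this c hc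

/-- sign -/
def eps (b : Bool) : ℤ := if b then 1 else -1

/-- weight homomorphism -/
def wt (w : S → ℤ) : FreeGroup S →* Multiplicative ℤ :=
  FreeGroup.lift (fun x => Multiplicative.ofAdd (w x))

theorem wt_mk (w : S → ℤ) (l : List (S × Bool)) :
    Multiplicative.toAdd (wt w (FreeGroup.mk l)) = (l.map (fun a => eps a.2 * w a.1)).sum := by
  induction l with
  | nil => simp [mk_nil]
  | cons a l ih =>
    rw [mk_cons, map_mul, toAdd_mul, ih, List.map_cons, List.sum_cons]
    congr 1
    obtain ⟨x, b⟩ := a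
    cases b <;> simp [wt, eps]

section rep
variable (s t : S) (L : ℝ)

open Classical in
/-- the representation -/
noncomputable def rho : FreeGroup S →* Equiv.Perm (ℝ × ℝ) :=
  FreeGroup.lift (fun x => if x = s then Up L else if x = t then Lo L else 1)

open Classical in
/-- sign of letter -/
noncomputable def sg (a : S × Bool) : ℝ := if a.1 = s then (if a.2 then 1 else -1) else (if a.2 then -1 else 1)

open Classical in
/-- own coordinate -/
noncomputable def cA (a : S × Bool) (v : ℝ × ℝ) : ℝ := if a.1 = s then v.1 else v.2

open Classical in
/-- other coordinate -/
noncomputable def cB (a : S × Bool) (v : ℝ × ℝ) : ℝ := if a.1 = s then v.2 else v.1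

variable {s t L}

theorem sg_eq (a : S × Bool) : sg s a = 1 ∨ sg s a = -1 := by
  unfold sg; split_ifs <;> simp

theorem rho_letter (hst : s ≠ t) {a : S × Bool} (ha : a.1 = s ∨ a.1 = t) (v : ℝ × ℝ) :
    cA s a (rho s t L (FreeGroup.mk [a]) v) = cA s a v + sg s a * L * cB s a v ∧
    cB s a (rho s t L (FreeGroup.mk [a]) v) = cB s a v := by
  obtain ⟨x, b⟩ := a
  simp only at ha
  rcases ha with rfl | rfl
  · cases b
    · simp [rho, cA, cB, sg, Up, Equiv.Perm.inv_def]; ring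
    · simp [rho, cA, cB, sg, Up]
  · have h := hst.symm
    cases b
    · simp [rho, cA, cB, sg, Lo, h, Equiv.Perm.inv_def]
    · simp [rho, cA, cB, sg, Lo, h]; ring

theorem cAB (hst : s ≠ t) {a b : S × Bool} (ha : a.1 = s ∨ a.1 = t) (hb : b.1 = s ∨ b.1 = t)
    (hab : a.1 ≠ b.1) (v : ℝ × ℝ) : cA s a v = cB s b v ∧ cB s a v = cA s b v := by
  unfold cA cB; grind

theorem cA_congr {a b : S × Bool} (h : a.1 = b.1) (v : ℝ × ℝ) :
    cA s a v = cA s b v ∧ cB s a v = cB s b v := by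
  unfold cA cB; rw [h]; exact ⟨rfl, rfl⟩

theorem ext_AB {a : S × Bool} {v w : ℝ × ℝ} (h1 : cA s a v = cA s a w) (h2 : cB s a v = cB s a w) :
    v = w := by
  unfold cA cB at *; split_ifs at * <;> ext <;> assumption

theorem rho_cons (a : S × Bool) (l : List (S × Bool)) (v : ℝ × ℝ) :
    rho s t L (FreeGroup.mk (a :: l)) v =
      rho s t L (FreeGroup.mk [a]) (rho s t L (FreeGroup.mk l) v) := by
  rw [mk_cons, map_mul, Equiv.Perm.mul_apply]

theorem rho_fix (hst : s ≠ t) (l : List (S × Bool)) (hl : ∀ a ∈ l, a.1 = s ∨ a.1 = t) (v : ℝ × ℝ)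
    (hv : ∀ a ∈ l, cB s a v = 0) : rho s t L (FreeGroup.mk l) v = v := by
  induction l with
  | nil => rw [mk_nil, map_one]; rfl
  | cons a l ih =>
    rw [rho_cons, ih (fun a ha => hl a (List.mem_cons_of_mem _ ha))
      (fun a ha => hv a (List.mem_cons_of_mem _ ha))]
    have := rho_letter (L := L) hst (hl a (by simp)) v
    rw [hv a (by simp)] at this
    exact ext_AB (a := a) (by rw [this.1]; ring) (by rw [this.2, hv a (by simp)])

variable (s) in
/-- Cone condition -/
def Good (f : ℕ → ℝ) (a : S × Bool) (j : ℕ) (v : ℝ × ℝ) : Prop :=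
  0 < sg s a * cA s a v * cB s a v ∧ |cB s a v| * f (j + 1) ≤ |cA s a v| * f j

theorem good_word (hst : s ≠ t) (hL : 0 < L) (f : ℕ → ℝ) (m : ℕ) (h0 : f 0 = 0) (h1 : f 1 = 1)
    (h2 : ∀ n, f (n + 2) = L * f (n + 1) - f n) (hpos : ∀ k, 1 ≤ k → k < m → 0 < f k)
    (v : ℝ × ℝ) (l : List (S × Bool)) : ∀ a : S × Bool, (∀ b ∈ a :: l, b.1 = s ∨ b.1 = t) →
    IsReduced (a :: l) → nc (a :: l) + 3 ≤ m →
    (∀ z ∈ (a :: l).getLast?, cA s z v = 0 ∧ cB s z v ≠ 0) →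
    Good s f a (nc (a :: l) + 1) (rho s t L (FreeGroup.mk (a :: l)) v) := by
  induction l with
  | nil =>
    intro a hl hr hm hv
    obtain ⟨hv1, hv2⟩ := hv a (by simp)
    obtain ⟨e1, e2⟩ := rho_letter (L := L) hst (hl a (by simp)) v
    have := core_step (A := cB s a v) (B := 0) (f0 := f 0) (f1 := f 1) (f2 := f 2) hv2 hL (h2 0)
      (by rw [h1]; norm_num) (hpos 2 (by norm_num) (by omega)) (by simp [h0]) (sg_eq (s := s) a)
    unfold Good
    rw [e1, e2, hv1]
    exact this
  | cons b l ih =>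
    intro a hl hr hm hv
    rw [rho_cons]
    rw [isReduced_cons_cons'] at hr
    have hle : nc (b :: l) ≤ nc (a :: b :: l) := by simp [nc]
    have hG := ih b (fun c hc => hl c (List.mem_cons_of_mem _ hc)) hr.2 (by omega)
      (by simpa using hv)
    set w := rho s t L (FreeGroup.mk (b :: l)) v with hw
    obtain ⟨e1, e2⟩ := rho_letter (L := L) hst (hl a (by simp)) w
    obtain ⟨g1, g2⟩ := hG
    by_cases hab : a.1 = b.1
    · rw [nc_same _ hab]
      have hba : b = a := by
        have h1 := hr.1
        rw [← ne_linv_iff] at h1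
        exact Prod.ext hab.symm (h1 hab).symm
      rw [← hba] at e1 e2 ⊢
      unfold Good
      rw [e1, e2]
      rw [nc_same _ hab] at hm
      exact core_same hL (hpos _ (by omega) (by omega)).le g1 g2 (sg_eq b)
    · rw [nc_diff _ hab] at hm ⊢
      obtain ⟨k1, k2⟩ := cAB hst (hl a (by simp)) (hl b (by simp)) hab w
      unfold Good
      rw [e1, e2, k1, k2]
      refine core_step ?_ hL (h2 _) (hpos _ (by omega) (by omega)) (hpos _ (by omega) (by omega))
        g2 (sg_eq a)
      intro h
      rw [h] at g1
      simp at g1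

theorem push_const (hst : s ≠ t) (hL : 0 < L) {a : S × Bool} (ha : a.1 = s ∨ a.1 = t)
    (l : List (S × Bool)) (hl : ∀ b ∈ l, b = a) (v : ℝ × ℝ) (hv : 0 < sg s a * cA s a v * cB s a v) :
    0 < sg s a * cA s a (rho s t L (FreeGroup.mk l) v) * cB s a (rho s t L (FreeGroup.mk l) v) ∧
    (l ≠ [] → L * |cB s a (rho s t L (FreeGroup.mk l) v)| < |cA s a (rho s t L (FreeGroup.mk l) v)|) := by
  induction l with
  | nil => rw [mk_nil, map_one]; exact ⟨hv, fun h => absurd rfl h⟩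
  | cons b l ih =>
    obtain rfl : b = a := hl b (by simp)
    have := (ih (fun c hc => hl c (List.mem_cons_of_mem _ hc))).1
    rw [rho_cons]
    set w := rho s t L (FreeGroup.mk l) v
    obtain ⟨e1, e2⟩ := rho_letter (L := L) hst ha w
    rw [e1, e2]
    refine ⟨(core_same (f0 := 0) (f1 := 0) hL le_rfl this (by simp) (sg_eq b)).1, fun _ => ?_⟩
    rw [← abs_of_pos hL, ← abs_mul]
    apply sq_lt_sq.1
    rw [abs_of_pos hL]
    have h3 : (cA s b w + sg s b * L * cB s b w) ^ 2 = (cA s b w) ^ 2 +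
      2 * (L * (sg s b * cA s b w * cB s b w)) + (sg s b * sg s b) * (L * cB s b w) ^ 2 := by ring
    have h4 : sg s b * sg s b = 1 := by rcases sg_eq (s := s) b with h | h <;> rw [h] <;> norm_num
    rw [h3, h4]
    nlinarith [mul_pos hL this, sq_nonneg (cA s b w)]

end rep
end Pride

namespace Pride
open FreeGroup hiding map_mul map_inv map_one
variable {S : Type*}

theorem lsum_nc {s t : S} (c : S → S → ℝ) (x : ℝ) (hc : c s t = x) (hc' : c t s = x)
    (h0 : ∀ s, c s s = 0) (l : List (S × Bool)) (hl : ∀ a ∈ l, a.1 = s ∨ a.1 = t) :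
    lsum (lc c) l = nc l * x := by
  induction l with
  | nil => simp [lsum, nc]
  | cons a l ih =>
    cases l with
    | nil => simp [lsum, nc]
    | cons b l =>
      rw [lsum, ih (fun a ha => hl a (List.mem_cons_of_mem _ ha))]
      have h1 := hl a (by simp)
      have h2 := hl b (by simp)
      unfold lc
      by_cases h : a.1 = b.1
      · rw [nc_same _ h, h, h0]; ring
      · rw [nc_diff _ h]
        have : c a.1 b.1 = x := by
          rcases h1 with h1 | h1 <;> rcases h2 with h2 | h2 <;> simp_all
        rw [this]; push_cast; ring

/-- The representation kills no short words -/
theorem rho_ne {s t : S} (hst : s ≠ t) {L : ℝ} (hL : 0 < L) (f : ℕ → ℝ) (m : ℕ) (hm3 : 3 ≤ m)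
    (h0 : f 0 = 0) (h1 : f 1 = 1)
    (h2 : ∀ n, f (n + 2) = L * f (n + 1) - f n) (hpos : ∀ k, 1 ≤ k → k < m → 0 < f k)
    (hfm : f m = 0) (β α : S × Bool) (hβ : β.2 = false) (hα : α.2 = true) (hαβ : β.1 ≠ α.1)
    (l : List (S × Bool)) (hl : ∀ a ∈ β :: l, a.1 = s ∨ a.1 = t) (hr : IsReduced (β :: l))
    (hlast : (β :: l).getLast? = some α) (hnc : nc (β :: l) + 3 ≤ 2 * m) :
    rho s t L (FreeGroup.mk (β :: l)) ≠ 1 := by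
  intro hρ
  have hodd : ¬ Even (nc (β :: l)) := by rw [nc_parity l α hl hlast]; exact hαβ
  have hαmem : α ∈ β :: l := List.mem_of_getLast? hlast
  have hex : ∀ a : S × Bool, ∃ v : ℝ × ℝ, cA s a v = 0 ∧ cB s a v ≠ 0 := by
    intro a
    by_cases h : a.1 = s
    · exact ⟨(0, 1), by simp [cA, cB, h]⟩
    · exact ⟨(1, 0), by simp [cA, cB, h]⟩
  by_cases hN : nc (β :: l) = 1
  · obtain ⟨p, a, b, q, e, hab, h3, h4⟩ := nc_split (β :: l) 0 (by omega)
    have hz0 : nc (b :: q) = 0 := by omega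
    obtain ⟨p', hp'⟩ : ∃ p', p ++ [a] = β :: p' := by
      cases p with
      | nil => simp at e; exact ⟨[], by simp [e.1]⟩
      | cons x p => simp at e; exact ⟨p ++ [a], by simp [e.1]⟩
    have e' : β :: l = (β :: p') ++ (b :: q) := by rw [← hp', e]; simp
    have hlab : ∀ c ∈ β :: p', c.1 = β.1 := by
      intro c hc
      rcases List.mem_cons.1 hc with rfl | hc
      · rfl
      · exact nc_zero p' (by rw [← hp']; exact h3) c hc
    have haβ : a.1 = β.1 := hlab a (by rw [← hp']; simp)
    obtain ⟨v, hv1, hv2⟩ := hex β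
    have hfix : rho s t L (FreeGroup.mk (b :: q)) v = v := by
      apply rho_fix hst _ (fun c hc => hl c (by rw [e']; exact List.mem_append_right _ hc))
      intro c hc
      have hcb : c.1 = b.1 := by
        rcases List.mem_cons.1 hc with rfl | hc
        · rfl
        · exact nc_zero q hz0 c hc
      rw [(cAB hst (hl c (by rw [e']; exact List.mem_append_right _ hc)) (hl β (by simp))
        (by rw [hcb, ← haβ]; exact hab.symm) v).2]
      exact hv1
    have hG := good_word hst hL f m h0 h1 h2 hpos v p' β
      (fun c hc => hl c (by rw [e']; exact List.mem_append_left _ hc))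
      (by rw [e'] at hr; exact (isReduced_append_iff.1 hr).1)
      (by rw [← hp', h3]; omega)
      (by
        intro z hz
        have := cA_congr (s := s) (hlab z (List.mem_of_getLast? hz)) v
        rw [this.1, this.2]; exact ⟨hv1, hv2⟩)
    have : rho s t L (FreeGroup.mk (β :: p')) v = v := by
      conv_lhs => rw [← hfix]
      rw [← Equiv.Perm.mul_apply, ← map_mul, ← mk_append, ← e', hρ]; rfl
    rw [this] at hG
    have := hG.1
    rw [hv1] at this
    simp at this
  have hN4 : 3 ≤ nc (β :: l) := by
    by_contra h
    have : nc (β :: l) = 0 ∨ nc (β :: l) = 2 := by omega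
    rcases this with h | h <;> exact hodd (by rw [h]; decide)
  have hN5 : nc (β :: l) + 3 ≤ 2 * m := hnc
  obtain ⟨k, j, hk, hj, hkj⟩ : ∃ k j, k + 3 ≤ m ∧ j + 3 ≤ m ∧ k + j + 3 = nc (β :: l) := by
    have : nc (β :: l) ≠ 2 * m - 2 := by
      intro h
      exact hodd (by rw [h]; exact ⟨m - 1, by omega⟩)
    refine ⟨min (m - 3) (nc (β :: l) - 3), nc (β :: l) - 3 - min (m - 3) (nc (β :: l) - 3), ?_, ?_, ?_⟩ <;> omega
  obtain ⟨p1, a1, b1, q1, e1, hab1, h31, h41⟩ := nc_split (β :: l) k (by omega)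
  obtain ⟨p2, a2, b2, q2, e2, hab2, h32, h42⟩ := nc_split (b1 :: q1) 0 (by omega)
  obtain ⟨p3, a3, b3, q3, e3, hab3, h33, h43⟩ := nc_split (b2 :: q2) j (by omega)
  have hz0 : nc (b3 :: q3) = 0 := by omega
  obtain ⟨p', hp'⟩ : ∃ p', p1 ++ [a1] = β :: p' := by
    cases p1 with
    | nil => simp at e1; exact ⟨[], by simp [e1.1]⟩
    | cons x p => simp at e1; exact ⟨p ++ [a1], by simp [e1.1]⟩
  obtain ⟨y', hy'⟩ : ∃ y', p2 ++ [a2] = b1 :: y' := by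
    cases p2 with
    | nil => simp at e2; exact ⟨[], by simp [e2.1]⟩
    | cons x p => simp at e2; exact ⟨p ++ [a2], by simp [e2.1]⟩
  obtain ⟨z', hz'⟩ : ∃ z', p3 ++ [a3] = b2 :: z' := by
    cases p3 with
    | nil => simp at e3; exact ⟨[], by simp [e3.1]⟩
    | cons x p => simp at e3; exact ⟨p ++ [a3], by simp [e3.1]⟩
  have e' : β :: l = (β :: p') ++ ((b1 :: y') ++ ((p3 ++ [a3]) ++ (b3 :: q3))) := by
    have i3 : b2 :: q2 = (p3 ++ [a3]) ++ (b3 :: q3) := by rw [e3]; simp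
    have i2 : b1 :: q1 = (b1 :: y') ++ (b2 :: q2) := by rw [← hy', e2]; simp
    have i1 : β :: l = (β :: p') ++ (b1 :: q1) := by rw [← hp', e1]; simp
    rw [i1, i2, i3]
  have m1 : ∀ c ∈ β :: p', c.1 = s ∨ c.1 = t := fun c hc => hl c (by
    rw [e']; exact List.mem_append_left _ hc)
  have m2 : ∀ c ∈ b1 :: y', c.1 = s ∨ c.1 = t := fun c hc => hl c (by
    rw [e']; exact List.mem_append_right _ (List.mem_append_left _ hc))
  have m3 : ∀ c ∈ p3 ++ [a3], c.1 = s ∨ c.1 = t := fun c hc => hl c (by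
    rw [e']; exact List.mem_append_right _ (List.mem_append_right _ (List.mem_append_left _ hc)))
  have m4 : ∀ c ∈ b3 :: q3, c.1 = s ∨ c.1 = t := fun c hc => hl c (by
    rw [e']; exact List.mem_append_right _ (List.mem_append_right _ (List.mem_append_right _ hc)))
  have ha1 := m1 a1 (by rw [← hp']; simp)
  have hb1 := m2 b1 (by simp)
  have ha2 := m2 a2 (by rw [← hy']; simp)
  have hb2 := m3 b2 (by rw [hz']; simp)
  have ha3 := m3 a3 (by simp)
  have hb3 := m4 b3 (by simp)
  have hr' := hr
  rw [e'] at hr'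
  obtain ⟨r1, hr', -⟩ := isReduced_append_iff.1 hr'
  obtain ⟨r2, hr', -⟩ := isReduced_append_iff.1 hr'
  obtain ⟨r3, r4, -⟩ := isReduced_append_iff.1 hr'
  have hα4 : α ∈ b3 :: q3 := by
    have : (b3 :: q3).getLast? = some α := by
      rw [e'] at hlast
      simpa [List.getLast?_append, List.getLast?_cons] using hlast
    exact List.mem_of_getLast? this
  have hb3α : b3 = α := (red_const q3 r4 (nc_zero q3 hz0) α hα4).symm
  have h4α : ∀ c ∈ b3 :: q3, c = α := by
    intro c hc
    rw [red_const q3 r4 (nc_zero q3 hz0) c hc, hb3α]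
  have hαl : α.1 = s ∨ α.1 = t := hl α hαmem
  have hβl : β.1 = s ∨ β.1 = t := hl β (by simp)
  have ha2b1 : a2.1 = b1.1 := by
    have h : a2 ∈ b1 :: y' := by rw [← hy']; simp
    rcases List.mem_cons.1 h with h | h
    · rw [h]
    · exact nc_zero y' (by rw [← hy']; exact h32) a2 h
  have hb2a1 : b2.1 = a1.1 := by grind
  obtain ⟨v, hv1, hv2⟩ := hex a1
  have hfix : rho s t L (FreeGroup.mk (b1 :: y')) v = v := by
    apply rho_fix hst _ m2
    intro c hc
    have hcb : c.1 = b1.1 := by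
      rcases List.mem_cons.1 hc with rfl | hc
      · rfl
      · exact nc_zero y' (by rw [← hy']; exact h32) c hc
    rw [(cAB hst (m2 c hc) ha1 (by rw [hcb]; exact hab1.symm) v).2]
    exact hv1
  have hG1 := good_word hst hL f m h0 h1 h2 hpos v p' β m1 r1 (by rw [← hp', h31]; omega)
    (by
      intro z hz
      rw [← hp'] at hz
      simp at hz
      rw [← hz]; exact ⟨hv1, hv2⟩)
  have hinv : invRev (p3 ++ [a3]) = linv a3 :: invRev p3 := by
    rw [invRev_append']; rfl
  have hG2 := good_word hst hL f m h0 h1 h2 hpos v (invRev p3) (linv a3) (by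
      intro c hc
      rw [← hinv] at hc
      simp only [invRev, List.mem_reverse, List.mem_map] at hc
      obtain ⟨d, hd, rfl⟩ := hc
      exact m3 d hd)
    (by rw [← hinv]; exact red_invRev r3)
    (by rw [← hinv, nc_invRev, h33]; omega)
    (by
      intro z hz
      rw [← hinv, getLast?_invRev, hz'] at hz
      simp at hz
      have := cA_congr (s := s) (a := z) (b := a1) (by rw [← hz]; exact hb2a1) v
      rw [this.1, this.2]; exact ⟨hv1, hv2⟩)
  rw [← hinv, nc_invRev, h33] at hG2
  set w := rho s t L (FreeGroup.mk (invRev (p3 ++ [a3]))) v with hw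
  set x := rho s t L (FreeGroup.mk (β :: p')) v with hx
  have hsg : sg s β = sg s α := by
    unfold sg; rw [hβ, hα]; grind
  obtain ⟨k1, k2⟩ := cAB hst hβl hαl hαβ x
  have hP := (push_const hst hL hαl (b3 :: q3) h4α x (by
    have := hG1.1
    rw [k1, k2, hsg] at this
    linarith)).2 (by simp)
  have hxw : rho s t L (FreeGroup.mk (b3 :: q3)) x = w := by
    rw [e', mk_append, mk_append, mk_append, map_mul, map_mul, map_mul] at hρ
    set R1 := rho s t L (FreeGroup.mk (β :: p'))
    set R2 := rho s t L (FreeGroup.mk (b1 :: y'))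
    set R3 := rho s t L (FreeGroup.mk (p3 ++ [a3])) with hR3
    set R4 := rho s t L (FreeGroup.mk (b3 :: q3))
    have i1 : R4 * (R1 * R2) = R3⁻¹ := by
      have : R1 * R2 = R4⁻¹ * R3⁻¹ := by
        rw [← mul_inv_rev]
        apply eq_inv_of_mul_eq_one_left
        rw [← hρ]; group
      rw [this]; group
    have i2 : R4 (R1 (R2 v)) = R3⁻¹ v := by rw [← i1]; rfl
    rw [hfix] at i2
    rw [hx, i2, hw, mk_invRev, map_inv]
  rw [hxw] at hP
  have hg2 := hG2.2
  have ha3α : (linv a3).1 ≠ α.1 := by rw [linv_fst, ← hb3α]; exact hab3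
  obtain ⟨k3, k4⟩ := cAB hst (a := linv a3) ha3 hαl ha3α w
  rw [k3, k4] at hg2
  have hf1 : 0 < f (j + 1 + 1) := hpos _ (by omega) (by omega)
  have hf2 : 0 ≤ f (j + 1 + 2) := by
    rcases Nat.lt_or_ge (j + 1 + 2) m with h | h
    · exact (hpos _ (by omega) h).le
    · rw [show j + 1 + 2 = m by omega, hfm]
  rw [h2] at hf2
  have := abs_nonneg (cB s α w)
  nlinarith

theorem exists_last_pos (l : List (S × Bool)) (h : ∃ a ∈ l, a.2 = true) :
    ∃ x a y, l = x ++ a :: y ∧ a.2 = true ∧ ∀ b ∈ y, b.2 = false := by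
  induction l with
  | nil => simp at h
  | cons c l ih =>
    by_cases h' : ∃ a ∈ l, a.2 = true
    · obtain ⟨x, a, y, rfl, h1, h2⟩ := ih h'
      exact ⟨c :: x, a, y, rfl, h1, h2⟩
    · push Not at h'
      refine ⟨[], c, l, rfl, ?_, fun b hb => by simpa using h' b hb⟩
      obtain ⟨a, ha, ha2⟩ := h
      rcases List.mem_cons.1 ha with rfl | ha
      · exact ha2
      · exact absurd ha2 (h' a ha)

theorem exists_rot {u : List (S × Bool)} (h1 : ∃ a ∈ u, a.2 = true) (h2 : ∃ a ∈ u, a.2 = false) :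
    ∃ p q, u = p ++ q ∧ ∃ b l a, q ++ p = b :: l ∧ (b :: l).getLast? = some a ∧ b.2 = false ∧
      a.2 = true := by
  obtain ⟨c, hc, hc2⟩ := h2
  obtain ⟨p0, q0, rfl⟩ := List.append_of_mem hc
  obtain ⟨x, a, y, e, ha, hy⟩ := exists_last_pos (q0 ++ p0) (by
    obtain ⟨d, hd, hd2⟩ := h1
    refine ⟨d, ?_, hd2⟩
    simp only [List.mem_append, List.mem_cons] at hd ⊢
    rcases hd with h | rfl | h
    · exact Or.inr h
    · rw [hc2] at hd2; cases hd2
    · exact Or.inl h)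
  have r1 : (p0 ++ c :: q0) ~r (y ++ c :: (x ++ [a])) := by
    have e1 : (p0 ++ c :: q0) ~r (c :: q0 ++ p0) := List.isRotated_append
    have e2 : c :: q0 ++ p0 = (c :: (x ++ [a])) ++ y := by simp [e]
    rw [e2] at e1
    exact e1.trans List.isRotated_append
  obtain ⟨n, hn⟩ := r1
  rw [List.rotate_eq_drop_append_take_mod] at hn
  refine ⟨_, _, (List.take_append_drop (n % (p0 ++ c :: q0).length) _).symm, ?_⟩
  rw [hn]
  cases y with
  | nil => exact ⟨c, x ++ [a], a, rfl, by simp [List.getLast?_cons], hc2, ha⟩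
  | cons d y => exact ⟨d, y ++ c :: (x ++ [a]), a, rfl,
      by simp [List.getLast?_cons, List.getLast?_append], hy d (by simp), ha⟩

theorem dihedral_syl {s t : S} (hst : s ≠ t) (m : ℕ) (hm : 2 ≤ m) (c : S → S → ℝ)
    (hc : c s t = 1 / m) (hc' : c t s = 1 / m) (hcs : ∀ s, c s s = 0) (u : List (S × Bool))
    (hcr : IsCyclicallyReduced u) (hne : u ≠ []) (hlab : ∀ a ∈ u, a.1 = s ∨ a.1 = t)
    (hN : ∀ {H : Type} [Group H] (f : FreeGroup S →* H),
      altWord (f (of s)) (f (of t)) m = altWord (f (of t)) (f (of s)) m → f (FreeGroup.mk u) = 1) :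
    2 ≤ lsum (lc c) u + jn (lc c) u u := by
  classical
  have hsum : (u.map (fun a => eps a.2)).sum = 0 := by
    have h := hN (wt (fun _ => 1)) (by simp [wt])
    have := wt_mk (fun _ => 1) u
    rw [h] at this
    simpa using this.symm
  have hlen : 0 < u.length := List.length_pos_iff.2 hne
  have h1 : ∃ a ∈ u, a.2 = true := by
    by_contra h
    push Not at h
    have : u.map (fun a => eps a.2) = u.map (fun _ => -1) :=
      List.map_congr_left (fun a ha => by have := h a ha; simp at this; simp [this, eps])
    rw [this] at hsum
    simp at hsum
    exact hne hsum
  have h2 : ∃ a ∈ u, a.2 = false := by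
    by_contra h
    push Not at h
    have : u.map (fun a => eps a.2) = u.map (fun _ => 1) :=
      List.map_congr_left (fun a ha => by have := h a ha; simp at this; simp [this, eps])
    rw [this] at hsum
    simp at hsum
    exact hne hsum
  obtain ⟨p, q, rfl, β, l, α, e, hlast, hβ, hα⟩ := exists_rot h1 h2
  have hsame : lsum (lc c) (p ++ q) + jn (lc c) (p ++ q) (p ++ q) =
      lsum (lc c) (q ++ p) + jn (lc c) (q ++ p) (q ++ p) := by
    by_cases hp : p = []
    · subst hp; simp
    by_cases hq : q = []
    · subst hq; simp
    rw [lsum_append, lsum_append, jn_append_left _ hq, jn_append_right _ hp, jn_append_left _ hp,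
      jn_append_right _ hq]
    ring
  have hcr' := cr_rotate hcr
  have hlab' : ∀ a ∈ q ++ p, a.1 = s ∨ a.1 = t := fun a ha => hlab a (by
    simp only [List.mem_append] at ha ⊢; tauto)
  have hN' : ∀ {H : Type} [Group H] (f : FreeGroup S →* H),
      altWord (f (of s)) (f (of t)) m = altWord (f (of t)) (f (of s)) m →
        f (FreeGroup.mk (q ++ p)) = 1 := by
    intro H _ f hf
    have := hN f hf
    rw [mk_append, map_mul] at this ⊢
    exact mul_eq_one_comm.1 this
  rw [hsame]
  rw [e] at hcr' hlab' hN' ⊢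
  obtain ⟨hr, hcyc⟩ := cr_iff.1 hcr'
  have hβα : β ≠ linv α := hcyc α hlast β rfl
  have hαβ : β.1 ≠ α.1 := by
    intro h
    apply hβα
    exact Prod.ext h (by simp [linv, hα, hβ])
  have hαmem : α ∈ β :: l := List.mem_of_getLast? hlast
  have hαl := hlab' α hαmem
  have hβl := hlab' β (by simp)
  have hm0 : (0 : ℝ) < m := by exact_mod_cast (by omega : 0 < m)
  have hcαβ : c α.1 β.1 = 1 / m := by
    rcases hαl with h1 | h1 <;> rcases hβl with h2 | h2 <;> simp_all
  rw [lsum_nc c (1 / m) hc hc' hcs _ hlab', jn_some _ hlast rfl]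
  unfold lc
  rw [hcαβ]
  have hodd : ¬ Even (nc (β :: l)) := by rw [nc_parity l α hlab' hlast]; exact hαβ
  have key : 2 * m ≤ nc (β :: l) + 1 := by
    by_contra hlt
    push Not at hlt
    have hlt' : nc (β :: l) + 3 ≤ 2 * m := by
      have : nc (β :: l) + 2 ≠ 2 * m := by
        intro h
        exact hodd ⟨m - 1, by omega⟩
      omega
    by_cases hm3 : 3 ≤ m
    · obtain ⟨f, L, f0, f1, f2, fm, fm1, hL, hpos⟩ := sine_seq m hm3
      refine rho_ne hst hL f m hm3 f0 f1 f2 hpos fm β α hβ hα hαβ l hlab' hr hlast hlt' ?_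
      apply hN'
      have h3 : rho s t L (of s) = Up L := by simp [rho]
      have h4 : rho s t L (of t) = Lo L := by simp [rho, hst.symm]
      rw [h3, h4]
      have := braid_UpLo f L f0 f1 f2 (m - 1) (by rwa [Nat.sub_add_cancel (by omega)]) fm1
      rwa [Nat.sub_add_cancel (by omega)] at this
    · have hm2 : m = 2 := by omega
      subst hm2
      have hN1 : nc (β :: l) = 1 := by
        have : nc (β :: l) ≠ 0 := fun h => hodd (by rw [h]; decide)
        omega
      obtain ⟨p, a, b, q, e, hab, h3, h4⟩ := nc_split (β :: l) 0 (by omega)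
      have hz0 : nc (b :: q) = 0 := by omega
      obtain ⟨p', hp'⟩ : ∃ p', p ++ [a] = β :: p' := by
        cases p with
        | nil => simp at e; exact ⟨[], by simp [e.1]⟩
        | cons x p => simp at e; exact ⟨p ++ [a], by simp [e.1]⟩
      have e' : β :: l = (β :: p') ++ (b :: q) := by rw [← hp', e]; simp
      have hlab1 := nc_zero p' (by rw [← hp']; exact h3)
      have hc1 := red_const p' (by rw [e'] at hr; exact (isReduced_append_iff.1 hr).1) hlab1
      have haβ : a = β := hc1 a (by rw [← hp']; simp)
      have hc2 : ∀ d ∈ b :: q, d.1 ≠ β.1 := by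
        intro d hd
        have hdb : d.1 = b.1 := by
          rcases List.mem_cons.1 hd with rfl | hd
          · rfl
          · exact nc_zero q hz0 d hd
        rw [hdb, ← haβ]; exact hab.symm
      have h := hN' (wt (fun x => if x = β.1 then 1 else 0)) (by
        simp only [altWord, mul_one]; rw [mul_comm])
      have h5 := wt_mk (fun x => if x = β.1 then 1 else 0) (β :: l)
      rw [h, e', List.map_append, List.sum_append] at h5
      have h6 : (β :: p').map (fun a => eps a.2 * (if a.1 = β.1 then 1 else 0)) =
          (β :: p').map (fun _ => -1) :=
        List.map_congr_left (fun a ha => by rw [hc1 a ha]; simp [hβ, eps])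
      have h7 : (b :: q).map (fun a => eps a.2 * (if a.1 = β.1 then 1 else 0)) =
          (b :: q).map (fun _ => 0) :=
        List.map_congr_left (fun a ha => by simp [hc2 a ha])
      rw [h6, h7] at h5
      simp at h5
      omega
  have key' : (2 * m : ℝ) ≤ nc (β :: l) + 1 := by exact_mod_cast key
  have : (nc (β :: l) : ℝ) * (1 / m) + 1 / m = (nc (β :: l) + 1) / m := by ring
  rw [this, le_div_iff₀ hm0]
  exact key'

end Pride

namespace Pride
open FreeGroup hiding map_mul map_inv map_one
variable {S : Type*}

section seq
variable {G : Type*} [Group G]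

mutual
/-- product of even-indexed terms -/
def sE (a : ℕ → G) : ℕ → G
  | 0 => 1
  | n + 1 => a 0 * sO (fun i => a (i + 1)) n
/-- product of odd-indexed terms -/
def sO (a : ℕ → G) : ℕ → G
  | 0 => 1
  | n + 1 => sE (fun i => a (i + 1)) n
end

theorem sEO_last (n : ℕ) : ∀ a : ℕ → G, (sE a (n + 1) = sE a n * (if Even n then a n else 1)) ∧
    (sO a (n + 1) = sO a n * (if Even n then 1 else a n)) := by
  induction n with
  | zero => intro a; simp [sE, sO]
  | succ n ih =>
    intro a
    constructor
    · rw [sE, (ih _).2, sE, mul_assoc]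
      by_cases h : Even n <;> simp [h, Nat.even_add_one]
    · rw [sO, (ih _).1, sO]
      by_cases h : Even n <;> simp [h, Nat.even_add_one]

theorem sEO_congr (n : ℕ) : ∀ a b : ℕ → G, (∀ i < n, a i = b i) → sE a n = sE b n ∧ sO a n = sO b n := by
  induction n with
  | zero => intro a b _; simp [sE, sO]
  | succ n ih =>
    intro a b h
    obtain ⟨h1, h2⟩ := ih (fun i => a (i + 1)) (fun i => b (i + 1)) (fun i hi => h _ (by omega))
    rw [sE, sE, sO, sO, h1, h2, h 0 (by omega)]
    exact ⟨rfl, rfl⟩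

theorem sEO_map {H : Type*} [Group H] (f : G →* H) (n : ℕ) : ∀ a : ℕ → G,
    f (sE a n) = sE (fun i => f (a i)) n ∧ f (sO a n) = sO (fun i => f (a i)) n := by
  induction n with
  | zero => intro a; simp [sE, sO]
  | succ n ih =>
    intro a
    obtain ⟨h1, h2⟩ := ih (fun i => a (i + 1))
    rw [sE, sE, sO, sO, map_mul, h1, h2]
    exact ⟨rfl, rfl⟩

/-- the next term -/
def sX (a : ℕ → G) (n : ℕ) : G := if Even n then (sE a n)⁻¹ * sO a n else (sO a n)⁻¹ * sE a n

/-- the previous term -/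
def sY (a : ℕ → G) (n : ℕ) : G := sE a n * (sO a n)⁻¹

theorem sX_iff (a : ℕ → G) (n : ℕ) : sE a (n + 1) = sO a (n + 1) ↔ a n = sX a n := by
  rw [(sEO_last n a).1, (sEO_last n a).2]
  unfold sX
  by_cases h : Even n
  · simp only [h, if_true, mul_one]; rw [eq_inv_mul_iff_mul_eq]
  · simp only [h, if_false, mul_one]; rw [eq_inv_mul_iff_mul_eq]; exact eq_comm

theorem sY_iff (a : ℕ → G) (n : ℕ) : sE a (n + 1) = sO a (n + 1) ↔
    a 0 = sY (fun i => a (i + 1)) n := by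
  rw [sE, sO, sY, eq_mul_inv_iff_mul_eq]

theorem sX_congr {n : ℕ} {a b : ℕ → G} (h : ∀ i < n, a i = b i) : sX a n = sX b n := by
  unfold sX; rw [(sEO_congr n a b h).1, (sEO_congr n a b h).2]
theorem sY_congr {n : ℕ} {a b : ℕ → G} (h : ∀ i < n, a i = b i) : sY a n = sY b n := by
  unfold sY; rw [(sEO_congr n a b h).1, (sEO_congr n a b h).2]
theorem sX_map {H : Type*} [Group H] (f : G →* H) (n : ℕ) (a : ℕ → G) :
    f (sX a n) = sX (fun i => f (a i)) n := by
  unfold sX; split_ifs <;> simp [sEO_map f n a]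
theorem sY_map {H : Type*} [Group H] (f : G →* H) (n : ℕ) (a : ℕ → G) :
    f (sY a n) = sY (fun i => f (a i)) n := by
  unfold sY; simp [sEO_map f n a]

theorem altWord_seq (x σ : G) (n : ℕ) (k : ℕ) :
    σ ^ k * altWord (x * σ) σ n * (σ ^ n)⁻¹ * (σ ^ k)⁻¹ =
      sE (fun i => σ ^ (i + k) * x * (σ ^ (i + k))⁻¹) n ∧
    σ ^ k * altWord σ (x * σ) n * (σ ^ n)⁻¹ * (σ ^ k)⁻¹ =
      sO (fun i => σ ^ (i + k) * x * (σ ^ (i + k))⁻¹) n := by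
  induction n generalizing k with
  | zero => simp [altWord, sE, sO]
  | succ n ih =>
    obtain ⟨h1, h2⟩ := ih (k + 1)
    have e : ∀ i, i + 1 + k = i + (k + 1) := fun i => by omega
    simp only [altWord, sE, sO, e]
    rw [← h1, ← h2]
    constructor
    · simp only [zero_add, pow_succ]; group
    · simp only [pow_succ]; group

theorem altWord_seq' (x σ : G) (n : ℕ) : altWord σ (x * σ) n = altWord (x * σ) σ n ↔
    sE (fun i => σ ^ i * x * (σ ^ i)⁻¹) n = sO (fun i => σ ^ i * x * (σ ^ i)⁻¹) n := by
  obtain ⟨h1, h2⟩ := altWord_seq x σ n 0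
  simp only [pow_zero, one_mul, inv_one, mul_one, add_zero] at h1 h2
  rw [← h1, ← h2, mul_left_inj]
  exact eq_comm

end seq

section aut
variable (n : ℕ)

/-- generators -/
def gx (i : ℕ) : FreeGroup (Fin n) := if h : i < n then of ⟨i, h⟩ else 1
/-- extended sequence -/
def gA (i : ℕ) : FreeGroup (Fin n) := if i < n then gx n i else sX (gx n) n
/-- extended sequence on the other side -/
def gB : ℕ → FreeGroup (Fin n)
  | 0 => sY (gx n) n
  | i + 1 => gx n i

theorem gA_rel : sE (gA n) (n + 1) = sO (gA n) (n + 1) := by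
  rw [sX_iff]
  have : gA n n = sX (gx n) n := by simp [gA]
  rw [this]
  exact sX_congr (fun i hi => by simp [gA, hi])

theorem gB_rel : sE (gB n) (n + 1) = sO (gB n) (n + 1) := by
  rw [sY_iff]; rfl

/-- forward map -/
def gPhi : FreeGroup (Fin n) →* FreeGroup (Fin n) := FreeGroup.lift (fun i => gA n (i + 1))
/-- backward map -/
def gPsi : FreeGroup (Fin n) →* FreeGroup (Fin n) := FreeGroup.lift (fun i => gB n i)

theorem gPhi_x {i : ℕ} (h : i < n) : gPhi n (gx n i) = gA n (i + 1) := by simp [gPhi, gx, h]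
theorem gPsi_x {i : ℕ} (h : i < n) : gPsi n (gx n i) = gB n i := by simp [gPsi, gx, h]

theorem gPsi_A {i : ℕ} (h : i ≤ n) : gPsi n (gA n i) = gB n i := by
  rcases h.lt_or_eq with h | rfl
  · rw [gA, if_pos h, gPsi_x n h]
  · rw [gA, if_neg (lt_irrefl _), sX_map, (sX_iff _ _).1 (gB_rel i)]
    exact sX_congr (fun j hj => gPsi_x i hj)

theorem gPhi_B {i : ℕ} (h : i ≤ n) : gPhi n (gB n i) = gA n i := by
  cases i with
  | zero =>
    rw [gB, sY_map, (sY_iff _ _).1 (gA_rel n)]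
    exact sY_congr (fun j hj => gPhi_x n hj)
  | succ i => rw [gB, gPhi_x n (by omega)]

/-- the automorphism -/
def gAut : MulAut (FreeGroup (Fin n)) :=
  MonoidHom.toMulEquiv (gPhi n) (gPsi n)
    (by
      ext i
      have hx : of i = gx n i := by simp [gx]
      simp only [MonoidHom.comp_apply, MonoidHom.id_apply]
      rw [hx, gPhi_x n i.2, gPsi_A n (by omega), gB])
    (by
      ext i
      have hx : of i = gx n i := by simp [gx]
      simp only [MonoidHom.comp_apply, MonoidHom.id_apply]
      rw [hx, gPsi_x n i.2, gPhi_B n (by omega), gA, if_pos i.2])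

theorem gAut_apply (x) : gAut n x = gPhi n x := rfl

/-- action of the integers -/
def gAct : Multiplicative ℤ →* MulAut (FreeGroup (Fin n)) := zpowersHom _ (gAut n)

theorem gAct_one : gAct n (Multiplicative.ofAdd 1) = gAut n := by simp [gAct]

end aut

theorem semi_tf (n : ℕ) (g : FreeGroup (Fin n) ⋊[gAct n] Multiplicative ℤ) (p : ℕ) (hp : p ≠ 0)
    (h : g ^ p = 1) : g = 1 := by
  have h1 : g.right ^ p = 1 := by
    have := congrArg SemidirectProduct.rightHom h
    rw [map_pow, map_one] at this
    exact this
  have h2 : g.right = 1 := by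
    have := congrArg Multiplicative.toAdd h1
    simp [hp] at this
    exact this
  have h3 : g = SemidirectProduct.inl g.left := by
    ext <;> simp [h2]
  rw [h3, ← map_pow, ← map_one SemidirectProduct.inl] at h
  have h4 := SemidirectProduct.inl_injective h
  have h5 : g.left = 1 := by simpa [hp] using h4
  rw [h3, h5, map_one]

theorem dihedral_tf {s t : S} (hst : s ≠ t) (m : ℕ) (hm : 2 ≤ m) (N : Subgroup (FreeGroup S))
    [N.Normal]
    (hrel : altWord (of s) (of t) m * (altWord (of t) (of s) m)⁻¹ ∈ N)
    (hN : ∀ {H : Type} [Group H] (f : FreeGroup S →* H),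
      altWord (f (of s)) (f (of t)) m = altWord (f (of t)) (f (of s)) m → ∀ x ∈ N, f x = 1)
    (u : FreeGroup S) (hu : u ∈ Subgroup.closure {of s, of t}) (p : ℕ) (hp : p ≠ 0)
    (hup : u ^ p ∈ N) : u ∈ N := by
  classical
  obtain ⟨n, rfl⟩ : ∃ n, m = n + 1 := ⟨m - 1, by omega⟩
  have hn : 0 < n := by omega
  let σ : FreeGroup (Fin n) ⋊[gAct n] Multiplicative ℤ := SemidirectProduct.inr (Multiplicative.ofAdd 1)
  let α : FreeGroup S →* FreeGroup (Fin n) ⋊[gAct n] Multiplicative ℤ := FreeGroup.lift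
    (fun x => if x = s then σ else if x = t then SemidirectProduct.inl (gx n 0) * σ else 1)
  have hαs : α (of s) = σ := by simp [α]
  have hαt : α (of t) = SemidirectProduct.inl (gx n 0) * σ := by simp [α, hst.symm]
  have hσ : ∀ x : FreeGroup (Fin n), σ * SemidirectProduct.inl x * σ⁻¹ =
      SemidirectProduct.inl (gAut n x) := by
    intro x
    rw [← gAct_one n, SemidirectProduct.inl_aut, map_inv]
  have hseq : ∀ i, i ≤ n → σ ^ i * SemidirectProduct.inl (gx n 0) * (σ ^ i)⁻¹ =
      SemidirectProduct.inl (gA n i) := by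
    intro i
    induction i with
    | zero => intro _; simp [gA, hn]
    | succ i ih =>
      intro hi
      have : σ ^ (i + 1) * SemidirectProduct.inl (gx n 0) * (σ ^ (i + 1))⁻¹ =
        σ * (σ ^ i * SemidirectProduct.inl (gx n 0) * (σ ^ i)⁻¹) * σ⁻¹ := by
        rw [pow_succ']; group
      rw [this, ih (by omega), hσ, gAut_apply, gA, if_pos (by omega), gPhi_x n (by omega)]
  have hαu : α u = 1 := by
    apply semi_tf n (α u) p hp
    rw [← map_pow]
    apply hN α _ _ hup
    rw [hαs, hαt, altWord_seq']
    have e := sEO_congr (n + 1) _ (fun i => SemidirectProduct.inl (gA n i)) (fun i hi => hseq i (by omega))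
    rw [e.1, e.2, ← (sEO_map SemidirectProduct.inl (n + 1) (gA n)).1,
      ← (sEO_map SemidirectProduct.inl (n + 1) (gA n)).2, gA_rel]
  let q := QuotientGroup.mk' N
  let a : ℕ → FreeGroup S ⧸ N := fun i => (q (of s)) ^ i * (q (of t) * (q (of s))⁻¹) * ((q (of s)) ^ i)⁻¹
  have ha : a n = sX a n := by
    rw [← sX_iff]
    refine (altWord_seq' _ _ _).1 ?_
    rw [inv_mul_cancel_right, ← altWord_map, ← altWord_map, ← mul_inv_eq_one, ← map_inv, ← map_mul]
    exact (QuotientGroup.eq_one_iff _).2 hrel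
  let f1 : FreeGroup (Fin n) →* FreeGroup S ⧸ N := FreeGroup.lift (fun i => a i)
  have hf1 : ∀ i < n, f1 (gx n i) = a i := fun i hi => by simp [f1, gx, hi]
  have hf1A : ∀ i ≤ n, f1 (gA n i) = a i := by
    intro i hi
    rcases hi.lt_or_eq with h | rfl
    · rw [gA, if_pos h, hf1 i h]
    · rw [gA, if_neg (lt_irrefl _), sX_map, ha]
      exact sX_congr hf1
  let f2 : Multiplicative ℤ →* FreeGroup S ⧸ N := zpowersHom _ (q (of s))
  have hf2 : f2 (Multiplicative.ofAdd 1) = q (of s) := by simp [f2]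
  have hgen : ∀ x, f1 (gAut n x) = q (of s) * f1 x * (q (of s))⁻¹ := by
    have : f1.comp (gPhi n) = ((MulAut.conj (q (of s))).toMonoidHom).comp f1 := by
      ext i
      have hx : of i = gx n i := by simp [gx]
      simp only [MonoidHom.comp_apply, MulEquiv.coe_toMonoidHom, MulAut.conj_apply]
      rw [hx, gPhi_x n i.2, hf1A _ (by omega), hf1 _ i.2]
      simp only [a]
      rw [pow_succ']; group
    intro x
    exact DFunLike.congr_fun this x
  have hcomp : ∀ g x, f1 (gAct n g x) = f2 g * f1 x * (f2 g)⁻¹ := by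
    let C : Subgroup (Multiplicative ℤ) :=
      { carrier := {g | ∀ x, f1 (gAct n g x) = f2 g * f1 x * (f2 g)⁻¹}
        one_mem' := by intro x; simp
        mul_mem' := by
          intro g h hg hh x
          rw [map_mul, MulAut.mul_apply, hg, hh, map_mul]; group
        inv_mem' := by
          intro g hg x
          have := hg ((gAct n g)⁻¹ x)
          rw [MulAut.apply_inv_self] at this
          rw [map_inv, map_inv, this]; group }
    have h1 : Multiplicative.ofAdd (1 : ℤ) ∈ C := by
      intro x
      rw [gAct_one, hf2, hgen]
    intro g
    have : g ∈ C := by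
      have e : g = (Multiplicative.ofAdd (1 : ℤ)) ^ (Multiplicative.toAdd g) := by
        rw [← ofAdd_zsmul]; simp
      rw [e]
      exact C.zpow_mem h1 _
    exact this
  let β : FreeGroup (Fin n) ⋊[gAct n] Multiplicative ℤ →* FreeGroup S ⧸ N :=
    SemidirectProduct.lift f1 f2 (fun g => by
      ext i
      simp [hcomp])
  have hβ : ∀ x ∈ Subgroup.closure {of s, of t}, (β.comp α) x = q x := by
    apply MonoidHom.eqOn_closure
    intro x hx
    simp only [Set.mem_insert_iff, Set.mem_singleton_iff] at hx
    rcases hx with rfl | rfl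
    · simp only [MonoidHom.comp_apply]
      rw [hαs]; simp [β, σ, hf2]
    · simp only [MonoidHom.comp_apply]
      rw [hαt, map_mul]; simp [β, σ, hf2, hf1 0 hn, a]
  have := hβ u hu
  rw [MonoidHom.comp_apply, hαu, map_one] at this
  exact (QuotientGroup.eq_one_iff _).1 this.symm

end Pride

namespace Pride
open FreeGroup hiding map_mul map_inv map_one
variable {S : Type*}

theorem mem_closure_letters {τ : Set S} {x : FreeGroup S}
    (hx : x ∈ Subgroup.closure (of '' τ)) {l : List (S × Bool)} (hl : IsReduced l)
    (h : x = FreeGroup.mk l) : ∀ a ∈ l, a.1 ∈ τ := by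
  classical
  let r : FreeGroup S →* FreeGroup S := FreeGroup.lift (fun y => if y ∈ τ then of y else 1)
  have h1 : r x = x := by
    have : Set.EqOn r (MonoidHom.id _) (Subgroup.closure (of '' τ)) := by
      apply MonoidHom.eqOn_closure
      rintro _ ⟨y, hy, rfl⟩
      simp [r, hy]
    exact this hx
  have h2 : ∀ l : List (S × Bool), r (FreeGroup.mk l) = FreeGroup.mk (l.filter (fun a => a.1 ∈ τ)) := by
    intro l
    induction l with
    | nil => simp [mk_nil]
    | cons a l ih =>
      rw [mk_cons, map_mul, ih]
      obtain ⟨y, b⟩ := a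
      by_cases hy : y ∈ τ
      · have e : r (FreeGroup.mk [(y, b)]) = FreeGroup.mk [(y, b)] := by
          cases b
          · have e2 : FreeGroup.mk [(y, false)] = (of y)⁻¹ := by
              simp [FreeGroup.of, FreeGroup.inv_mk, FreeGroup.invRev]
            rw [e2, map_inv]
            simp [r, hy]
          · change r (of y) = of y
            simp [r, hy]
        rw [e, List.filter_cons_of_pos (by simpa using hy)]
        exact (mk_cons _ _).symm
      · rw [List.filter_cons_of_neg (by simpa using hy)]
        cases b <;> simp [r, hy]
  have h3 : FreeGroup.mk (l.filter (fun a => a.1 ∈ τ)) = FreeGroup.mk l := by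
    rw [← h2, ← h, h1]
  have h4 : l.length ≤ (l.filter (fun a => a.1 ∈ τ)).length := by
    have e1 : FreeGroup.norm (FreeGroup.mk l) = l.length := by
      unfold FreeGroup.norm; rw [toWord_mk, hl.reduce_eq]
    rw [← e1, ← h3]
    exact FreeGroup.norm_mk_le
  have h5 := List.filter_eq_self.1 (List.filter_sublist.eq_of_length_le h4)
  intro a ha
  simpa using h5 a ha

variable (M : S → S → ℕ∞)

/-- pairs with finite exponent -/
def Ix : Type _ := {τ : Set S // ∃ s t : S, s ≠ t ∧ ∃ n : ℕ, M s t = n ∧ τ = {s, t}}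

variable {M}

/-- relators on two labels -/
def relset (τ : Ix M) : Set (FreeGroup S) :=
  {w | ∃ s t : S, s ≠ t ∧ s ∈ τ.1 ∧ t ∈ τ.1 ∧ ∃ n : ℕ, M s t = (n : ℕ∞) ∧
      w = altWord (of s) (of t) n * (altWord (of t) (of s) n)⁻¹}

/-- local normal closure -/
def NN (τ : Ix M) : Subgroup (FreeGroup S) := Subgroup.normalClosure (relset τ)
/-- local free group -/
def FF (τ : Ix M) : Subgroup (FreeGroup S) := Subgroup.closure (of '' τ.1)
/-- face group -/
def KK (τ : Ix M) : Subgroup (FreeGroup S) := FF τ ⊓ NN τ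

instance (τ : Ix M) : (NN τ).Normal := Subgroup.normalClosure_normal

theorem NN_le (τ : Ix M) : NN τ ≤ Subgroup.normalClosure (artinRels M) := by
  apply Subgroup.normalClosure_mono
  rintro w ⟨s, t, hst, -, -, n, h1, h2⟩
  exact ⟨s, t, hst, n, h1, h2⟩

theorem NN_kill (hsymm : ∀ a b : S, M a b = M b a) (τ : Ix M) {s t : S} {m : ℕ}
    (hm : M s t = m) (hτ : τ.1 = {s, t}) {H : Type} [Group H] (f : FreeGroup S →* H)
    (hf : altWord (f (of s)) (f (of t)) m = altWord (f (of t)) (f (of s)) m) :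
    ∀ x ∈ NN τ, f x = 1 := by
  have : NN τ ≤ f.ker := by
    apply Subgroup.normalClosure_le_normal
    rintro w ⟨s', t', hst', hs, ht, n, h1, rfl⟩
    rw [hτ] at hs ht
    simp only [Set.mem_insert_iff, Set.mem_singleton_iff] at hs ht
    simp only [SetLike.mem_coe, MonoidHom.mem_ker, map_mul, map_inv, altWord_map]
    rw [mul_inv_eq_one]
    rcases hs with rfl | rfl <;> rcases ht with rfl | rfl
    · exact absurd rfl hst'
    · rw [hm] at h1
      have : m = n := by exact_mod_cast h1
      rw [← this]; exact hf
    · rw [hsymm, hm] at h1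
      have : m = n := by exact_mod_cast h1
      rw [← this]; exact hf.symm
    · exact absurd rfl hst'
  exact fun x hx => this hx

theorem tf_local (hsymm : ∀ a b : S, M a b = M b a) (htwo : ∀ a b : S, a ≠ b → 2 ≤ M a b)
    (τ : Ix M) {u : FreeGroup S} (hu : u ∈ FF τ) {p : ℕ} (hp : p ≠ 0) (hup : u ^ p ∈ NN τ) :
    u ∈ NN τ := by
  obtain ⟨s, t, hst, m, hm, hτ⟩ := τ.2
  have hm2 : 2 ≤ m := by
    have := htwo s t hst
    rw [hm] at this
    exact_mod_cast this
  apply dihedral_tf hst m hm2 (NN τ) _ (fun f hf => NN_kill hsymm τ hm hτ f hf) u _ p hp hup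
  · apply Subgroup.subset_normalClosure
    exact ⟨s, t, hst, by rw [hτ]; simp, by rw [hτ]; simp, m, hm, rfl⟩
  · unfold FF at hu
    rw [hτ, Set.image_pair] at hu
    exact hu

open scoped ENNReal in
open Classical in
/-- angles -/
noncomputable def ang (M : S → S → ℕ∞) (s t : S) : ℝ :=
  if s = t then 0 else ((M s t : ℝ≥0∞)⁻¹).toReal

open scoped ENNReal in
theorem inv_le_half (htwo : ∀ a b : S, a ≠ b → 2 ≤ M a b) {s t : S} (h : s ≠ t) :
    ((M s t : ℝ≥0∞))⁻¹ ≤ 2⁻¹ := by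
  rw [ENNReal.inv_le_inv]
  have := htwo s t h
  have h2 := ENat.toENNReal_le.2 this
  simpa using h2

theorem ang_half (htwo : ∀ a b : S, a ≠ b → 2 ≤ M a b) (s t : S) : ang M s t ≤ 1 / 2 := by
  unfold ang
  split_ifs with h
  · norm_num
  · have := ENNReal.toReal_mono (by simp) (inv_le_half htwo h)
    simpa using this

theorem ang_self (s : S) : ang M s s = 0 := by simp [ang]
theorem ang_nonneg (s t : S) : 0 ≤ ang M s t := by
  unfold ang; split_ifs <;> simp
theorem ang_symm (hsymm : ∀ a b : S, M a b = M b a) (s t : S) : ang M s t = ang M t s := by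
  unfold ang
  by_cases h : s = t
  · subst h; rfl
  · rw [if_neg h, if_neg (Ne.symm h), hsymm s t]

theorem ang_tri (hsymm : ∀ a b : S, M a b = M b a) (htwo : ∀ a b : S, a ≠ b → 2 ≤ M a b)
    (h2dim : TwoDimensional M) (s t r : S) : ang M s t + ang M t r + ang M s r ≤ 1 := by
  have h1 := ang_half htwo s t
  have h2 := ang_half htwo t r
  have h3 := ang_half htwo s r
  by_cases hst : s = t
  · subst hst; rw [ang_self]; linarith
  by_cases htr : t = r
  · subst htr; rw [ang_self]; linarith
  by_cases hsr : s = r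
  · subst hsr; rw [ang_self]; linarith
  have := h2dim s t r hst htr hsr
  have f1 := (inv_le_half htwo hst).trans_lt (by simp : (2 : ENNReal)⁻¹ < ⊤)
  have f2 := (inv_le_half htwo htr).trans_lt (by simp : (2 : ENNReal)⁻¹ < ⊤)
  have f3 := (inv_le_half htwo hsr).trans_lt (by simp : (2 : ENNReal)⁻¹ < ⊤)
  unfold ang
  rw [if_neg hst, if_neg htr, if_neg hsr, ← ENNReal.toReal_add f1.ne f2.ne,
    ← ENNReal.toReal_add (ENNReal.add_lt_top.2 ⟨f1, f2⟩).ne f3.ne]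
  have := ENNReal.toReal_mono (by simp) this
  simpa using this

theorem ang_eq {s t : S} (h : s ≠ t) {m : ℕ} (hm : M s t = m) : ang M s t = 1 / m := by
  unfold ang
  rw [if_neg h, hm]
  simp

theorem syl_local (hsymm : ∀ a b : S, M a b = M b a) (htwo : ∀ a b : S, a ≠ b → 2 ≤ M a b)
    (τ : Ix M) (u : List (S × Bool)) (hcr : IsCyclicallyReduced u) (hne : u ≠ [])
    (hu : FreeGroup.mk u ∈ KK τ) : 2 ≤ lsum (lc (ang M)) u + jn (lc (ang M)) u u := by
  have hlab := mem_closure_letters hu.1 (cr_iff.1 hcr).1 rfl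
  obtain ⟨s, t, hst, m, hm, hτ⟩ := τ.2
  have hm2 : 2 ≤ m := by
    have := htwo s t hst
    rw [hm] at this
    exact_mod_cast this
  refine dihedral_syl hst m hm2 (ang M) (ang_eq hst hm) (ang_eq hst.symm (by rw [hsymm, hm]))
    ang_self u hcr hne ?_ ?_
  · intro a ha
    have := hlab a ha
    rw [hτ] at this
    simpa using this
  · intro H _ f hf
    exact NN_kill hsymm τ hm hτ f hf _ hu.2

/-- the system of an Artin group over the free group -/
noncomputable def artSys (hsymm : ∀ a b : S, M a b = M b a) (htwo : ∀ a b : S, a ≠ b → 2 ≤ M a b)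
    (h2dim : TwoDimensional M) {Γ : Type*} [Group Γ] (ι : FreeGroup S →* Γ) (π : Γ →* FreeGroup S)
    (πι : ∀ x, π (ι x) = x) (K : Ix M → Subgroup Γ) (hK : ∀ i f, f ∈ K i → π f ∈ KK i)
    (cen : ∀ i k f, π k = 1 → f ∈ K i → k * f = f * k)
    (norm : ∀ i (a : S × Bool) f, a.1 ∈ i.1 → f ∈ K i →
      ι (FreeGroup.mk [a]) * f * (ι (FreeGroup.mk [a]))⁻¹ ∈ K i)
    (inj : ∀ i f, f ∈ K i → π f = 1 → f = 1) : Sys S Γ (Ix M) where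
  ι := ι
  π := π
  πι := πι
  lab := fun i => i.1
  K := K
  c := ang M
  cen := cen
  norm := norm
  inj := inj
  lett := fun i f l hf hl h => mem_closure_letters (hK i f hf).1 hl h
  csymm := ang_symm hsymm
  cself := ang_self
  cnonneg := ang_nonneg
  chalf := ang_half htwo
  ctri := ang_tri hsymm htwo h2dim
  lab_eq := by
    intro i j s t hst h1 h2 h3 h4
    obtain ⟨a, b, hab, n, hn, e1⟩ := i.2
    obtain ⟨a', b', hab', n', hn', e2⟩ := j.2
    apply Subtype.ext
    rw [e1] at h1 h2 ⊢
    rw [e2] at h3 h4 ⊢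
    simp only [Set.mem_insert_iff, Set.mem_singleton_iff] at h1 h2 h3 h4
    ext x
    simp only [Set.mem_insert_iff, Set.mem_singleton_iff]
    grind
  syl := fun i f u hf hu hne h => syl_local hsymm htwo i u hu hne (h ▸ hK i f hf)

theorem mem_FF_letter (τ : Ix M) (a : S × Bool) (ha : a.1 ∈ τ.1) : FreeGroup.mk [a] ∈ FF τ := by
  have h : of a.1 ∈ FF τ := Subgroup.subset_closure ⟨a.1, ha, rfl⟩
  obtain ⟨x, b⟩ := a
  cases b
  · have : FreeGroup.mk [(x, false)] = (of x)⁻¹ := by simp [FreeGroup.of, FreeGroup.inv_mk, FreeGroup.invRev]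
    rw [this]; exact inv_mem h
  · exact h

theorem KK_norm (τ : Ix M) {x y : FreeGroup S} (hx : x ∈ FF τ) (hy : y ∈ KK τ) :
    x * y * x⁻¹ ∈ KK τ :=
  Subgroup.mem_inf.2 ⟨mul_mem (mul_mem hx hy.1) (inv_mem hx), (inferInstance : (NN τ).Normal).conj_mem _ hy.2 _⟩

theorem exists_ar {Γ : Type*} [Group Γ] (Y : Sys S Γ (Ix M))
    (hs : ∀ i, ∀ y ∈ KK i, ∃ f ∈ Y.K i, Y.π f = y) (y : FreeGroup S)
    (hy : y ∈ Subgroup.normalClosure (artinRels M)) : ∃ n x, Y.Ar n x ∧ Y.π x = y := by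
  unfold Subgroup.normalClosure at hy
  induction hy using Subgroup.closure_induction with
  | mem y hy =>
    rw [Group.mem_conjugatesOfSet_iff] at hy
    obtain ⟨r, ⟨s, t, hst, n, hn, rfl⟩, hc⟩ := hy
    obtain ⟨g, rfl⟩ := isConj_iff.1 hc
    let τ : Ix M := ⟨{s, t}, s, t, hst, n, hn, rfl⟩
    have h1 : of s ∈ FF τ := Subgroup.subset_closure ⟨s, by simp [τ], rfl⟩
    have h2 : of t ∈ FF τ := Subgroup.subset_closure ⟨t, by simp [τ], rfl⟩
    have hw : ∀ n, ∀ x y, x ∈ FF τ → y ∈ FF τ → altWord x y n ∈ FF τ := by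
      intro n
      induction n with
      | zero => intro x y _ _; exact one_mem _
      | succ n ih => intro x y hx hy; exact mul_mem hx (ih y x hy hx)
    obtain ⟨f, hf, hf2⟩ := hs τ (altWord (of s) (of t) n * (altWord (of t) (of s) n)⁻¹)
      (Subgroup.mem_inf.2 ⟨mul_mem (hw _ _ _ h1 h2) (inv_mem (hw _ _ _ h2 h1)),
        Subgroup.subset_normalClosure ⟨s, t, hst, by simp [τ], by simp [τ], n, hn, rfl⟩⟩)
    exact ⟨1, _, (Sys.Ar.of hf).conj (Y.ι g), by rw [map_mul, map_mul, map_inv, Y.πι, hf2]⟩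
  | one => exact ⟨0, 1, Sys.Ar.one, map_one _⟩
  | mul a b _ _ ha hb =>
    obtain ⟨n, x, hx, rfl⟩ := ha
    obtain ⟨m, y, hy, rfl⟩ := hb
    exact ⟨_, _, hx.mul hy, map_mul _ _ _⟩
  | inv a _ ha =>
    obtain ⟨n, x, hx, rfl⟩ := ha
    exact ⟨_, _, hx.inv, map_inv _ _⟩

/-- Two-generator parabolics embed. -/
theorem parabolic (hsymm : ∀ a b : S, M a b = M b a) (htwo : ∀ a b : S, a ≠ b → 2 ≤ M a b)
    (h2dim : TwoDimensional M) (τ : Ix M) {u : FreeGroup S} (hu : u ∈ FF τ)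
    (hN : u ∈ Subgroup.normalClosure (artinRels M)) : u ∈ NN τ := by
  let Y := artSys hsymm htwo h2dim (MonoidHom.id (FreeGroup S)) (MonoidHom.id _) (fun _ => rfl) KK
    (fun _ _ h => h) (fun i k f hk _ => by
      have : k = 1 := hk
      rw [this]; simp) (fun i a f ha hf => KK_norm i (mem_FF_letter i a ha) hf) (fun i f _ h => h)
  obtain ⟨n, x, hx, rfl⟩ := exists_ar Y (fun i y hy => ⟨y, hy, rfl⟩) u hN
  obtain ⟨l, hl, hlx⟩ := exists_red (Y.π x)
  have := Sys.claim (i := τ) hx hlx.symm (mem_closure_letters hu hl hlx.symm)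
  exact this.2

end Pride

namespace Pride
open FreeGroup hiding map_mul map_inv map_one
variable {S : Type*}

theorem exists_kappa {X : Type*} (σ : Equiv.Perm X) {p : ℕ} (hp : p.Prime) (hσ : σ ^ p = 1)
    (hfix : ∀ x, σ x ≠ x) : ∃ κ : X → ZMod p, ∀ x, κ (σ x) = κ x + 1 := by
  let st := Equiv.Perm.SameCycle.setoid σ
  let r : X → X := fun x => (Quotient.mk st x).out
  have hr : ∀ x, ∃ i : ℤ, (σ ^ i) (r x) = x := fun x => Quotient.exact (Quotient.out_eq (Quotient.mk st x))
  have hrs : ∀ x, r (σ x) = r x := by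
    intro x
    have : Quotient.mk st (σ x) = Quotient.mk st x := Quotient.sound ⟨-1, by simp⟩
    simp only [r, this]
  choose i hi using hr
  refine ⟨fun x => (i x : ZMod p), fun x => ?_⟩
  have key : ∀ d : ℤ, ∀ y, (σ ^ d) y = y → (d : ZMod p) = 0 := by
    intro d y hd
    have : NeZero p := ⟨hp.ne_zero⟩
    rw [ZMod.intCast_zmod_eq_zero_iff_dvd d p]
    by_contra hnd
    have hc : IsCoprime (p : ℤ) d :=
      (Prime.coprime_iff_not_dvd (Nat.prime_iff_prime_int.1 hp)).2 hnd
    obtain ⟨a, b, hab⟩ := hc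
    apply hfix y
    have : σ = (σ ^ d) ^ b := by
      rw [← zpow_mul]
      have h2 : (σ : Equiv.Perm X) = σ ^ (a * p + b * d) := by rw [hab, zpow_one]
      rw [zpow_add, mul_comm a, zpow_mul σ (p : ℤ), zpow_natCast, hσ, one_zpow, one_mul, mul_comm] at h2
      exact h2
    have h3 : ((σ ^ d) ^ b) y = y := by
      exact Equiv.Perm.zpow_apply_eq_self_of_apply_eq_self hd b
    rwa [← this] at h3
  have h1 := key (i (σ x) - i x - 1) (r x) (by
    have e1 := hi (σ x)
    rw [hrs] at e1
    have e2 : (σ ^ (i x + 1)) (r x) = σ x := by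
      rw [add_comm, zpow_add, zpow_one, Equiv.Perm.mul_apply, hi]
    rw [show i (σ x) - i x - 1 = -(i x + 1) + i (σ x) by ring, zpow_add, Equiv.Perm.mul_apply, e1,
      ← e2, ← Equiv.Perm.mul_apply, ← zpow_add]
    simp)
  push_cast at h1
  linear_combination h1

/-- indicator of the last residue -/
def rhoZ {p : ℕ} (a : ZMod p) : ZMod p := if a = -1 then 1 else 0
/-- comparison cochain -/
def xi {p : ℕ} (a b : ZMod p) : ZMod p := if b.val < a.val then 1 else 0

theorem xi_rhoZ {p : ℕ} (hp : p ≠ 0) (a b : ZMod p) : xi a b - xi (a + 1) (b + 1) = rhoZ a - rhoZ b := by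
  obtain ⟨n, rfl⟩ := Nat.exists_eq_succ_of_ne_zero hp
  have hv : ∀ a : ZMod n.succ, a = -1 ↔ a.val = n := by
    intro a
    have h := (ZMod.val_injective n.succ).eq_iff (a := a) (b := -1)
    rw [ZMod.val_neg_one] at h
    exact h.symm
  have hl : ∀ a : ZMod n.succ, a.val ≤ n := fun a => Nat.lt_succ_iff.1 (ZMod.val_lt a)
  have hs : ∀ a : ZMod n.succ, a ≠ -1 → (a + 1).val = a.val + 1 := by
    intro a ha
    have h1 : a.val < n := lt_of_le_of_ne (hl a) (fun h => ha ((hv a).2 h))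
    rw [ZMod.val_add, ZMod.val_one_eq_one_mod, Nat.mod_eq_of_lt (by omega : 1 < n.succ),
      Nat.mod_eq_of_lt (by omega)]
  have la := hl a
  have lb := hl b
  unfold xi rhoZ
  by_cases ha : a = -1 <;> by_cases hb : b = -1
  · rw [ha, hb]; simp
  · rw [if_pos ha, if_neg hb]
    have h1 := (hv a).1 ha
    have h2 := mt (hv b).2 hb
    have h3 : (a + 1).val = 0 := by rw [ha]; simp
    rw [if_pos (by omega), if_neg (by omega)]
  · rw [if_neg ha, if_pos hb]
    have h1 := (hv b).1 hb
    have h3 : (b + 1).val = 0 := by rw [hb]; simp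
    have h4 := hs a ha
    rw [if_neg (by omega), if_pos (by omega)]
  · rw [if_neg ha, if_neg hb, hs a ha, hs b hb]
    simp

theorem sum_rhoZ {p : ℕ} (hp : p ≠ 0) (a : ZMod p) :
    ∑ k ∈ Finset.range p, rhoZ (a + (k : ZMod p)) = 1 := by
  have : NeZero p := ⟨hp⟩
  rw [Finset.sum_eq_single (ZMod.val (-1 - a))]
  · rw [ZMod.natCast_zmod_val]; simp [rhoZ]
  · intro k hk hne
    rw [rhoZ, if_neg]
    intro h
    apply hne
    have : (k : ZMod p) = -1 - a := by linear_combination h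
    rw [← this, ZMod.val_natCast, Nat.mod_eq_of_lt (Finset.mem_range.1 hk)]
  · intro h
    exact absurd (Finset.mem_range.2 (ZMod.val_lt _)) h

variable {G : Type*} [Group G] (q : FreeGroup S →* G) (p : ℕ)

/-- The extension of the free group by functions on the quotient. -/
@[ext] structure Gam {S G : Type*} [Group G] (_q : FreeGroup S →* G) (p : ℕ) where
  c : G → ZMod p
  f : FreeGroup S

namespace Gam
variable {q p}

instance : Mul (Gam q p) := ⟨fun x y => ⟨fun h => x.c h + y.c (h * q x.f), x.f * y.f⟩⟩
instance : One (Gam q p) := ⟨⟨fun _ => 0, 1⟩⟩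
instance : Inv (Gam q p) := ⟨fun x => ⟨fun h => - x.c (h * (q x.f)⁻¹), x.f⁻¹⟩⟩

@[simp] theorem mul_c (x y : Gam q p) (h : G) : (x * y).c h = x.c h + y.c (h * q x.f) := rfl
@[simp] theorem mul_f (x y : Gam q p) : (x * y).f = x.f * y.f := rfl
@[simp] theorem one_c (h : G) : (1 : Gam q p).c h = 0 := rfl
@[simp] theorem one_f : (1 : Gam q p).f = 1 := rfl
@[simp] theorem inv_c (x : Gam q p) (h : G) : (x⁻¹).c h = - x.c (h * (q x.f)⁻¹) := rfl
@[simp] theorem inv_f (x : Gam q p) : (x⁻¹).f = x.f⁻¹ := rfl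

instance : Group (Gam q p) := Group.ofLeftAxioms
  (by
    intro x y z
    ext h
    · simp [mul_assoc, add_assoc]
    · simp [mul_assoc])
  (by intro x; ext h <;> simp)
  (by intro x; ext h <;> simp)

/-- projection -/
def pr : Gam q p →* FreeGroup S where
  toFun := fun x => x.f
  map_one' := rfl
  map_mul' := fun _ _ => rfl

/-- section -/
def sec : FreeGroup S →* Gam q p where
  toFun := fun y => ⟨fun _ => 0, y⟩
  map_one' := rfl
  map_mul' := fun x y => by ext h <;> simp

@[simp] theorem pr_apply (x : Gam q p) : pr x = x.f := rfl
@[simp] theorem sec_c (y : FreeGroup S) (h : G) : (sec y : Gam q p).c h = 0 := rfl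
@[simp] theorem sec_f (y : FreeGroup S) : (sec y : Gam q p).f = y := rfl

variable (q) in
/-- twisted section -/
def th (ω : G → S → ZMod p) : FreeGroup S →* Gam q p :=
  FreeGroup.lift (fun s => ⟨fun h => ω h s, FreeGroup.of s⟩)

@[simp] theorem th_f (ω : G → S → ZMod p) (y : FreeGroup S) : (th q ω y).f = y := by
  have : (pr.comp (th q ω)) = MonoidHom.id _ := by
    ext s; simp [th]
  exact DFunLike.congr_fun this y

theorem commute_of {x y : Gam q p} (hx : x.f = 1) (hy : q y.f = 1) : x * y = y * x := by
  ext h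
  · simp [hx, hy, add_comm]
  · simp [hx]

end Gam

variable {p}

/-- path sums -/
def psi (ω : G → S → ZMod p) (y : FreeGroup S) (h : G) : ZMod p := (Gam.th q ω y).c h

variable {q}

theorem psi_mul (ω : G → S → ZMod p) (x y : FreeGroup S) (h : G) :
    psi q ω (x * y) h = psi q ω x h + psi q ω y (h * q x) := by
  simp [psi]

theorem psi_one (ω : G → S → ZMod p) (h : G) : psi q ω 1 h = 0 := by
  simp [psi]

theorem psi_inv (ω : G → S → ZMod p) (x : FreeGroup S) (h : G) :
    psi q ω x⁻¹ h = - psi q ω x (h * (q x)⁻¹) := by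
  simp [psi]

theorem psi_of (ω : G → S → ZMod p) (s : S) (h : G) : psi q ω (of s) h = ω h s := by
  simp [psi, Gam.th]

theorem psi_unique (ω : G → S → ZMod p) (φ : FreeGroup S → G → ZMod p)
    (h1 : ∀ x y h, φ (x * y) h = φ x h + φ y (h * q x)) (h2 : ∀ s h, φ (of s) h = ω h s)
    (y : FreeGroup S) (h : G) : φ y h = psi q ω y h := by
  let F : FreeGroup S →* Gam q p := MonoidHom.mk' (fun y => ⟨φ y, y⟩) (by
    intro x y
    ext h
    · simp [h1]
    · simp)
  have : F = Gam.th q ω := by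
    ext s h
    · simpa [F, Gam.th] using h2 s h
    · simp [F]
  unfold psi
  rw [← this]
  rfl

theorem psi_sub (ω ω' : G → S → ZMod p) (y : FreeGroup S) (h : G) :
    psi q ω y h - psi q ω' y h = psi q (fun h s => ω h s - ω' h s) y h := by
  apply psi_unique _ (fun y h => psi q ω y h - psi q ω' y h)
  · intro x y h; simp only [psi_mul]; ring
  · intro s h; simp only [psi_of]

theorem psi_shift (ω : G → S → ZMod p) (g : G) (y : FreeGroup S) (h : G) :
    psi q ω y (g * h) = psi q (fun h s => ω (g * h) s) y h := by
  apply psi_unique _ (fun y h => psi q ω y (g * h))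
  · intro x y h; simp only [psi_mul, mul_assoc]
  · intro s h; simp only [psi_of]

theorem psi_pow (ω : G → S → ZMod p) (w : FreeGroup S) (n : ℕ) (h : G) :
    psi q ω (w ^ n) h = ∑ k ∈ Finset.range n, psi q ω w (h * q w ^ k) := by
  induction n with
  | zero => simp [psi_one]
  | succ n ih => rw [pow_succ, psi_mul, ih, Finset.sum_range_succ, map_pow]

theorem psi_local (κ c : G → ZMod p) (T : Set S) (hc : ∀ h, ∀ s ∈ T, c (h * q (of s)) = c h)
    {y : FreeGroup S} (hy : y ∈ Subgroup.closure (of '' T)) :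
    (∀ h, c (h * q y) = c h) ∧
    ∀ h, psi q (fun h s => c h * (κ (h * q (of s)) - κ h)) y h = c h * (κ (h * q y) - κ h) := by
  induction hy using Subgroup.closure_induction with
  | mem y hy =>
    obtain ⟨s, hs, rfl⟩ := hy
    exact ⟨fun h => hc h s hs, fun h => psi_of _ _ _⟩
  | one => exact ⟨by simp, by simp [psi_one]⟩
  | mul a b _ _ ha hb =>
    refine ⟨fun h => ?_, fun h => ?_⟩
    · rw [map_mul, ← mul_assoc, hb.1, ha.1]
    · rw [psi_mul, ha.2, hb.2, ha.1, map_mul, ← mul_assoc]; ring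
  | inv a _ ha =>
    have e : ∀ h, c (h * q a⁻¹) = c h := by
      intro h
      have := ha.1 (h * q a⁻¹)
      rw [map_inv, inv_mul_cancel_right] at this
      rw [map_inv]; exact this.symm
    refine ⟨e, fun h => ?_⟩
    rw [psi_inv, ha.2, ← map_inv, e, map_inv, inv_mul_cancel_right]; ring

theorem sum_psi (hp : p ≠ 0) (g : G) (κ : G → ZMod p) (hκ : ∀ h, κ (g * h) = κ h + 1)
    (u : FreeGroup S) (h : G) :
    ∑ k ∈ Finset.range p, psi q (fun h s => rhoZ (κ h) * (κ (h * q (of s)) - κ h)) u (g ^ k * h)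
      = κ (h * q u) - κ h := by
  have hk : ∀ (k : ℕ) h, κ (g ^ k * h) = κ h + k := by
    intro k
    induction k with
    | zero => simp
    | succ k ih => intro h; rw [pow_succ', mul_assoc, hκ, ih]; push_cast; ring
  rw [psi_unique (q := q) (fun h s => κ (h * q (of s)) - κ h) (fun u h =>
    ∑ k ∈ Finset.range p, psi q (fun h s => rhoZ (κ h) * (κ (h * q (of s)) - κ h)) u (g ^ k * h))]
  · symm
    apply psi_unique (q := q) _ (fun u h => κ (h * q u) - κ h)
    · intro x y h; simp only [map_mul, mul_assoc]; ring
    · intro s h; rfl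
  · intro x y h
    simp only [psi_mul, Finset.sum_add_distrib, mul_assoc]
  · intro s h
    simp only [psi_of, hk, mul_assoc]
    rw [← one_mul (κ (h * q (of s)) - κ h), ← sum_rhoZ hp (κ h), Finset.sum_mul]
    apply Finset.sum_congr rfl
    intro k _
    ring

end Pride

namespace Pride
open FreeGroup hiding map_mul map_inv map_one
variable {S : Type*} {M : S → S → ℕ∞}

theorem exists_kt (hsymm : ∀ a b : S, M a b = M b a) (htwo : ∀ a b : S, a ≠ b → 2 ≤ M a b)
    (h2dim : TwoDimensional M) {G : Type*} [Group G] (q : FreeGroup S →* G)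
    (hq : ∀ y, q y = 1 ↔ y ∈ Subgroup.normalClosure (artinRels M)) {p : ℕ} (hp : p.Prime)
    {g : G} (hg : g ≠ 1) (hgp : g ^ p = 1) (τ : Ix M) :
    ∃ c : G → ZMod p, (∀ h, c (g * h) = c h + 1) ∧ ∀ h, ∀ s ∈ τ.1, c (h * q (of s)) = c h := by
  let H : Subgroup G := (FF τ).map q
  obtain ⟨κ, hκ⟩ := exists_kappa (X := G ⧸ H) (MulAction.toPerm g) hp (by
    ext x
    rw [← MulAction.toPermHom_apply, ← map_pow, hgp, map_one]) (by
    intro x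
    induction x using QuotientGroup.induction_on with
    | H h =>
      intro hx
      have hx2 : ((g * h : G) : G ⧸ H) = (h : G ⧸ H) := hx
      rw [QuotientGroup.eq] at hx2
      obtain ⟨u, hu, hu2⟩ := hx2
      have e1 : q u = h⁻¹ * g⁻¹ * h⁻¹⁻¹ := by rw [hu2]; group
      have e2 : q (u ^ p) = 1 := by
        rw [map_pow, e1, conj_pow, inv_pow, hgp]; group
      have e3 := parabolic hsymm htwo h2dim τ ((FF τ).pow_mem hu p) ((hq _).1 e2)
      have e4 := tf_local hsymm htwo τ hu hp.ne_zero e3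
      have e5 := (hq u).2 (NN_le τ e4)
      rw [e5] at e1
      apply hg
      calc g = (h * (h⁻¹ * g⁻¹ * h⁻¹⁻¹) * h⁻¹)⁻¹ := by group
        _ = 1 := by rw [← e1]; group)
  refine ⟨fun h => κ (h : G ⧸ H), fun h => hκ h, fun h s hs => ?_⟩
  refine congrArg κ ?_
  rw [QuotientGroup.eq]
  have : q (of s) ∈ H := ⟨of s, Subgroup.subset_closure ⟨s, hs, rfl⟩, rfl⟩
  have h2 := H.inv_mem this
  convert h2 using 1
  group

theorem no_prime (hsymm : ∀ a b : S, M a b = M b a) (htwo : ∀ a b : S, a ≠ b → 2 ≤ M a b)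
    (h2dim : TwoDimensional M) {G : Type*} [Group G] (q : FreeGroup S →* G)
    (hq : ∀ y, q y = 1 ↔ y ∈ Subgroup.normalClosure (artinRels M))
    (hsurj : Function.Surjective q) {p : ℕ} (hp : p.Prime)
    {g : G} (hg : g ≠ 1) (hgp : g ^ p = 1) : False := by
  have : Fact p.Prime := ⟨hp⟩
  obtain ⟨κ, hκ'⟩ := exists_kappa (X := G) (MulAction.toPerm g) hp (by
    ext x
    rw [← MulAction.toPermHom_apply, ← map_pow, hgp, map_one]) (by
    intro x hx
    have hx2 : g * x = x := hx
    exact hg (by simpa using hx2))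
  have hκ : ∀ h, κ (g * h) = κ h + 1 := hκ'
  choose kt hkt1 hkt2 using exists_kt hsymm htwo h2dim q hq hp hg hgp
  let ω : Ix M → G → S → ZMod p := fun τ h s => xi (kt τ h) (κ h) * (κ (h * q (of s)) - κ h)
  let ωρ : G → S → ZMod p := fun h s => rhoZ (κ h) * (κ (h * q (of s)) - κ h)
  have hqK : ∀ τ : Ix M, ∀ y ∈ KK τ, q y = 1 := fun τ y hy => (hq y).2 (NN_le τ hy.2)
  let K : Ix M → Subgroup (Gam q p) := fun τ => (KK τ).map (Gam.th q (ω τ))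
  have hK : ∀ i f, f ∈ K i → Gam.pr f ∈ KK i := by
    rintro i _ ⟨y, hy, rfl⟩
    simpa using hy
  have hcen : ∀ i (k f : Gam q p), Gam.pr k = 1 → f ∈ K i → k * f = f * k := by
    intro i k f hk hf
    exact Gam.commute_of hk (hqK i _ (hK i f hf))
  let Y := artSys hsymm htwo h2dim (Gam.sec : FreeGroup S →* Gam q p) Gam.pr (fun _ => rfl) K hK hcen
    (by
      rintro i a f ha hf
      have hf' := hf
      obtain ⟨y, hy, rfl⟩ := hf'
      refine ⟨_, KK_norm i (mem_FF_letter i a ha) hy, ?_⟩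
      have := hcen i ((Gam.sec (FreeGroup.mk [a]))⁻¹ * Gam.th q (ω i) (FreeGroup.mk [a])) _
        (by rw [map_mul, map_inv, Gam.pr_apply, Gam.pr_apply, Gam.sec_f, Gam.th_f, inv_mul_cancel]) hf
      rw [map_mul, map_mul, map_inv]
      set A := Gam.th q (ω i) (FreeGroup.mk [a])
      set B := (Gam.sec (FreeGroup.mk [a]) : Gam q p)
      set C := Gam.th q (ω i) y
      calc A * C * A⁻¹ = B * (B⁻¹ * A * C) * A⁻¹ := by group
        _ = B * (C * (B⁻¹ * A)) * A⁻¹ := by rw [this]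
        _ = B * C * B⁻¹ := by group)
    (by
      rintro i _ ⟨y, hy, rfl⟩ h
      have : y = 1 := by simpa using h
      rw [this, map_one])
  have hmain : ∀ n x, Y.Ar n x → q x.f = 1 ∧ ∀ h, x.c h - x.c (g * h) = - psi q ωρ x.f h := by
    intro n x hx
    induction hx with
    | one => exact ⟨by simp, by simp [psi_one]⟩
    | cons n x i f γ _ hf ih =>
      have hf' : f ∈ K i := hf
      obtain ⟨y, hy, rfl⟩ := hf'
      have hqy := hqK i y hy
      have hD : ∀ h, psi q (ω i) y h - psi q (ω i) y (g * h) = - psi q ωρ y h := by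
        intro h
        rw [psi_shift, psi_sub]
        have e1 : (fun (h : G) (s : S) => ω i h s - ω i (g * h) s) =
            fun h s => (fun h s => rhoZ (kt i h) * (κ (h * q (of s)) - κ h)) h s - ωρ h s := by
          funext h s
          simp only [ω, ωρ, hkt1, hκ, mul_assoc]
          linear_combination (κ (h * q (of s)) - κ h) * xi_rhoZ hp.ne_zero (kt i h) (κ h)
        rw [e1, ← psi_sub, (psi_local κ (fun h => rhoZ (kt i h)) i.1
          (fun h s hs => by simp only [hkt2 i h s hs]) hy.1).2 h, hqy]
        simp
      have hc1 : ∀ h, (γ * Gam.th q (ω i) y * γ⁻¹ * x).c h =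
          psi q (ω i) y (h * q γ.f) + x.c h := by
        intro h
        simp [hqy, psi]
      have hc2 : ∀ h, psi q ωρ (γ * Gam.th q (ω i) y * γ⁻¹ * x).f h =
          psi q ωρ y (h * q γ.f) + psi q ωρ x.f h := by
        intro h
        simp [psi_mul, psi_inv, hqy]
      refine ⟨by simp [hqy, ih.1], fun h => ?_⟩
      rw [hc1, hc1, hc2]
      have := hD (h * q γ.f)
      rw [mul_assoc]
      linear_combination this + ih.2 h
  obtain ⟨w, hw⟩ := hsurj g
  obtain ⟨n, x, hx, hxw⟩ := exists_ar Y (fun i y hy => ⟨Gam.th q (ω i) y, ⟨y, hy, rfl⟩, Gam.th_f _ _⟩)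
    (w ^ p) ((hq _).1 (by rw [map_pow, hw, hgp]))
  have hxw' : x.f = w ^ p := hxw
  have hsph : Gam.sec w * x * (Gam.sec w)⁻¹ * x⁻¹ = 1 := by
    apply Sys.sphere ((hx.conj (Gam.sec w)).mul hx.inv)
    change w * x.f * w⁻¹ * (x.f)⁻¹ = 1
    rw [hxw']; group
  have hcomm : Gam.sec w * x = x * Gam.sec w := by
    rw [mul_inv_eq_one, mul_inv_eq_iff_eq_mul] at hsph
    exact hsph
  have h1 : x.c g = x.c 1 := by
    have := congrArg (fun z : Gam q p => z.c 1) hcomm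
    simpa [hw] using this
  have h2 := (hmain n x hx).2 1
  rw [mul_one, h1, sub_self, hxw', psi_pow, hw] at h2
  have h3 := sum_psi (q := q) hp.ne_zero g κ hκ w 1
  have h4 := hκ 1
  simp only [one_mul, mul_one, hw] at h2 h3 h4
  rw [h4] at h3
  have h5 : (1 : ZMod p) = 0 := by
    linear_combination h2 - h3
  exact one_ne_zero h5

theorem torsion_free (hsymm : ∀ a b : S, M a b = M b a) (htwo : ∀ a b : S, a ≠ b → 2 ≤ M a b)
    (h2dim : TwoDimensional M) (g : ArtinGroup M) (hg : IsOfFinOrder g) : g = 1 := by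
  by_contra hne
  have h1 : orderOf g ≠ 1 := fun h => hne (orderOf_eq_one_iff.1 h)
  obtain ⟨p, hp, k, hk⟩ := Nat.exists_prime_and_dvd h1
  have hpos := hg.orderOf_pos
  refine no_prime hsymm htwo h2dim (PresentedGroup.mk (artinRels M))
    (fun y => QuotientGroup.eq_one_iff y) (PresentedGroup.mk_surjective _) hp (g := g ^ k) ?_ ?_
  · intro h
    have h2 := orderOf_dvd_of_pow_eq_one h
    have hk0 : 0 < k := by
      rcases Nat.eq_zero_or_pos k with h0 | h0
      · rw [h0, mul_zero] at hk; omega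
      · exact h0
    have h3 := Nat.le_of_dvd hk0 h2
    rw [hk] at h3
    have := hp.two_le
    nlinarith
  · rw [← pow_mul, mul_comm, ← hk, pow_orderOf_eq_one]

end Pride

/-- Every two-dimensional Artin group is torsion-free: the only element of finite order
is the identity. -/
theorem artin_twoDimensional_torsionFree {S : Type*} [Fintype S] (M : S → S → ℕ∞)
    (hsymm : ∀ a b : S, M a b = M b a) (htwo : ∀ a b : S, a ≠ b → 2 ≤ M a b)
    (h2dim : TwoDimensional M) :
    ∀ g : ArtinGroup M, IsOfFinOrder g → g = 1 := by
  exact fun g hg => Pride.torsion_free hsymm htwo h2dim g hg
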